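/- Scalar multivariate Hermite spectral multiplier theorem: let ψ > π/4 and let m be a bounded holomorphic function on the sector Γ_ψ = { (z₁,…,zₙ) ∈ ℂⁿ : |Arg z_j| < ψ, j = 1,…,n }. Define the multiplier operator T_m on the linear span of the n-dimensional Hermite functions by T_m f = ∑_{k = (k₁,…,kₙ) ∈ ℕⁿ} m(2k₁+1, …, 2kₙ+1) c_k(f) h_k, where c_k(f) = ∫_{ℝⁿ} h_k(x) f(x) dx (the sum is finite for f in the span). Then for every 1 < p < ∞ there exists C > 0 such that ‖T_m f‖_{L^p(ℝⁿ)} ≤ C ‖f‖_{L^p(ℝⁿ)} for every f in the linear span of {h_k : k ∈ ℕⁿ}; hence T_m extends to a bounded operator from L^p(ℝⁿ) into itself. -/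

import Mathlib

open MeasureTheory Real Complex ENNReal

/-- The `m`-th physicists' Hermite polynomial
`P_m(u) = (−1)^m e^{u²} (d/du)^m e^{−u²}`. -/
noncomputable def hermitePoly (m : ℕ) (u : ℝ) : ℝ :=
  (-1) ^ m * Real.exp (u ^ 2) * iteratedDeriv m (fun v => Real.exp (-v ^ 2)) u

/-- The `m`-th Hermite function `h_m(u) = (2^m m! √π)^{−1/2} P_m(u) e^{−u²/2}`. -/
noncomputable def hermiteFun (m : ℕ) (u : ℝ) : ℝ :=
  (Real.sqrt (2 ^ m * m.factorial * Real.sqrt Real.pi))⁻¹ * hermitePoly m u *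
    Real.exp (-u ^ 2 / 2)

/-- The `n`-dimensional Hermite function `h_k(x) = ∏_{j=1}^n h_{k_j}(x_j)`,
regarded as a complex-valued function. -/
noncomputable def hermiteFunNC {n : ℕ} (k : Fin n → ℕ) (x : Fin n → ℝ) : ℂ :=
  ((∏ j, hermiteFun (k j) (x j) : ℝ) : ℂ)

/-- The `k`-th Hermite coefficient `c_k(f) = ∫_{ℝⁿ} h_k(x) f(x) dx`. -/
noncomputable def hermiteCoeff {n : ℕ} (k : Fin n → ℕ) (f : (Fin n → ℝ) → ℂ) : ℂ :=
  ∫ x : Fin n → ℝ, hermiteFunNC k x * f x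

/-- The multivariate Hermite spectral multiplier operator
`T_m f = ∑_k m(2k₁+1,…,2kₙ+1) c_k(f) h_k`. -/
noncomputable def hermiteMultiplier {n : ℕ} (m : (Fin n → ℂ) → ℂ)
    (f : (Fin n → ℝ) → ℂ) (x : Fin n → ℝ) : ℂ :=
  ∑ᶠ k : Fin n → ℕ,
    m (fun j => (2 * (k j : ℂ) + 1)) * hermiteCoeff k f * hermiteFunNC k x

/-- The open sector `Γ_ψ = {z ∈ ℂⁿ : |Arg z_j| < ψ, j = 1,…,n}`. -/
def sectorN (n : ℕ) (ψ : ℝ) : Set (Fin n → ℂ) :=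
  {z | ∀ j, |Complex.arg (z j)| < ψ}

namespace HermiteMult

set_option linter.unusedSectionVars false

open Polynomial in
/-- Physicists' Hermite polynomials, as polynomials. -/
noncomputable def hpoly : ℕ → Polynomial ℝ
  | 0 => 1
  | m + 1 => 2 * Polynomial.X * hpoly m - Polynomial.derivative (hpoly m)

/-- The unnormalized Hermite function. -/
noncomputable def hgauss (k : ℕ) (u : ℝ) : ℝ := (hpoly k).eval u * Real.exp (-u ^ 2 / 2)

lemma iteratedDeriv_gauss (m : ℕ) :
    iteratedDeriv m (fun v : ℝ => Real.exp (-v ^ 2)) =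
      fun u => (-1) ^ m * ((hpoly m).eval u * Real.exp (-u ^ 2)) := by
  induction m with
  | zero => simp [hpoly]
  | succ m ih =>
    rw [iteratedDeriv_succ, ih]
    funext u
    have h1 : HasDerivAt (fun v : ℝ => Real.exp (-v ^ 2)) (Real.exp (-u ^ 2) * (-(2 * u))) u := by
      have := ((hasDerivAt_pow 2 u).neg).exp
      simpa using this
    have h2 := ((((hpoly m).hasDerivAt u).mul h1).const_mul ((-1 : ℝ) ^ m)).deriv
    have h3 : deriv (fun u => (-1 : ℝ) ^ m * (Polynomial.eval u (hpoly m) * Real.exp (-u ^ 2))) u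
        = _ := h2
    rw [h3]
    simp only [hpoly, Polynomial.eval_sub, Polynomial.eval_mul, Polynomial.eval_ofNat,
      Polynomial.eval_X]
    ring

lemma hermitePoly_eq (m : ℕ) (u : ℝ) : hermitePoly m u = (hpoly m).eval u := by
  unfold hermitePoly
  rw [iteratedDeriv_gauss]
  have h1 : Real.exp (u ^ 2) * Real.exp (-u ^ 2) = 1 := by
    rw [← Real.exp_add]; simp
  have h2 : ((-1 : ℝ) ^ m) * (-1) ^ m = 1 := by
    rw [← mul_pow]; simp
  calc _ = (((-1 : ℝ) ^ m) * (-1) ^ m) * (Real.exp (u ^ 2) * Real.exp (-u ^ 2)) *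
        (hpoly m).eval u := by ring
    _ = _ := by rw [h1, h2]; ring

/-- Normalization constant of the Hermite function. -/
noncomputable def hnorm (m : ℕ) : ℝ := (Real.sqrt (2 ^ m * m.factorial * Real.sqrt Real.pi))⁻¹

lemma hnorm_ne_zero (m : ℕ) : hnorm m ≠ 0 := by
  unfold hnorm
  have : 0 < (2 : ℝ) ^ m * m.factorial * Real.sqrt Real.pi := by positivity
  exact inv_ne_zero (Real.sqrt_ne_zero'.2 this)

lemma hermiteFun_eq (m : ℕ) (u : ℝ) : hermiteFun m u = hnorm m * hgauss m u := by
  unfold hermiteFun hnorm hgauss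
  rw [hermitePoly_eq]; ring

lemma hpoly_derivative (k : ℕ) :
    Polynomial.derivative (hpoly (k + 1)) = (2 * ((k : Polynomial ℝ) + 1)) * hpoly k := by
  induction k with
  | zero => simp [hpoly]
  | succ k ih =>
    have h : hpoly (k + 1 + 1) = 2 * Polynomial.X * hpoly (k + 1)
      - Polynomial.derivative (hpoly (k + 1)) := rfl
    have h' : hpoly (k + 1) = 2 * Polynomial.X * hpoly k
      - Polynomial.derivative (hpoly k) := rfl
    rw [h, ih]
    simp only [Polynomial.derivative_sub, Polynomial.derivative_mul, ih, Polynomial.derivative_X,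
      Polynomial.derivative_ofNat, Polynomial.derivative_add, Polynomial.derivative_natCast,
      Polynomial.derivative_one]
    rw [h']
    push_cast
    ring

lemma hgauss_zero (u : ℝ) : hgauss 0 u = Real.exp (-u ^ 2 / 2) := by simp [hgauss, hpoly]

lemma hgauss_succ_succ (k : ℕ) (u : ℝ) :
    hgauss (k + 2) u = 2 * u * hgauss (k + 1) u - 2 * ((k : ℝ) + 1) * hgauss k u := by
  have h : hpoly (k + 1 + 1) = 2 * Polynomial.X * hpoly (k + 1)
      - Polynomial.derivative (hpoly (k + 1)) := rfl
  unfold hgauss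
  rw [h, hpoly_derivative]
  simp only [Polynomial.eval_sub, Polynomial.eval_mul, Polynomial.eval_ofNat,
      Polynomial.eval_X, Polynomial.eval_add, Polynomial.eval_natCast, Polynomial.eval_one]
  ring

lemma hgauss_one (u : ℝ) : hgauss 1 u = 2 * u * hgauss 0 u := by
  simp [hgauss, hpoly]

lemma hasDerivAt_hgauss (k : ℕ) (u : ℝ) :
    HasDerivAt (hgauss k) (u * hgauss k u - hgauss (k + 1) u) u := by
  have h1 : HasDerivAt (fun v : ℝ => Real.exp (-v ^ 2 / 2)) (Real.exp (-u ^ 2 / 2) * (-u)) u := by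
    have := (((hasDerivAt_pow 2 u).neg).div_const 2).exp
    refine (this.congr_deriv ?_)
    simp only [Pi.neg_apply, Nat.cast_ofNat]
    ring
  have h2 := ((hpoly k).hasDerivAt u).mul h1
  have h : hpoly (k + 1) = 2 * Polynomial.X * hpoly k
      - Polynomial.derivative (hpoly k) := rfl
  refine h2.congr_deriv ?_
  unfold hgauss
  rw [h]
  simp only [Polynomial.eval_sub, Polynomial.eval_mul, Polynomial.eval_ofNat,
      Polynomial.eval_X]
  ring

lemma continuous_hgauss (k : ℕ) : Continuous (hgauss k) :=
  continuous_iff_continuousAt.2 fun u => (hasDerivAt_hgauss k u).continuousAt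

lemma poly_gauss_bound (q : Polynomial ℝ) :
    ∃ C : ℝ, 0 ≤ C ∧ ∀ u : ℝ, |q.eval u| * Real.exp (-u ^ 2 / 2) ≤ C * Real.exp (-u ^ 2 / 4) := by
  induction q using Polynomial.induction_on' with
  | add p q hp hq =>
    obtain ⟨C, hC, h⟩ := hp
    obtain ⟨D, hD, h'⟩ := hq
    refine ⟨C + D, by positivity, fun u => ?_⟩
    rw [Polynomial.eval_add]
    have := abs_add_le (p.eval u) (q.eval u)
    have h1 := h u
    have h2 := h' u
    have h3 := mul_le_mul_of_nonneg_right this (Real.exp_pos (-u ^ 2 / 2)).le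
    linarith
  | monomial n a =>
    refine ⟨|a| * (n.factorial * Real.exp 1), by positivity, fun u => ?_⟩
    rw [Polynomial.eval_monomial, abs_mul, abs_pow]
    have h1 : |u| ^ n ≤ n.factorial * Real.exp |u| := by
      have := Real.pow_div_factorial_le_exp |u| (abs_nonneg u) n
      rwa [div_le_iff₀' (by positivity)] at this
    have h2 : Real.exp |u| * Real.exp (-u ^ 2 / 2) ≤ Real.exp 1 * Real.exp (-u ^ 2 / 4) := by
      rw [← Real.exp_add, ← Real.exp_add]
      apply Real.exp_le_exp.2
      nlinarith [sq_nonneg (|u| - 2), sq_abs u]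
    calc |a| * |u| ^ n * Real.exp (-u ^ 2 / 2)
        ≤ |a| * (n.factorial * Real.exp |u|) * Real.exp (-u ^ 2 / 2) := by gcongr
      _ = |a| * n.factorial * (Real.exp |u| * Real.exp (-u ^ 2 / 2)) := by ring
      _ ≤ |a| * n.factorial * (Real.exp 1 * Real.exp (-u ^ 2 / 4)) := by gcongr
      _ = _ := by ring

lemma hgauss_bound (k : ℕ) :
    ∃ C : ℝ, 0 ≤ C ∧ ∀ u : ℝ, |hgauss k u| ≤ C * Real.exp (-u ^ 2 / 4) := by
  obtain ⟨C, hC, h⟩ := poly_gauss_bound (hpoly k)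
  refine ⟨C, hC, fun u => ?_⟩
  unfold hgauss
  rw [abs_mul, Real.abs_exp]
  exact h u

lemma integrable_gauss4 : Integrable (fun u : ℝ => Real.exp (-u ^ 2 / 4)) := by
  have := integrable_exp_neg_mul_sq (b := 1 / 4) (by norm_num)
  refine this.congr (Filter.Eventually.of_forall fun u => ?_)
  change Real.exp _ = Real.exp _
  congr 1; ring

/-- A continuous function dominated by a Gaussian is integrable. -/
lemma integrable_of_gauss_bound {E : Type*} [NormedAddCommGroup E] {f : ℝ → E}
    (hf : Continuous f) {C : ℝ} (h : ∀ u, ‖f u‖ ≤ C * Real.exp (-u ^ 2 / 4)) : Integrable f :=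
  (integrable_gauss4.const_mul C).mono' hf.aestronglyMeasurable (Filter.Eventually.of_forall h)

lemma hgauss_abs_le (k : ℕ) : ∃ C : ℝ, ∀ u, |hgauss k u| ≤ C := by
  obtain ⟨C, hC, h⟩ := hgauss_bound k
  refine ⟨C, fun u => (h u).trans ?_⟩
  have : Real.exp (-u ^ 2 / 4) ≤ 1 := Real.exp_le_one_iff.2 (by nlinarith [sq_nonneg u])
  nlinarith

lemma integrable_hgauss (k : ℕ) : Integrable (hgauss k) := by
  obtain ⟨C, hC, h⟩ := hgauss_bound k
  exact integrable_of_gauss_bound (continuous_hgauss k) h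

lemma integrable_hgauss_mul (k l : ℕ) : Integrable (fun u => hgauss k u * hgauss l u) := by
  obtain ⟨C, h⟩ := hgauss_abs_le l
  exact (integrable_hgauss k).mul_bdd (c := C) (continuous_hgauss l).aestronglyMeasurable
    (Filter.Eventually.of_forall h)

lemma two_mul_hgauss (k : ℕ) (u : ℝ) :
    2 * (u * hgauss k u) = hgauss (k + 1) u + 2 * (k : ℝ) * hgauss (k - 1) u := by
  cases k with
  | zero => simp [hgauss_one]; ring
  | succ k =>
    rw [hgauss_succ_succ]
    push_cast
    ring

lemma integrable_id_mul_hgauss (k : ℕ) : Integrable (fun u => u * hgauss k u) := by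
  have := (((integrable_hgauss (k + 1)).add ((integrable_hgauss (k - 1)).const_mul (2 * (k : ℝ)))).const_mul (1 / 2))
  refine this.congr (Filter.Eventually.of_forall fun u => ?_)
  simp only [Pi.add_apply]
  rw [← two_mul_hgauss]; ring

lemma integrable_id_mul_hgauss_mul (k l : ℕ) :
    Integrable (fun u => u * hgauss k u * hgauss l u) := by
  obtain ⟨C, h⟩ := hgauss_abs_le l
  exact (integrable_id_mul_hgauss k).mul_bdd (c := C) (continuous_hgauss l).aestronglyMeasurable
    (Filter.Eventually.of_forall h)

lemma integral_hgauss_succ_mul (k l : ℕ) :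
    ∫ u, hgauss (k + 1) u * hgauss l u = 2 * l * ∫ u, hgauss k u * hgauss (l - 1) u := by
  have hd : ∀ j, Integrable (fun u => u * hgauss j u - hgauss (j + 1) u) := fun j =>
    (integrable_id_mul_hgauss j).sub (integrable_hgauss _)
  have hI1 : Integrable (fun u => hgauss k u * (u * hgauss l u - hgauss (l + 1) u)) := by
    have := (integrable_id_mul_hgauss_mul l k).sub (integrable_hgauss_mul k (l + 1))
    refine this.congr (Filter.Eventually.of_forall fun u => ?_)
    simp only [Pi.sub_apply]; ring
  have hI2 : Integrable (fun u => (u * hgauss k u - hgauss (k + 1) u) * hgauss l u) := by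
    have := (integrable_id_mul_hgauss_mul k l).sub (integrable_hgauss_mul (k + 1) l)
    refine this.congr (Filter.Eventually.of_forall fun u => ?_)
    simp only [Pi.sub_apply]; ring
  have ibp := integral_mul_deriv_eq_deriv_mul_of_integrable
    (fun u _ => hasDerivAt_hgauss k u) (fun u _ => hasDerivAt_hgauss l u)
    hI1 hI2 (integrable_hgauss_mul k l)
  have e1 : ∫ u, hgauss (k + 1) u * hgauss l u
      = (∫ u, u * hgauss k u * hgauss l u)
        - ∫ u, (u * hgauss k u - hgauss (k + 1) u) * hgauss l u := by
    rw [← integral_sub (integrable_id_mul_hgauss_mul k l) hI2]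
    congr 1; funext u; ring
  rw [e1, ← neg_eq_iff_eq_neg.2 ibp, sub_neg_eq_add,
    ← integral_add (integrable_id_mul_hgauss_mul k l) hI1, ← integral_const_mul]
  congr 1; funext u
  have := two_mul_hgauss l u
  linear_combination (hgauss k u) * this

lemma integral_hgauss_mul (k l : ℕ) :
    ∫ u, hgauss k u * hgauss l u = if k = l then 2 ^ k * k.factorial * Real.sqrt Real.pi else 0 := by
  induction k generalizing l with
  | zero =>
    cases l with
    | zero =>
      simp only [if_true, hgauss_zero, ← Real.exp_add]
      have := integral_gaussian 1
      simp at this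
      simp only [pow_zero, Nat.factorial_zero, Nat.cast_one, mul_one, one_mul]
      rw [← this]
      congr 1; funext u; congr 1; ring
    | succ l =>
      have : ∫ u, hgauss 0 u * hgauss (l + 1) u = ∫ u, hgauss (l + 1) u * hgauss 0 u := by
        congr 1; funext u; ring
      rw [this, integral_hgauss_succ_mul]; simp
  | succ k ih =>
    rw [integral_hgauss_succ_mul]
    cases l with
    | zero => simp
    | succ l =>
      simp only [Nat.add_sub_cancel, ih, Nat.add_right_cancel_iff]
      split_ifs with h
      · subst h; push_cast [Nat.factorial_succ, pow_succ]; ring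
      · simp

lemma integral_hermiteFun_mul (k l : ℕ) :
    ∫ u, hermiteFun k u * hermiteFun l u = if k = l then 1 else 0 := by
  have : ∀ u, hermiteFun k u * hermiteFun l u = hnorm k * hnorm l * (hgauss k u * hgauss l u) := by
    intro u; rw [hermiteFun_eq, hermiteFun_eq]; ring
  simp_rw [this]
  rw [integral_const_mul, integral_hgauss_mul]
  split_ifs with h
  · subst h
    have h0 : 0 < (2 : ℝ) ^ k * k.factorial * Real.sqrt Real.pi := by positivity
    unfold hnorm
    rw [← mul_inv, Real.mul_self_sqrt h0.le, inv_mul_cancel₀ h0.ne']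
  · simp

lemma continuous_hermiteFun (k : ℕ) : Continuous (hermiteFun k) := by
  have : hermiteFun k = fun u => hnorm k * hgauss k u := funext (hermiteFun_eq k)
  rw [this]; exact continuous_const.mul (continuous_hgauss k)

lemma hermiteFun_bound (k : ℕ) :
    ∃ C : ℝ, 0 ≤ C ∧ ∀ u : ℝ, |hermiteFun k u| ≤ C * Real.exp (-u ^ 2 / 4) := by
  obtain ⟨C, hC, h⟩ := hgauss_bound k
  refine ⟨|hnorm k| * C, by positivity, fun u => ?_⟩
  rw [hermiteFun_eq, abs_mul, mul_assoc]
  exact mul_le_mul_of_nonneg_left (h u) (abs_nonneg _)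

lemma hermiteFun_abs_le (k : ℕ) : ∃ C : ℝ, ∀ u, |hermiteFun k u| ≤ C := by
  obtain ⟨C, hC, h⟩ := hermiteFun_bound k
  refine ⟨C, fun u => (h u).trans ?_⟩
  have : Real.exp (-u ^ 2 / 4) ≤ 1 := Real.exp_le_one_iff.2 (by nlinarith [sq_nonneg u])
  nlinarith

lemma integrable_hermiteFun (k : ℕ) : Integrable (hermiteFun k) := by
  obtain ⟨C, hC, h⟩ := hermiteFun_bound k
  exact integrable_of_gauss_bound (continuous_hermiteFun k) h

lemma integrable_hermiteFun_mul (k l : ℕ) :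
    Integrable (fun u => hermiteFun k u * hermiteFun l u) := by
  obtain ⟨C, h⟩ := hermiteFun_abs_le l
  exact (integrable_hermiteFun k).mul_bdd (c := C) (continuous_hermiteFun l).aestronglyMeasurable
    (Filter.Eventually.of_forall h)

/-- The complex Gaussian appearing in Mehler's formula. -/
noncomputable def mehlerGauss (w : ℂ) (x y : ℝ) : ℂ :=
  Complex.exp (-((1 / 2) * (1 + w ^ 2) * ((x : ℂ) ^ 2 + (y : ℂ) ^ 2) - 2 * w * x * y) / (1 - w ^ 2))

lemma one_sub_sq_re_pos {w : ℂ} (hw : ‖w‖ < 1) : 0 < (1 - w ^ 2).re := by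
  have h : (w ^ 2).re ≤ ‖w‖ ^ 2 := by
    rw [← norm_pow]; exact Complex.re_le_norm _
  have : ‖w‖ ^ 2 < 1 := by nlinarith [norm_nonneg w]
  simp only [Complex.sub_re, Complex.one_re]; linarith

lemma one_sub_sq_ne_zero {w : ℂ} (hw : ‖w‖ < 1) : 1 - w ^ 2 ≠ 0 := by
  intro h; have := one_sub_sq_re_pos hw; rw [h] at this; simp at this

lemma one_sub_ne_zero_of_norm {w : ℂ} (hw : ‖w‖ < 1) : 1 - w ≠ 0 := by
  intro h
  have : w = 1 := by linear_combination -h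
  rw [this] at hw; simp at hw

lemma one_add_ne_zero_of_norm {w : ℂ} (hw : ‖w‖ < 1) : 1 + w ≠ 0 := by
  intro h
  have : w = -1 := by linear_combination h
  rw [this] at hw; simp at hw

lemma re_one_sub_div_one_add (w : ℂ) :
    ((1 - w) / (1 + w)).re = (1 - ‖w‖ ^ 2) / ‖1 + w‖ ^ 2 := by
  rw [Complex.div_re, ← Complex.normSq_eq_norm_sq, ← Complex.normSq_eq_norm_sq, ← add_div]
  congr 1
  simp [Complex.normSq_apply]; ring

lemma re_one_add_div_one_sub (w : ℂ) :
    ((1 + w) / (1 - w)).re = (1 - ‖w‖ ^ 2) / ‖1 - w‖ ^ 2 := by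
  simpa [sub_neg_eq_add, ← sub_eq_add_neg] using re_one_sub_div_one_add (-w)

lemma mehler_exponent {w : ℂ} (hw : ‖w‖ < 1) (x y : ℂ) :
    -((1 / 2) * (1 + w ^ 2) * (x ^ 2 + y ^ 2) - 2 * w * x * y) / (1 - w ^ 2) =
      -(1 / 4) * ((1 - w) / (1 + w) * (x + y) ^ 2 + (1 + w) / (1 - w) * (x - y) ^ 2) := by
  have h1 := one_sub_ne_zero_of_norm hw
  have h2 := one_add_ne_zero_of_norm hw
  have h3 : 1 - w ^ 2 = (1 - w) * (1 + w) := by ring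
  rw [h3]
  field_simp
  ring

lemma norm_mehlerGauss {w : ℂ} (hw : ‖w‖ < 1) (x y : ℝ) :
    ‖mehlerGauss w x y‖ = Real.exp (-((1 - ‖w‖ ^ 2) / ‖1 + w‖ ^ 2 / 4 * (x + y) ^ 2)) *
      Real.exp (-((1 - ‖w‖ ^ 2) / ‖1 - w‖ ^ 2 / 4 * (x - y) ^ 2)) := by
  unfold mehlerGauss
  rw [Complex.norm_exp, mehler_exponent hw, ← Real.exp_add]
  congr 1
  have e1 : ((x : ℂ) + y) ^ 2 = (((x + y) ^ 2 : ℝ) : ℂ) := by push_cast; ring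
  have e2 : ((x : ℂ) - y) ^ 2 = (((x - y) ^ 2 : ℝ) : ℂ) := by push_cast; ring
  have e3 : (-(1 / 4) : ℂ) = ((-(1 / 4) : ℝ) : ℂ) := by push_cast; ring
  rw [e1, e2, e3, Complex.re_ofReal_mul, Complex.add_re, Complex.re_mul_ofReal,
    Complex.re_mul_ofReal, re_one_sub_div_one_add, re_one_add_div_one_sub]
  ring

lemma norm_mehlerGauss_le_one {w : ℂ} (hw : ‖w‖ < 1) (x y : ℝ) : ‖mehlerGauss w x y‖ ≤ 1 := by
  rw [norm_mehlerGauss hw]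
  have h : 0 ≤ 1 - ‖w‖ ^ 2 := by nlinarith [norm_nonneg w]
  apply mul_le_one₀ _ (Real.exp_pos _).le
  · apply Real.exp_le_one_iff.2
    have : 0 ≤ (1 - ‖w‖ ^ 2) / ‖1 - w‖ ^ 2 / 4 * (x - y) ^ 2 := by positivity
    linarith
  · apply Real.exp_le_one_iff.2
    have : 0 ≤ (1 - ‖w‖ ^ 2) / ‖1 + w‖ ^ 2 / 4 * (x + y) ^ 2 := by positivity
    linarith

lemma mehlerGauss_symm (w : ℂ) (x y : ℝ) : mehlerGauss w x y = mehlerGauss w y x := by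
  unfold mehlerGauss; congr 1; ring

lemma hasDerivAt_mehlerGauss (w : ℂ) (x y : ℝ) :
    HasDerivAt (fun y => mehlerGauss w x y)
      (mehlerGauss w x y * (-((1 + w ^ 2) * y - 2 * w * x) / (1 - w ^ 2))) y := by
  have h1 : HasDerivAt (fun y : ℝ => (y : ℂ)) 1 y := Complex.ofRealCLM.hasDerivAt
  have h2 := ((((((h1.pow 2).const_add ((x : ℂ) ^ 2)).const_mul ((1 / 2) * (1 + w ^ 2))).sub
    (h1.const_mul (2 * w * x))).neg).div_const (1 - w ^ 2)).cexp
  refine h2.congr_deriv ?_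
  unfold mehlerGauss
  congr 1
  simp only [Nat.cast_ofNat]
  ring

lemma continuous_mehlerGauss (w : ℂ) (x : ℝ) : Continuous (fun y => mehlerGauss w x y) :=
  continuous_iff_continuousAt.2 fun y => (hasDerivAt_mehlerGauss w x y).continuousAt

lemma integrable_mehlerGauss_mul {w : ℂ} (hw : ‖w‖ < 1) (x : ℝ) {f : ℝ → ℂ}
    (hf : Integrable f) : Integrable (fun y => mehlerGauss w x y * f y) :=
  hf.bdd_mul (c := 1) (continuous_mehlerGauss w x).aestronglyMeasurable
    (Filter.Eventually.of_forall fun y => norm_mehlerGauss_le_one hw x y)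

lemma integral_mehlerGauss_zero {w : ℂ} (hw : ‖w‖ < 1) (x : ℝ) :
    ∫ y, mehlerGauss w x y * (hgauss 0 y : ℂ) =
      (Real.pi * (1 - w ^ 2)) ^ (1 / 2 : ℂ) * (hgauss 0 x : ℂ) := by
  have h0 := one_sub_sq_ne_zero hw
  have hb : (-(1 / (1 - w ^ 2))).re < 0 := by
    rw [Complex.neg_re, neg_lt_zero, one_div, Complex.inv_re]
    exact div_pos (one_sub_sq_re_pos hw) (Complex.normSq_pos.2 h0)
  have key := integral_cexp_quadratic hb (2 * w * x / (1 - w ^ 2))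
    (-(1 / 2) * (1 + w ^ 2) / (1 - w ^ 2) * (x : ℂ) ^ 2)
  have e1 : ∀ y : ℝ, mehlerGauss w x y * (hgauss 0 y : ℂ) =
      Complex.exp (-(1 / (1 - w ^ 2)) * (y : ℂ) ^ 2 + 2 * w * x / (1 - w ^ 2) * y +
        -(1 / 2) * (1 + w ^ 2) / (1 - w ^ 2) * (x : ℂ) ^ 2) := by
    intro y
    unfold mehlerGauss
    rw [hgauss_zero, Complex.ofReal_exp, ← Complex.exp_add]
    congr 1
    push_cast
    field_simp
    ring
  simp_rw [e1]
  rw [key, hgauss_zero, Complex.ofReal_exp]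
  congr 1
  · congr 1
    field_simp
  · congr 1
    push_cast
    field_simp
    ring

lemma integral_mehlerGauss_succ {w : ℂ} (hw : ‖w‖ < 1) (x : ℝ) (k : ℕ) :
    ∫ y, mehlerGauss w x y * (hgauss (k + 1) y : ℂ) =
      2 * w * x * (∫ y, mehlerGauss w x y * (hgauss k y : ℂ)) -
        2 * k * w ^ 2 * ∫ y, mehlerGauss w x y * (hgauss (k - 1) y : ℂ) := by
  have h0 := one_sub_sq_ne_zero hw
  have hI : ∀ j, Integrable (fun y => mehlerGauss w x y * (hgauss j y : ℂ)) := fun j =>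
    integrable_mehlerGauss_mul hw x (integrable_hgauss j).ofReal
  have hY : Integrable (fun y : ℝ => mehlerGauss w x y * (y * hgauss k y : ℂ)) := by
    have := (integrable_id_mul_hgauss k).ofReal (𝕜 := ℂ)
    push_cast at this
    exact integrable_mehlerGauss_mul hw x this
  have hd : ∀ y : ℝ, HasDerivAt (fun y : ℝ => (hgauss k y : ℂ))
      ((y : ℂ) * hgauss k y - hgauss (k + 1) y) y := fun y => by
    have := (hasDerivAt_hgauss k y).ofReal_comp
    push_cast at this
    exact this
  have hI1 : Integrable (fun y : ℝ => mehlerGauss w x y *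
      ((y : ℂ) * hgauss k y - hgauss (k + 1) y)) := by
    simp_rw [mul_sub]; exact hY.sub (hI _)
  have e2 : ∀ y : ℝ, mehlerGauss w x y * (-((1 + w ^ 2) * y - 2 * w * x) / (1 - w ^ 2)) *
      (hgauss k y : ℂ) = -(1 + w ^ 2) / (1 - w ^ 2) * (mehlerGauss w x y * (y * hgauss k y : ℂ)) +
        2 * w * x / (1 - w ^ 2) * (mehlerGauss w x y * (hgauss k y : ℂ)) := by
    intro y; ring
  have hI2 : Integrable (fun y : ℝ => mehlerGauss w x y *
      (-((1 + w ^ 2) * y - 2 * w * x) / (1 - w ^ 2)) * (hgauss k y : ℂ)) := by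
    simp_rw [e2]; exact (hY.const_mul _).add ((hI k).const_mul _)
  have ibp := integral_mul_deriv_eq_deriv_mul_of_integrable
    (fun y _ => hasDerivAt_mehlerGauss w x y) (fun y _ => hd y) hI1 hI2 (hI k)
  simp_rw [e2, mul_sub] at ibp
  rw [integral_sub hY (hI _), integral_add (hY.const_mul _) ((hI k).const_mul _),
    integral_const_mul, integral_const_mul] at ibp
  have e3 : 2 * ∫ y : ℝ, mehlerGauss w x y * (y * hgauss k y : ℂ) =
      (∫ y, mehlerGauss w x y * (hgauss (k + 1) y : ℂ)) +
        2 * k * ∫ y, mehlerGauss w x y * (hgauss (k - 1) y : ℂ) := by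
    rw [← integral_const_mul, ← integral_const_mul, ← integral_add (hI _) ((hI _).const_mul _)]
    congr 1; funext y
    have := congrArg (fun t : ℝ => (t : ℂ)) (two_mul_hgauss k y)
    push_cast at this
    linear_combination (mehlerGauss w x y) * this
  set A := ∫ y : ℝ, mehlerGauss w x y * (y * hgauss k y : ℂ)
  set B := ∫ y, mehlerGauss w x y * (hgauss (k + 1) y : ℂ)
  set D := ∫ y, mehlerGauss w x y * (hgauss k y : ℂ)
  set F := ∫ y, mehlerGauss w x y * (hgauss (k - 1) y : ℂ)
  field_simp at ibp
  linear_combination (-1 : ℂ) * ibp - w ^ 2 * e3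

lemma integral_mehlerGauss {w : ℂ} (hw : ‖w‖ < 1) (x : ℝ) (k : ℕ) :
    ∫ y, mehlerGauss w x y * (hgauss k y : ℂ) =
      (Real.pi * (1 - w ^ 2)) ^ (1 / 2 : ℂ) * w ^ k * (hgauss k x : ℂ) := by
  induction k using Nat.strong_induction_on with
  | _ k ih =>
    match k, ih with
    | 0, _ => rw [integral_mehlerGauss_zero hw]; simp
    | 1, ih =>
      rw [integral_mehlerGauss_succ hw, ih 0 (by norm_num), hgauss_one]
      push_cast; ring
    | k + 2, ih =>
      rw [integral_mehlerGauss_succ hw, ih (k + 1) (by omega), Nat.add_sub_cancel, ih k (by omega),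
        hgauss_succ_succ]
      push_cast; ring

/-- The Mehler kernel of `exp (-z H)`, `H` the harmonic oscillator. -/
noncomputable def mehler (z : ℂ) (x y : ℝ) : ℂ :=
  Complex.exp (-z) / (Real.pi * (1 - Complex.exp (-2 * z) ^ 2)) ^ (1 / 2 : ℂ) *
    mehlerGauss (Complex.exp (-2 * z)) x y

lemma norm_exp_neg_two_mul (z : ℂ) : ‖Complex.exp (-2 * z)‖ = Real.exp (-2 * z.re) := by
  rw [Complex.norm_exp]; simp

lemma norm_exp_neg_lt {z : ℂ} (hz : 0 < z.re) : ‖Complex.exp (-2 * z)‖ < 1 := by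
  rw [norm_exp_neg_two_mul]; rw [Real.exp_lt_one_iff]; linarith

lemma mehler_symm (z : ℂ) (x y : ℝ) : mehler z x y = mehler z y x := by
  unfold mehler; rw [mehlerGauss_symm]

lemma integral_mehler {z : ℂ} (hz : 0 < z.re) (x : ℝ) (k : ℕ) :
    ∫ y, mehler z x y * (hermiteFun k y : ℂ) =
      Complex.exp (-z * (2 * k + 1)) * (hermiteFun k x : ℂ) := by
  have hw := norm_exp_neg_lt hz
  have hne : ((Real.pi : ℂ) * (1 - Complex.exp (-2 * z) ^ 2)) ^ (1 / 2 : ℂ) ≠ 0 := by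
    rw [Complex.cpow_ne_zero_iff]
    left
    exact mul_ne_zero (by exact_mod_cast Real.pi_ne_zero) (one_sub_sq_ne_zero hw)
  have e1 : ∀ y : ℝ, mehler z x y * (hermiteFun k y : ℂ) =
      (Complex.exp (-z) / (Real.pi * (1 - Complex.exp (-2 * z) ^ 2)) ^ (1 / 2 : ℂ) * hnorm k) *
      (mehlerGauss (Complex.exp (-2 * z)) x y * (hgauss k y : ℂ)) := by
    intro y; unfold mehler; rw [hermiteFun_eq]; push_cast; ring
  simp_rw [e1]
  rw [integral_const_mul, integral_mehlerGauss hw, hermiteFun_eq]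
  have e2 : Complex.exp (-z * (2 * k + 1)) = Complex.exp (-z) * Complex.exp (-2 * z) ^ k := by
    rw [← Complex.exp_nat_mul, ← Complex.exp_add]; congr 1; ring
  rw [e2]
  push_cast
  generalize ((Real.pi : ℂ) * (1 - Complex.exp (-2 * z) ^ 2)) ^ (1 / 2 : ℂ) = P at hne ⊢
  field_simp

lemma lintegral_gauss {b : ℝ} (hb : 0 < b) (c : ℝ) :
    ∫⁻ x : ℝ, ENNReal.ofReal (Real.exp (-(b * (x - c) ^ 2))) = ENNReal.ofReal (Real.sqrt (π / b)) := by
  rw [lintegral_sub_right_eq_self (fun x : ℝ => ENNReal.ofReal (Real.exp (-(b * x ^ 2)))) c]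
  rw [← ofReal_integral_eq_lintegral_ofReal]
  · rw [← integral_gaussian b]; simp only [neg_mul]
  · simpa only [neg_mul] using integrable_exp_neg_mul_sq hb
  · exact Filter.Eventually.of_forall fun x => (Real.exp_pos _).le

lemma abs_mul_exp_le {b : ℝ} (hb : 0 < b) (t : ℝ) :
    |t| * Real.exp (-(b * t ^ 2)) ≤ (Real.sqrt b)⁻¹ * Real.exp (-(b / 2 * t ^ 2)) := by
  have hs : 0 < Real.sqrt b := Real.sqrt_pos.2 hb
  rw [inv_mul_eq_div, le_div_iff₀ hs]
  have e : Real.exp (-(b * t ^ 2)) = Real.exp (-(b / 2 * t ^ 2)) * Real.exp (-(b / 2 * t ^ 2)) := by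
    rw [← Real.exp_add]; congr 1; ring
  have h1 : |t| * Real.sqrt b * Real.exp (-(b / 2 * t ^ 2)) ≤ 1 := by
    rw [Real.exp_neg, ← div_eq_mul_inv, div_le_one (Real.exp_pos _)]
    have h2 := Real.add_one_le_exp (b / 2 * t ^ 2)
    have h3 : (|t| * Real.sqrt b) ^ 2 = b * t ^ 2 := by
      rw [mul_pow, sq_abs, Real.sq_sqrt hb.le]; ring
    nlinarith [sq_nonneg (|t| * Real.sqrt b - 1)]
  rw [e]
  nlinarith [Real.exp_pos (-(b / 2 * t ^ 2))]

lemma lintegral_abs_gauss_le {b : ℝ} (hb : 0 < b) (c : ℝ) :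
    ∫⁻ x : ℝ, ENNReal.ofReal (|x - c| * Real.exp (-(b * (x - c) ^ 2))) ≤
      ENNReal.ofReal (3 / b) := by
  calc _ ≤ ∫⁻ x : ℝ, ENNReal.ofReal (Real.sqrt b)⁻¹ *
        ENNReal.ofReal (Real.exp (-(b / 2 * (x - c) ^ 2))) := by
        refine lintegral_mono fun x => ?_
        rw [← ENNReal.ofReal_mul (by positivity)]
        exact ENNReal.ofReal_le_ofReal (abs_mul_exp_le hb _)
    _ = ENNReal.ofReal ((Real.sqrt b)⁻¹ * Real.sqrt (π / (b / 2))) := by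
        rw [lintegral_const_mul' _ _ ENNReal.ofReal_ne_top, lintegral_gauss (by positivity),
          ENNReal.ofReal_mul (by positivity)]
    _ ≤ _ := by
        apply ENNReal.ofReal_le_ofReal
        have h1 : Real.sqrt (π / (b / 2)) ≤ 3 / Real.sqrt b := by
          apply Real.sqrt_le_iff.2 ⟨by positivity, ?_⟩
          rw [div_pow, Real.sq_sqrt hb.le, div_le_div_iff₀ (by positivity) hb]
          nlinarith [Real.pi_lt_four, Real.pi_pos]
        calc _ ≤ (Real.sqrt b)⁻¹ * (3 / Real.sqrt b) := by gcongr
          _ = 3 / (Real.sqrt b * Real.sqrt b) := by field_simp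
          _ = 3 / b := by rw [Real.mul_self_sqrt hb.le]

section sector
variable {z : ℂ}

lemma norm_one_sub_exp_le (hz : 0 < z.re) (hi : |z.im| ≤ 2 * z.re) {c : ℝ} (hc : 0 < c) :
    ‖1 - Complex.exp (-c * z)‖ ≤ 3 * (1 - Real.exp (-c * z.re)) := by
  have e1 : Complex.exp (-c * z) = (Real.exp (-c * z.re) : ℂ) *
      Complex.exp (((-c * z.im : ℝ) : ℂ) * I) := by
    rw [Complex.ofReal_exp, ← Complex.exp_add]
    congr 1
    conv_lhs => rw [← Complex.re_add_im z]
    push_cast; ring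
  set r := Real.exp (-c * z.re) with hr
  have hr0 : 0 < r := Real.exp_pos _
  have h1 : ‖Complex.exp (((-c * z.im : ℝ) : ℂ) * I) - 1‖ ≤ c * |z.im| := by
    have := Real.norm_exp_I_mul_ofReal_sub_one_le (x := -c * z.im)
    rw [mul_comm] at this
    refine this.trans (le_of_eq ?_)
    rw [Real.norm_eq_abs, abs_mul, abs_neg, abs_of_pos hc]
  have h2 : 1 - r ≥ c * z.re * r := by
    have h3 := Real.add_one_le_exp (c * z.re)
    have h4 : Real.exp (c * z.re) * r = 1 := by rw [hr, ← Real.exp_add]; simp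
    nlinarith
  rw [e1]
  calc ‖1 - (r : ℂ) * Complex.exp (((-c * z.im : ℝ) : ℂ) * I)‖
      = ‖((1 - r : ℝ) : ℂ) - (r : ℂ) * (Complex.exp (((-c * z.im : ℝ) : ℂ) * I) - 1)‖ := by
        congr 1; push_cast; ring
    _ ≤ ‖((1 - r : ℝ) : ℂ)‖ + ‖(r : ℂ) * (Complex.exp (((-c * z.im : ℝ) : ℂ) * I) - 1)‖ :=
        norm_sub_le _ _
    _ ≤ (1 - r) + r * (c * (2 * z.re)) := by
        rw [norm_mul, Complex.norm_real, Complex.norm_real, Real.norm_of_nonneg hr0.le,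
          Real.norm_of_nonneg]
        · gcongr
          exact h1.trans (by gcongr)
        · nlinarith [mul_pos (mul_pos hc hz) hr0]
    _ ≤ _ := by nlinarith

/-- The prefactor of the Mehler kernel. -/
noncomputable def mehlerPre (z : ℂ) : ℂ :=
  Complex.exp (-z) / (Real.pi * (1 - Complex.exp (-2 * z) ^ 2)) ^ (1 / 2 : ℂ)

lemma norm_mehlerPre_le (hz : 0 < z.re) : ‖mehlerPre z‖ ≤ (Real.sqrt z.re)⁻¹ / 3 := by
  unfold mehlerPre
  have hw := norm_exp_neg_lt hz
  set w := Complex.exp (-2 * z) with hwd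
  have hw1 : ‖w‖ = Real.exp (-2 * z.re) := norm_exp_neg_two_mul z
  have h0 : (Real.pi : ℂ) * (1 - w ^ 2) ≠ 0 :=
    mul_ne_zero (by exact_mod_cast Real.pi_ne_zero) (one_sub_sq_ne_zero hw)
  have e1 : ‖((Real.pi : ℂ) * (1 - w ^ 2)) ^ (1 / 2 : ℂ)‖ =
      Real.sqrt (Real.pi * ‖1 - w ^ 2‖) := by
    have : (1 / 2 : ℂ) = ((1 / 2 : ℝ) : ℂ) := by push_cast; ring
    rw [this, Complex.norm_cpow_real, norm_mul, Complex.norm_real,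
      Real.norm_of_nonneg Real.pi_pos.le, Real.sqrt_eq_rpow]
  have e2 : ‖Complex.exp (-z)‖ = Real.sqrt (Real.exp (-2 * z.re)) := by
    rw [Complex.norm_exp, Complex.neg_re, eq_comm, Real.sqrt_eq_iff_mul_self_eq (Real.exp_pos _).le (Real.exp_pos _).le,
      ← Real.exp_add]
    congr 1; ring
  rw [norm_div, e1, e2, ← Real.sqrt_div (Real.exp_pos _).le]
  have h3 : (1 - ‖w‖ ^ 2) ≤ ‖1 - w ^ 2‖ := by
    have := norm_sub_norm_le (1 : ℂ) (w ^ 2)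
    simpa using this
  have h4 : 4 * z.re * Real.exp (-2 * z.re) ≤ 1 - ‖w‖ ^ 2 := by
    rw [hw1]
    have h5 := Real.self_le_sinh_iff.2 (show 0 ≤ 2 * z.re by linarith)
    rw [Real.sinh_eq] at h5
    have h6 : Real.exp (-(2 * z.re)) = Real.exp (-2 * z.re) := by congr 1; ring
    have h7 : Real.exp (2 * z.re) * Real.exp (-2 * z.re) = 1 := by rw [← Real.exp_add]; simp
    rw [h6] at h5
    nlinarith [Real.exp_pos (-2 * z.re)]
  have h8 : 0 < 1 - ‖w‖ ^ 2 := by nlinarith [norm_nonneg w]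
  have h9 : 0 < Real.exp (-2 * z.re) := Real.exp_pos _
  rw [show (Real.sqrt z.re)⁻¹ / 3 = Real.sqrt (z.re⁻¹ / 9) by
    rw [Real.sqrt_div (by positivity), Real.sqrt_inv]; congr 1
    rw [eq_comm, Real.sqrt_eq_iff_mul_self_eq (by norm_num) (by norm_num)]; norm_num]
  apply Real.sqrt_le_sqrt
  have h11 : 0 < ‖1 - w ^ 2‖ := h8.trans_le h3
  rw [div_le_div_iff₀ (by positivity) (by norm_num), inv_mul_eq_div, le_div_iff₀ hz]
  have h10 : Real.pi * (4 * z.re * Real.exp (-2 * z.re)) ≤ Real.pi * ‖1 - w ^ 2‖ := by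
    have := Real.pi_pos
    gcongr
    linarith
  nlinarith [Real.pi_gt_three, mul_pos hz h9]

/-- The two Gaussian rates. -/
noncomputable def rateM (z : ℂ) : ℝ :=
  (1 - ‖Complex.exp (-2 * z)‖ ^ 2) / ‖1 - Complex.exp (-2 * z)‖ ^ 2

noncomputable def rateP (z : ℂ) : ℝ :=
  (1 - ‖Complex.exp (-2 * z)‖ ^ 2) / ‖1 + Complex.exp (-2 * z)‖ ^ 2

lemma rateM_pos (hz : 0 < z.re) : 0 < rateM z := by
  have hw := norm_exp_neg_lt hz
  have h8 : 0 < 1 - ‖Complex.exp (-2 * z)‖ ^ 2 := by nlinarith [norm_nonneg (Complex.exp (-2 * z))]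
  have := norm_pos_iff.2 (one_sub_ne_zero_of_norm hw)
  unfold rateM; positivity

lemma rateP_pos (hz : 0 < z.re) : 0 < rateP z := by
  have hw := norm_exp_neg_lt hz
  have h8 : 0 < 1 - ‖Complex.exp (-2 * z)‖ ^ 2 := by nlinarith [norm_nonneg (Complex.exp (-2 * z))]
  have := norm_pos_iff.2 (one_add_ne_zero_of_norm hw)
  unfold rateP; positivity

lemma inv_rateM_le (hz : 0 < z.re) (hi : |z.im| ≤ 2 * z.re) : (rateM z)⁻¹ ≤ 18 * z.re := by
  have hw := norm_exp_neg_lt hz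
  have h1 := norm_one_sub_exp_le hz hi (c := 2) (by norm_num)
  push_cast at h1
  unfold rateM
  rw [← norm_exp_neg_two_mul] at h1
  have h2 : 1 - ‖Complex.exp (-2 * z)‖ ≤ 2 * z.re := by
    rw [norm_exp_neg_two_mul]
    have := Real.add_one_le_exp (-2 * z.re); linarith
  set w := Complex.exp (-2 * z)
  have h8 : 0 < 1 - ‖w‖ ^ 2 := by nlinarith [norm_nonneg w]
  rw [inv_div, div_le_iff₀ h8]
  have h9 : ‖1 - w‖ ^ 2 ≤ (3 * (1 - ‖w‖)) ^ 2 := by gcongr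
  have h10 : 0 ≤ 1 - ‖w‖ := by linarith
  nlinarith [norm_nonneg w, mul_nonneg h10 (norm_nonneg w), mul_le_mul_of_nonneg_right h2 h10,
    mul_nonneg (mul_nonneg h10 (norm_nonneg w)) hz.le]

lemma norm_ratio_le (hz : 0 < z.re) (hi : |z.im| ≤ 2 * z.re) :
    ‖(1 + Complex.exp (-2 * z)) / (1 - Complex.exp (-2 * z))‖ ≤ 3 * rateM z ∧
    ‖(1 - Complex.exp (-2 * z)) / (1 + Complex.exp (-2 * z))‖ ≤ 3 * rateP z := by
  have hw := norm_exp_neg_lt hz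
  have h1 := norm_one_sub_exp_le hz hi (c := 4) (by norm_num)
  have e1 : Complex.exp (-((4 : ℝ) : ℂ) * z) = Complex.exp (-2 * z) ^ 2 := by
    rw [← Complex.exp_nat_mul]; congr 1; push_cast; ring
  have e2 : Real.exp (-4 * z.re) = ‖Complex.exp (-2 * z)‖ ^ 2 := by
    rw [norm_exp_neg_two_mul, ← Real.exp_nat_mul]; congr 1; push_cast; ring
  rw [e1, e2] at h1
  unfold rateM rateP
  set w := Complex.exp (-2 * z)
  have h2 := norm_pos_iff.2 (one_sub_ne_zero_of_norm hw)
  have h3 := norm_pos_iff.2 (one_add_ne_zero_of_norm hw)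
  have h4 : ‖1 - w ^ 2‖ = ‖1 - w‖ * ‖1 + w‖ := by rw [← norm_mul]; congr 1; ring
  rw [h4] at h1
  constructor
  · rw [norm_div, ← mul_div_assoc, div_le_div_iff₀ h2 (by positivity)]
    nlinarith [mul_le_mul_of_nonneg_right h1 h2.le]
  · rw [norm_div, ← mul_div_assoc, div_le_div_iff₀ h3 (by positivity)]
    nlinarith [mul_le_mul_of_nonneg_right h1 h3.le]

lemma mehler_eq (z : ℂ) (x y : ℝ) :
    mehler z x y = mehlerPre z * mehlerGauss (Complex.exp (-2 * z)) x y := rfl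

lemma norm_mehler (hz : 0 < z.re) (x y : ℝ) :
    ‖mehler z x y‖ = ‖mehlerPre z‖ * (Real.exp (-(rateP z / 4 * (x + y) ^ 2)) *
      Real.exp (-(rateM z / 4 * (x - y) ^ 2))) := by
  rw [mehler_eq, norm_mul, norm_mehlerGauss (norm_exp_neg_lt hz)]; rfl

lemma norm_mehler_le (hz : 0 < z.re) (x y : ℝ) :
    ‖mehler z x y‖ ≤ (Real.sqrt z.re)⁻¹ := by
  rw [mehler_eq, norm_mul]
  have h1 := norm_mehlerPre_le hz
  have h2 := norm_mehlerGauss_le_one (norm_exp_neg_lt hz) x y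
  have h3 : 0 ≤ (Real.sqrt z.re)⁻¹ := by positivity
  calc _ ≤ (Real.sqrt z.re)⁻¹ / 3 * 1 := by gcongr
    _ ≤ _ := by linarith

lemma norm_mehler_le' (hz : 0 < z.re) (x y : ℝ) :
    ‖mehler z x y‖ ≤ (Real.sqrt z.re)⁻¹ / 3 * Real.exp (-(rateM z / 4 * (x - y) ^ 2)) := by
  rw [norm_mehler hz]
  have h1 := norm_mehlerPre_le hz
  have h2 : Real.exp (-(rateP z / 4 * (x + y) ^ 2)) ≤ 1 := by
    apply Real.exp_le_one_iff.2
    have := rateP_pos hz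
    have : 0 ≤ rateP z / 4 * (x + y) ^ 2 := by positivity
    linarith
  calc _ ≤ ‖mehlerPre z‖ * (1 * Real.exp (-(rateM z / 4 * (x - y) ^ 2))) := by gcongr
    _ ≤ _ := by rw [one_mul]; gcongr

lemma sqrt_inv_mul_self (a : ℝ) : (Real.sqrt a)⁻¹ * a = Real.sqrt a := by
  rw [inv_mul_eq_div, Real.div_sqrt]

lemma lintegral_mehler_le (hz : 0 < z.re) (hi : |z.im| ≤ 2 * z.re) (y : ℝ) :
    ∫⁻ x, ‖mehler z x y‖ₑ ≤ ENNReal.ofReal 6 := by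
  have hM := rateM_pos hz
  calc ∫⁻ x, ‖mehler z x y‖ₑ ≤ ∫⁻ x, ENNReal.ofReal ((Real.sqrt z.re)⁻¹ / 3) *
      ENNReal.ofReal (Real.exp (-(rateM z / 4 * (x - y) ^ 2))) := by
        refine lintegral_mono fun x => ?_
        rw [← ENNReal.ofReal_mul (by positivity), ← ofReal_norm]
        exact ENNReal.ofReal_le_ofReal (norm_mehler_le' hz x y)
    _ = ENNReal.ofReal ((Real.sqrt z.re)⁻¹ / 3 * Real.sqrt (π / (rateM z / 4))) := by
        rw [lintegral_const_mul' _ _ ENNReal.ofReal_ne_top, lintegral_gauss (by positivity),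
          ENNReal.ofReal_mul (by positivity)]
    _ ≤ _ := by
        apply ENNReal.ofReal_le_ofReal
        have h := inv_rateM_le hz hi
        have h1 : Real.sqrt (π / (rateM z / 4)) ≤ 18 * Real.sqrt z.re := by
          apply Real.sqrt_le_iff.2 ⟨by positivity, ?_⟩
          rw [mul_pow, Real.sq_sqrt hz.le]
          calc π / (rateM z / 4) = 4 * π * (rateM z)⁻¹ := by field_simp
            _ ≤ 4 * 4 * (18 * z.re) := by gcongr; exact Real.pi_lt_four.le
            _ ≤ _ := by nlinarith
        have hs : 0 < Real.sqrt z.re := Real.sqrt_pos.2 hz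
        calc _ ≤ (Real.sqrt z.re)⁻¹ / 3 * (18 * Real.sqrt z.re) := by gcongr
          _ = 6 := by field_simp; norm_num

lemma lintegral_abs_mul_mehler_le (hz : 0 < z.re) (hi : |z.im| ≤ 2 * z.re) (y : ℝ) :
    ∫⁻ x, ENNReal.ofReal |x - y| * ‖mehler z x y‖ₑ ≤ ENNReal.ofReal (72 * Real.sqrt z.re) := by
  have hM := rateM_pos hz
  calc _ ≤ ∫⁻ x, ENNReal.ofReal ((Real.sqrt z.re)⁻¹ / 3) *
      ENNReal.ofReal (|x - y| * Real.exp (-(rateM z / 4 * (x - y) ^ 2))) := by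
        refine lintegral_mono fun x => ?_
        rw [← ENNReal.ofReal_mul (by positivity), ← ofReal_norm, ← ENNReal.ofReal_mul (by positivity)]
        apply ENNReal.ofReal_le_ofReal
        calc _ ≤ |x - y| * ((Real.sqrt z.re)⁻¹ / 3 * Real.exp (-(rateM z / 4 * (x - y) ^ 2))) := by
              gcongr; exact norm_mehler_le' hz x y
          _ = _ := by ring
    _ ≤ ENNReal.ofReal ((Real.sqrt z.re)⁻¹ / 3) * ENNReal.ofReal (3 / (rateM z / 4)) := by
        rw [lintegral_const_mul' _ _ ENNReal.ofReal_ne_top]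
        gcongr
        exact lintegral_abs_gauss_le (by positivity) y
    _ ≤ _ := by
        rw [← ENNReal.ofReal_mul (by positivity)]
        apply ENNReal.ofReal_le_ofReal
        have h := inv_rateM_le hz hi
        calc _ = (Real.sqrt z.re)⁻¹ * (4 * (rateM z)⁻¹) := by field_simp
          _ ≤ (Real.sqrt z.re)⁻¹ * (4 * (18 * z.re)) := by gcongr
          _ = 72 * ((Real.sqrt z.re)⁻¹ * z.re) := by ring
          _ = _ := by rw [sqrt_inv_mul_self]

/-- The derivative of the Mehler kernel in the second variable. -/
noncomputable def mehlerDeriv (z : ℂ) (x y : ℝ) : ℂ :=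
  mehler z x y * (-((1 + Complex.exp (-2 * z) ^ 2) * y - 2 * Complex.exp (-2 * z) * x) /
    (1 - Complex.exp (-2 * z) ^ 2))

lemma hasDerivAt_mehler (z : ℂ) (x y : ℝ) :
    HasDerivAt (fun y => mehler z x y) (mehlerDeriv z x y) y := by
  have := (hasDerivAt_mehlerGauss (Complex.exp (-2 * z)) x y).const_mul (mehlerPre z)
  refine this.congr_deriv ?_
  unfold mehlerDeriv; rw [mehler_eq]; ring

lemma norm_mehlerDeriv_le (hz : 0 < z.re) (hi : |z.im| ≤ 2 * z.re) (x y : ℝ) :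
    ‖mehlerDeriv z x y‖ ≤ (Real.sqrt z.re)⁻¹ / 2 *
      (rateP z * (|x + y| * Real.exp (-(rateP z / 4 * (x + y) ^ 2))) +
       rateM z * (|x - y| * Real.exp (-(rateM z / 4 * (x - y) ^ 2)))) := by
  have hw := norm_exp_neg_lt hz
  have hP := rateP_pos hz
  have hM := rateM_pos hz
  obtain ⟨r1, r2⟩ := norm_ratio_le hz hi
  have h1 := one_sub_ne_zero_of_norm hw
  have h2 := one_add_ne_zero_of_norm hw
  have e : (-((1 + Complex.exp (-2 * z) ^ 2) * y - 2 * Complex.exp (-2 * z) * x) /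
    (1 - Complex.exp (-2 * z) ^ 2)) =
      (1 / 2) * ((1 + Complex.exp (-2 * z)) / (1 - Complex.exp (-2 * z)) * ((x - y : ℝ) : ℂ)) -
      (1 / 2) * ((1 - Complex.exp (-2 * z)) / (1 + Complex.exp (-2 * z)) * ((x + y : ℝ) : ℂ)) := by
    generalize Complex.exp (-2 * z) = w at *
    have h3 : 1 - w ^ 2 = (1 - w) * (1 + w) := by ring
    rw [h3]
    push_cast
    field_simp
    ring
  have hb : ‖(-((1 + Complex.exp (-2 * z) ^ 2) * y - 2 * Complex.exp (-2 * z) * x) /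
    (1 - Complex.exp (-2 * z) ^ 2))‖ ≤ 3 / 2 * (rateP z * |x + y|) + 3 / 2 * (rateM z * |x - y|) := by
    rw [e]
    refine (norm_sub_le _ _).trans ?_
    rw [norm_mul, norm_mul, norm_mul, norm_mul, Complex.norm_real, Complex.norm_real,
      Real.norm_eq_abs, Real.norm_eq_abs]
    have hh : ‖(1 / 2 : ℂ)‖ = 1 / 2 := by simp
    rw [hh]
    have t1 := mul_le_mul_of_nonneg_right r1 (abs_nonneg (x - y))
    have t2 := mul_le_mul_of_nonneg_right r2 (abs_nonneg (x + y))
    linarith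
  unfold mehlerDeriv
  rw [norm_mul]
  calc _ ≤ ‖mehler z x y‖ * (3 / 2 * (rateP z * |x + y|) + 3 / 2 * (rateM z * |x - y|)) := by gcongr
    _ ≤ _ := by
      rw [norm_mehler hz]
      set s := (Real.sqrt z.re)⁻¹
      have hs : 0 ≤ s := by positivity
      have hp : ‖mehlerPre z‖ ≤ s / 3 := norm_mehlerPre_le hz
      set E1 := Real.exp (-(rateP z / 4 * (x + y) ^ 2)) with hE1
      set E2 := Real.exp (-(rateM z / 4 * (x - y) ^ 2)) with hE2
      have p1 : 0 < E1 := Real.exp_pos _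
      have p2 : 0 < E2 := Real.exp_pos _
      have q1 : E1 ≤ 1 := Real.exp_le_one_iff.2 (by
        have : 0 ≤ rateP z / 4 * (x + y) ^ 2 := by positivity
        linarith)
      have q2 : E2 ≤ 1 := Real.exp_le_one_iff.2 (by
        have : 0 ≤ rateM z / 4 * (x - y) ^ 2 := by positivity
        linarith)
      calc _ = ‖mehlerPre z‖ * (3 / 2 * (rateP z * (|x + y| * (E1 * E2))) +
            3 / 2 * (rateM z * (|x - y| * (E1 * E2)))) := by ring
        _ ≤ s / 3 * (3 / 2 * (rateP z * (|x + y| * (E1 * 1))) +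
            3 / 2 * (rateM z * (|x - y| * (1 * E2)))) := by gcongr
        _ = _ := by ring

lemma lintegral_mehlerDeriv_le (hz : 0 < z.re) (hi : |z.im| ≤ 2 * z.re) (y : ℝ) :
    ∫⁻ x, ‖mehlerDeriv z x y‖ₑ ≤ ENNReal.ofReal (12 * (Real.sqrt z.re)⁻¹) := by
  have hP := rateP_pos hz
  have hM := rateM_pos hz
  have key : ∀ r : ℝ, 0 < r → ∀ c : ℝ, ∫⁻ x : ℝ, ENNReal.ofReal r *
      ENNReal.ofReal (|x - c| * Real.exp (-(r / 4 * (x - c) ^ 2))) ≤ ENNReal.ofReal 12 := by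
    intro r hr c
    rw [lintegral_const_mul' _ _ ENNReal.ofReal_ne_top]
    calc _ ≤ ENNReal.ofReal r * ENNReal.ofReal (3 / (r / 4)) := by
          gcongr; exact lintegral_abs_gauss_le (by positivity) c
      _ = _ := by rw [← ENNReal.ofReal_mul hr.le]; congr 1; field_simp; norm_num
  calc _ ≤ ∫⁻ x, ENNReal.ofReal ((Real.sqrt z.re)⁻¹ / 2) *
      (ENNReal.ofReal (rateP z) * ENNReal.ofReal (|x - -y| * Real.exp (-(rateP z / 4 * (x - -y) ^ 2))) +
       ENNReal.ofReal (rateM z) * ENNReal.ofReal (|x - y| * Real.exp (-(rateM z / 4 * (x - y) ^ 2)))) := by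
        refine lintegral_mono fun x => ?_
        rw [← ENNReal.ofReal_mul hP.le, ← ENNReal.ofReal_mul hM.le,
          ← ENNReal.ofReal_add (by positivity) (by positivity),
          ← ENNReal.ofReal_mul (by positivity), ← ofReal_norm]
        apply ENNReal.ofReal_le_ofReal
        simpa only [sub_neg_eq_add] using norm_mehlerDeriv_le hz hi x y
    _ ≤ ENNReal.ofReal ((Real.sqrt z.re)⁻¹ / 2) * (ENNReal.ofReal 12 + ENNReal.ofReal 12) := by
        rw [lintegral_const_mul' _ _ ENNReal.ofReal_ne_top, lintegral_add_left (by fun_prop)]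
        gcongr
        · exact key _ hP _
        · exact key _ hM _
    _ = _ := by
        rw [← ENNReal.ofReal_add (by norm_num) (by norm_num), ← ENNReal.ofReal_mul (by positivity)]
        congr 1; ring

end sector

lemma measurable_mehler : Measurable (fun p : ℂ × ℝ × ℝ => mehler p.1 p.2.1 p.2.2) := by
  unfold mehler mehlerGauss; fun_prop

lemma measurable_mehlerDeriv : Measurable (fun p : ℂ × ℝ × ℝ => mehlerDeriv p.1 p.2.1 p.2.2) := by
  unfold mehlerDeriv mehler mehlerGauss; fun_prop

lemma continuous_mehlerDeriv (z : ℂ) (x : ℝ) : Continuous (fun y => mehlerDeriv z x y) := by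
  unfold mehlerDeriv mehler mehlerGauss; fun_prop

attribute [local irreducible] mehler mehlerDeriv

lemma lintegral_mehler_sub_le {z : ℂ} (hz : 0 < z.re) (hi : |z.im| ≤ 2 * z.re) (y y' : ℝ) :
    ∫⁻ x, ‖mehler z x y - mehler z x y'‖ₑ ≤
      ENNReal.ofReal (12 * (Real.sqrt z.re)⁻¹ * |y - y'|) := by
  have hm : Measurable (fun p : ℝ × ℝ => mehlerDeriv z p.1 p.2) :=
    measurable_mehlerDeriv.comp (by fun_prop : Measurable fun p : ℝ × ℝ => (z, p.1, p.2))
  calc _ ≤ ∫⁻ x, ∫⁻ t in Set.uIoc y' y, ‖mehlerDeriv z x t‖ₑ := by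
        refine lintegral_mono fun x => ?_
        have := intervalIntegral.integral_eq_sub_of_hasDerivAt
          (fun t _ => hasDerivAt_mehler z x t) ((continuous_mehlerDeriv z x).intervalIntegrable y' y)
        rw [← this, ← ofReal_norm, intervalIntegral.norm_integral_eq_norm_integral_uIoc, ofReal_norm]
        exact enorm_integral_le_lintegral_enorm _
    _ = ∫⁻ t in Set.uIoc y' y, ∫⁻ x, ‖mehlerDeriv z x t‖ₑ := by
        rw [lintegral_lintegral_swap]
        exact hm.enorm.aemeasurable
    _ ≤ ∫⁻ t in Set.uIoc y' y, ENNReal.ofReal (12 * (Real.sqrt z.re)⁻¹) :=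
        lintegral_mono fun t => lintegral_mehlerDeriv_le hz hi t
    _ = _ := by
        rw [setLIntegral_const, Set.uIoc, Real.volume_Ioc, max_sub_min_eq_abs',
          ← ENNReal.ofReal_mul (by positivity), abs_sub_comm]

/-- A family of symmetric integral kernels with the size and smoothness of a parabolic
approximation at frequency `s`. -/
structure HKernel (κ : ℝ → ℝ → ℝ → ℂ) (C : ℝ) : Prop where
  nonneg : 0 ≤ C
  meas : ∀ s, 0 < s → Measurable (Function.uncurry (κ s))
  symm : ∀ s x y, κ s x y = κ s y x
  sup : ∀ s, 0 < s → ∀ x y, ‖κ s x y‖ₑ ≤ ENNReal.ofReal (C * Real.sqrt s)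
  int : ∀ s, 0 < s → ∀ y, ∫⁻ x, ‖κ s x y‖ₑ ≤ ENNReal.ofReal C
  mom : ∀ s, 0 < s → ∀ y, ∫⁻ x, ENNReal.ofReal |x - y| * ‖κ s x y‖ₑ ≤
    ENNReal.ofReal (C * (Real.sqrt s)⁻¹)
  diff : ∀ s, 0 < s → ∀ y y', ∫⁻ x, ‖κ s x y - κ s x y'‖ₑ ≤
    ENNReal.ofReal (C * Real.sqrt s * |y - y'|)

lemma HKernel.star {κ : ℝ → ℝ → ℝ → ℂ} {C : ℝ} (h : HKernel κ C) :
    HKernel (fun s x y => (starRingEnd ℂ) (κ s x y)) C where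
  nonneg := h.nonneg
  meas s hs := Complex.continuous_conj.measurable.comp (h.meas s hs)
  symm s x y := by rw [h.symm]
  sup s hs x y := by simpa only [← ofReal_norm, RCLike.norm_conj] using h.sup s hs x y
  int s hs y := by simpa only [← ofReal_norm, RCLike.norm_conj] using h.int s hs y
  mom s hs y := by simpa only [← ofReal_norm, RCLike.norm_conj] using h.mom s hs y
  diff s hs y y' := by
    simpa only [← map_sub, ← ofReal_norm, RCLike.norm_conj] using h.diff s hs y y'

lemma HKernel.const_mul {κ : ℝ → ℝ → ℝ → ℂ} {C : ℝ} (h : HKernel κ C) (c : ℂ) :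
    HKernel (fun s x y => c * κ s x y) (‖c‖ * C) where
  nonneg := mul_nonneg (norm_nonneg _) h.nonneg
  meas s hs := (h.meas s hs).const_mul c
  symm s x y := by rw [h.symm]
  sup s hs x y := by
    rw [enorm_mul, mul_assoc, ENNReal.ofReal_mul (norm_nonneg _), ofReal_norm]
    gcongr; exact h.sup s hs x y
  int s hs y := by
    simp_rw [enorm_mul]
    rw [lintegral_const_mul' _ _ enorm_ne_top, ENNReal.ofReal_mul (norm_nonneg _), ofReal_norm]
    gcongr; exact h.int s hs y
  mom s hs y := by
    simp_rw [enorm_mul, mul_left_comm _ ‖c‖ₑ]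
    rw [lintegral_const_mul' _ _ enorm_ne_top, mul_assoc, ENNReal.ofReal_mul (norm_nonneg _),
      ofReal_norm]
    gcongr; exact h.mom s hs y
  diff s hs y y' := by
    simp_rw [← mul_sub, enorm_mul]
    rw [lintegral_const_mul' _ _ enorm_ne_top, mul_assoc, mul_assoc,
      ENNReal.ofReal_mul (norm_nonneg _), ofReal_norm]
    gcongr; rw [← mul_assoc]; exact h.diff s hs y y'

lemma HKernel.measurable_left {κ : ℝ → ℝ → ℝ → ℂ} {C : ℝ} (h : HKernel κ C) {s : ℝ} (hs : 0 < s)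
    (y : ℝ) : Measurable fun x => κ s x y :=
  (h.meas s hs).comp (by fun_prop : Measurable fun x : ℝ => (x, y))

lemma HKernel.add {κ κ' : ℝ → ℝ → ℝ → ℂ} {C C' : ℝ} (h : HKernel κ C) (h' : HKernel κ' C') :
    HKernel (fun s x y => κ s x y + κ' s x y) (C + C') where
  nonneg := add_nonneg h.nonneg h'.nonneg
  meas s hs := (h.meas s hs).add (h'.meas s hs)
  symm s x y := by rw [h.symm, h'.symm]
  sup s hs x y := by
    have := h.nonneg
    have := h'.nonneg
    rw [add_mul, ENNReal.ofReal_add (by positivity) (by positivity)]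
    exact (enorm_add_le _ _).trans (add_le_add (h.sup s hs x y) (h'.sup s hs x y))
  int s hs y := by
    have m := h.measurable_left hs y
    rw [ENNReal.ofReal_add h.nonneg h'.nonneg]
    calc _ ≤ ∫⁻ x, ‖κ s x y‖ₑ + ‖κ' s x y‖ₑ := lintegral_mono fun x => enorm_add_le _ _
      _ ≤ _ := by
        rw [lintegral_add_left (by fun_prop)]
        exact add_le_add (h.int s hs y) (h'.int s hs y)
  mom s hs y := by
    have := h.nonneg
    have := h'.nonneg
    have m := h.measurable_left hs y
    rw [add_mul, ENNReal.ofReal_add (by positivity) (by positivity)]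
    calc _ ≤ ∫⁻ x, ENNReal.ofReal |x - y| * ‖κ s x y‖ₑ + ENNReal.ofReal |x - y| * ‖κ' s x y‖ₑ :=
          lintegral_mono fun x => by rw [← mul_add]; gcongr; exact enorm_add_le _ _
      _ ≤ _ := by
        rw [lintegral_add_left (by fun_prop)]
        exact add_le_add (h.mom s hs y) (h'.mom s hs y)
  diff s hs y y' := by
    have := h.nonneg
    have := h'.nonneg
    have m := h.measurable_left hs y
    have m' := h.measurable_left hs y'
    rw [add_mul, add_mul, ENNReal.ofReal_add (by positivity) (by positivity)]
    calc _ ≤ ∫⁻ x, ‖κ s x y - κ s x y'‖ₑ + ‖κ' s x y - κ' s x y'‖ₑ :=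
          lintegral_mono fun x => by
            rw [show κ s x y + κ' s x y - (κ s x y' + κ' s x y') =
              (κ s x y - κ s x y') + (κ' s x y - κ' s x y') by ring]
            exact enorm_add_le _ _
      _ ≤ _ := by
        rw [lintegral_add_left (by fun_prop)]
        exact add_le_add (h.diff s hs y y') (h'.diff s hs y y')

/-- The kernel of `s (σ s + ω H)⁻¹`. -/
noncomputable def resKernel (σ ω : ℂ) (s x y : ℝ) : ℂ :=
  ∫ ρ in Set.Ioi (0 : ℝ), s * Complex.exp (-(σ * s) * ρ) * mehler (ω * ρ) x y

lemma integrableOn_gamma {s α : ℝ} (hs : 0 < s) (hα : 0 < α) :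
    IntegrableOn (fun ρ : ℝ => ρ ^ (α - 1) * Real.exp (-(s * ρ))) (Set.Ioi 0) := by
  have := integrableOn_rpow_mul_exp_neg_mul_rpow (p := 1) (s := α - 1) (b := s) (by linarith)
    one_pos hs
  simpa only [Real.rpow_one, neg_mul] using this

lemma lintegral_gamma {s α : ℝ} (hs : 0 < s) (hα : 0 < α) :
    ∫⁻ ρ in Set.Ioi (0 : ℝ), ENNReal.ofReal (s * Real.exp (-(s * ρ))) * ENNReal.ofReal (ρ ^ (α - 1)) =
      ENNReal.ofReal (s * ((1 / s) ^ α * Real.Gamma α)) := by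
  rw [← Real.integral_rpow_mul_exp_neg_mul_Ioi hα hs, ← integral_const_mul,
    ofReal_integral_eq_lintegral_ofReal]
  · refine setLIntegral_congr_fun measurableSet_Ioi fun ρ hρ => ?_
    rw [← ENNReal.ofReal_mul (by positivity)]
    congr 1; ring
  · exact (integrableOn_gamma hs hα).const_mul s
  · filter_upwards [ae_restrict_mem measurableSet_Ioi] with ρ hρ
    have : (0 : ℝ) < ρ := hρ
    change 0 ≤ s * (ρ ^ (α - 1) * Real.exp (-(s * ρ)))
    positivity

lemma lintegral_gamma_half {s : ℝ} (hs : 0 < s) :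
    ∫⁻ ρ in Set.Ioi (0 : ℝ), ENNReal.ofReal (s * Real.exp (-(s * ρ))) *
      ENNReal.ofReal ((Real.sqrt ρ)⁻¹) ≤ ENNReal.ofReal (2 * Real.sqrt s) := by
  have h := lintegral_gamma hs (α := 1 / 2) (by norm_num)
  have e : ∀ ρ ∈ Set.Ioi (0 : ℝ), ENNReal.ofReal (s * Real.exp (-(s * ρ))) *
      ENNReal.ofReal (ρ ^ ((1 : ℝ) / 2 - 1)) = ENNReal.ofReal (s * Real.exp (-(s * ρ))) *
      ENNReal.ofReal ((Real.sqrt ρ)⁻¹) := by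
    intro ρ hρ
    rw [Real.sqrt_eq_rpow, ← Real.rpow_neg (le_of_lt hρ)]
    norm_num
  rw [setLIntegral_congr_fun measurableSet_Ioi e] at h
  rw [h]
  apply ENNReal.ofReal_le_ofReal
  rw [Real.Gamma_one_half_eq, ← Real.sqrt_eq_rpow, Real.sqrt_div zero_le_one, Real.sqrt_one]
  have h1 : Real.sqrt π ≤ 2 := by
    rw [Real.sqrt_le_iff]; constructor <;> nlinarith [Real.pi_lt_four]
  have h2 : s * (1 / Real.sqrt s) = Real.sqrt s := by rw [mul_one_div, Real.div_sqrt]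
  rw [← mul_assoc, h2]
  nlinarith [Real.sqrt_nonneg s]

lemma lintegral_gamma_three_half {s : ℝ} (hs : 0 < s) :
    ∫⁻ ρ in Set.Ioi (0 : ℝ), ENNReal.ofReal (s * Real.exp (-(s * ρ))) *
      ENNReal.ofReal (Real.sqrt ρ) ≤ ENNReal.ofReal ((Real.sqrt s)⁻¹) := by
  have h := lintegral_gamma hs (α := 1 / 2 + 1) (by norm_num)
  have e : ∀ ρ ∈ Set.Ioi (0 : ℝ), ENNReal.ofReal (s * Real.exp (-(s * ρ))) *
      ENNReal.ofReal (ρ ^ ((1 : ℝ) / 2 + 1 - 1)) = ENNReal.ofReal (s * Real.exp (-(s * ρ))) *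
      ENNReal.ofReal (Real.sqrt ρ) := by
    intro ρ hρ
    rw [Real.sqrt_eq_rpow]
    norm_num
  rw [setLIntegral_congr_fun measurableSet_Ioi e] at h
  rw [h]
  apply ENNReal.ofReal_le_ofReal
  rw [Real.Gamma_add_one (by norm_num), Real.Gamma_one_half_eq, Real.rpow_add (by positivity),
    ← Real.sqrt_eq_rpow, Real.sqrt_div zero_le_one, Real.sqrt_one, Real.rpow_one]
  have h1 : Real.sqrt π ≤ 2 := by
    rw [Real.sqrt_le_iff]; constructor <;> nlinarith [Real.pi_lt_four]
  have h3 : 0 < Real.sqrt s := Real.sqrt_pos.2 hs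
  have : s * (1 / Real.sqrt s * (1 / s) * (1 / 2 * Real.sqrt π)) =
    (Real.sqrt s)⁻¹ * (Real.sqrt π / 2) := by field_simp
  rw [this]
  have h4 : 0 < (Real.sqrt s)⁻¹ := by positivity
  nlinarith

lemma lintegral_gamma_one {s : ℝ} (hs : 0 < s) :
    ∫⁻ ρ in Set.Ioi (0 : ℝ), ENNReal.ofReal (s * Real.exp (-(s * ρ))) = 1 := by
  have h := lintegral_gamma hs (α := 1) (by norm_num)
  have e : ENNReal.ofReal (s * ((1 / s) ^ (1 : ℝ) * Real.Gamma 1)) = 1 := by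
    rw [Real.rpow_one, Real.Gamma_one]; field_simp; simp
  rw [e] at h
  simpa using h

section res
variable {σ ω : ℂ}

lemma norm_res_factor (hσ : σ.re = 1) {s : ℝ} (hs : 0 < s) (ρ : ℝ) :
    ‖(s : ℂ) * Complex.exp (-(σ * s) * ρ)‖ = s * Real.exp (-(s * ρ)) := by
  rw [norm_mul, Complex.norm_real, Real.norm_of_nonneg hs.le, Complex.norm_exp]
  congr 2
  simp [hσ]

lemma enorm_res_factor (hσ : σ.re = 1) {s : ℝ} (hs : 0 < s) (ρ : ℝ) :
    ‖(s : ℂ) * Complex.exp (-(σ * s) * ρ)‖ₑ = ENNReal.ofReal (s * Real.exp (-(s * ρ))) := by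
  rw [← ofReal_norm, norm_res_factor hσ hs]

lemma mul_re_eq (hω : ω.re = 1) (ρ : ℝ) : (ω * (ρ : ℂ)).re = ρ := by simp [hω]

lemma mul_re_pos (hω : ω.re = 1) {ρ : ℝ} (hρ : 0 < ρ) : 0 < (ω * (ρ : ℂ)).re := by
  rwa [mul_re_eq hω]

lemma mul_im_le (hω : ω.re = 1) (hi : |ω.im| ≤ 2) {ρ : ℝ} (hρ : 0 < ρ) :
    |(ω * (ρ : ℂ)).im| ≤ 2 * (ω * (ρ : ℂ)).re := by
  rw [mul_re_eq hω]
  simp only [mul_im, ofReal_im, mul_zero, ofReal_re, zero_add]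
  rw [abs_mul, abs_of_pos hρ]; gcongr

lemma integrableOn_res_bound {s : ℝ} (hs : 0 < s) :
    IntegrableOn (fun ρ : ℝ => s * Real.exp (-(s * ρ)) * (Real.sqrt ρ)⁻¹) (Set.Ioi 0) := by
  have h : IntegrableOn (fun ρ : ℝ => s * (ρ ^ ((1 : ℝ) / 2 - 1) * Real.exp (-(s * ρ))))
      (Set.Ioi 0) := (integrableOn_gamma hs (by norm_num)).const_mul s
  refine h.congr_fun (fun ρ hρ => ?_) measurableSet_Ioi
  have : ρ ^ ((1 : ℝ) / 2 - 1) = (Real.sqrt ρ)⁻¹ := by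
    rw [Real.sqrt_eq_rpow, ← Real.rpow_neg (le_of_lt hρ)]; norm_num
  change s * (_ * _) = _
  rw [this]; ring

lemma norm_res_integrand_le (hσ : σ.re = 1) (hω : ω.re = 1) {s : ℝ} (hs : 0 < s) (x y : ℝ)
    {ρ : ℝ} (hρ : 0 < ρ) :
    ‖(s : ℂ) * Complex.exp (-(σ * s) * ρ) * mehler (ω * ρ) x y‖ ≤
      s * Real.exp (-(s * ρ)) * (Real.sqrt ρ)⁻¹ := by
  rw [norm_mul, norm_res_factor hσ hs]
  have := norm_mehler_le (mul_re_pos hω hρ) x y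
  rw [mul_re_eq hω] at this
  gcongr

lemma measurable_res_integrand (σ ω : ℂ) (s : ℝ) : Measurable (fun p : (ℝ × ℝ) × ℝ =>
    (s : ℂ) * Complex.exp (-(σ * s) * p.2) * mehler (ω * p.2) p.1.1 p.1.2) := by
  have := measurable_mehler.comp
    (by fun_prop : Measurable fun p : (ℝ × ℝ) × ℝ => (ω * (p.2 : ℂ), p.1.1, p.1.2))
  exact Measurable.mul (by fun_prop) this

lemma integrableOn_res_integrand (hσ : σ.re = 1) (hω : ω.re = 1) {s : ℝ} (hs : 0 < s) (x y : ℝ) :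
    IntegrableOn (fun ρ : ℝ => (s : ℂ) * Complex.exp (-(σ * s) * ρ) * mehler (ω * ρ) x y)
      (Set.Ioi 0) := by
  refine (integrableOn_res_bound hs).mono' ?_ ?_
  · exact ((measurable_res_integrand σ ω s).comp
      (by fun_prop : Measurable fun ρ : ℝ => ((x, y), ρ))).aestronglyMeasurable
  · filter_upwards [ae_restrict_mem measurableSet_Ioi] with ρ hρ
    exact norm_res_integrand_le hσ hω hs x y hρ

lemma lintegral_superpose_le {W : ℝ → ℝ≥0∞} (hW : Measurable W) {c : ℝ → ℂ} (hc : Measurable c)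
    {f : ℝ → ℝ → ℂ} (hf : Measurable (Function.uncurry f)) {B : ℝ → ℝ≥0∞}
    (h : ∀ ρ : ℝ, 0 < ρ → ∫⁻ x, W x * ‖f x ρ‖ₑ ≤ B ρ) :
    ∫⁻ x, W x * ‖∫ ρ in Set.Ioi (0 : ℝ), c ρ * f x ρ‖ₑ ≤ ∫⁻ ρ in Set.Ioi (0 : ℝ), ‖c ρ‖ₑ * B ρ := by
  have hfx : ∀ x, Measurable (f x) := fun x => hf.of_uncurry_left
  calc _ ≤ ∫⁻ x, W x * ∫⁻ ρ in Set.Ioi (0 : ℝ), ‖c ρ‖ₑ * ‖f x ρ‖ₑ := by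
        refine lintegral_mono fun x => ?_
        gcongr
        simp_rw [← enorm_mul]
        exact enorm_integral_le_lintegral_enorm _
    _ = ∫⁻ x, ∫⁻ ρ in Set.Ioi (0 : ℝ), W x * (‖c ρ‖ₑ * ‖f x ρ‖ₑ) := by
        refine lintegral_congr fun x => ?_
        rw [lintegral_const_mul]
        have := hfx x
        fun_prop
    _ = ∫⁻ ρ in Set.Ioi (0 : ℝ), ∫⁻ x, W x * (‖c ρ‖ₑ * ‖f x ρ‖ₑ) := by
        rw [lintegral_lintegral_swap]
        apply Measurable.aemeasurable
        exact (hW.comp measurable_fst).mul ((hc.comp measurable_snd).enorm.mul hf.enorm)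
    _ ≤ _ := by
        refine setLIntegral_mono' measurableSet_Ioi fun ρ hρ => ?_
        simp_rw [mul_left_comm (W _)]
        rw [lintegral_const_mul' _ _ enorm_ne_top]
        gcongr
        exact h ρ hρ

lemma resKernel_hKernel (hσ : σ.re = 1) (hω : ω.re = 1) (hi : |ω.im| ≤ 2) :
    HKernel (resKernel σ ω) 72 where
  nonneg := by norm_num
  meas s hs := by
    have := (measurable_res_integrand σ ω s).stronglyMeasurable.integral_prod_right'
      (ν := volume.restrict (Set.Ioi 0))
    exact this.measurable
  symm s x y := by unfold resKernel; simp_rw [mehler_symm _ x y]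
  sup s hs x y := by
    unfold resKernel
    calc _ ≤ ∫⁻ ρ in Set.Ioi (0 : ℝ), _ := enorm_integral_le_lintegral_enorm _
      _ ≤ ∫⁻ ρ in Set.Ioi (0 : ℝ), ENNReal.ofReal (s * Real.exp (-(s * ρ))) *
          ENNReal.ofReal ((Real.sqrt ρ)⁻¹) := by
          refine setLIntegral_mono' measurableSet_Ioi fun ρ hρ => ?_
          rw [← ENNReal.ofReal_mul (by positivity), ← ofReal_norm]
          exact ENNReal.ofReal_le_ofReal (norm_res_integrand_le hσ hω hs x y hρ)
      _ ≤ _ := (lintegral_gamma_half hs).trans (ENNReal.ofReal_le_ofReal (by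
          nlinarith [Real.sqrt_nonneg s]))
  int s hs y := by
    have hm : Measurable (Function.uncurry fun x ρ : ℝ => mehler (ω * ρ) x y) :=
      measurable_mehler.comp (by fun_prop : Measurable fun p : ℝ × ℝ => (ω * (p.2 : ℂ), p.1, y))
    have := lintegral_superpose_le (W := 1) measurable_one
      (c := fun ρ : ℝ => (s : ℂ) * Complex.exp (-(σ * s) * ρ)) (by fun_prop) hm
      (B := fun _ => ENNReal.ofReal 6)
      (fun ρ hρ => by
        simpa using lintegral_mehler_le (mul_re_pos hω hρ) (mul_im_le hω hi hρ) y)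
    simp only [Pi.one_apply, one_mul, enorm_res_factor hσ hs] at this
    refine this.trans ?_
    rw [lintegral_mul_const' _ _ ENNReal.ofReal_ne_top, lintegral_gamma_one hs, one_mul]
    exact ENNReal.ofReal_le_ofReal (by norm_num)
  mom s hs y := by
    have hm : Measurable (Function.uncurry fun x ρ : ℝ => mehler (ω * ρ) x y) :=
      measurable_mehler.comp (by fun_prop : Measurable fun p : ℝ × ℝ => (ω * (p.2 : ℂ), p.1, y))
    have := lintegral_superpose_le (W := fun x => ENNReal.ofReal |x - y|) (by fun_prop)
      (c := fun ρ : ℝ => (s : ℂ) * Complex.exp (-(σ * s) * ρ)) (by fun_prop) hm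
      (B := fun ρ => ENNReal.ofReal 72 * ENNReal.ofReal (Real.sqrt ρ))
      (fun ρ hρ => by
        rw [← ENNReal.ofReal_mul (by norm_num)]
        have := lintegral_abs_mul_mehler_le (mul_re_pos hω hρ) (mul_im_le hω hi hρ) y
        rwa [mul_re_eq hω] at this)
    simp only [enorm_res_factor hσ hs] at this
    refine this.trans ?_
    simp_rw [mul_left_comm _ (ENNReal.ofReal 72)]
    rw [lintegral_const_mul' _ _ ENNReal.ofReal_ne_top, ENNReal.ofReal_mul (by norm_num)]
    gcongr
    exact lintegral_gamma_three_half hs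
  diff s hs y y' := by
    have hm : ∀ y, Measurable (Function.uncurry fun x ρ : ℝ => mehler (ω * ρ) x y) := fun y =>
      measurable_mehler.comp (by fun_prop : Measurable fun p : ℝ × ℝ => (ω * (p.2 : ℂ), p.1, y))
    have := lintegral_superpose_le (W := 1) measurable_one
      (c := fun ρ : ℝ => (s : ℂ) * Complex.exp (-(σ * s) * ρ)) (by fun_prop) 
      (f := fun x ρ => mehler (ω * ρ) x y - mehler (ω * ρ) x y') ((hm y).sub (hm y'))
      (B := fun ρ => ENNReal.ofReal (12 * |y - y'|) * ENNReal.ofReal ((Real.sqrt ρ)⁻¹))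
      (fun ρ hρ => by
        rw [← ENNReal.ofReal_mul (by positivity)]
        have := lintegral_mehler_sub_le (mul_re_pos hω hρ) (mul_im_le hω hi hρ) y y'
        rw [mul_re_eq hω] at this
        simp only [Pi.one_apply, one_mul]
        refine this.trans (le_of_eq ?_)
        congr 1; ring)
    simp only [Pi.one_apply, one_mul, enorm_res_factor hσ hs] at this
    have e : ∀ x, resKernel σ ω s x y - resKernel σ ω s x y' =
        ∫ ρ in Set.Ioi (0 : ℝ), (s : ℂ) * Complex.exp (-(σ * s) * ρ) *
          (mehler (ω * ρ) x y - mehler (ω * ρ) x y') := by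
      intro x
      simp_rw [mul_sub]
      rw [integral_sub (integrableOn_res_integrand hσ hω hs x y)
        (integrableOn_res_integrand hσ hω hs x y')]
      rfl
    simp_rw [e]
    refine this.trans ?_
    simp_rw [mul_left_comm _ (ENNReal.ofReal (12 * |y - y'|))]
    rw [lintegral_const_mul' _ _ ENNReal.ofReal_ne_top]
    calc _ ≤ ENNReal.ofReal (12 * |y - y'|) * ENNReal.ofReal (2 * Real.sqrt s) := by
          gcongr; exact lintegral_gamma_half hs
      _ ≤ _ := by
          rw [← ENNReal.ofReal_mul (by positivity)]
          apply ENNReal.ofReal_le_ofReal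
          nlinarith [mul_nonneg (Real.sqrt_nonneg s) (abs_nonneg (y - y'))]

lemma integral_resKernel (hσ : σ.re = 1) (hω : ω.re = 1) {s : ℝ} (hs : 0 < s) (x : ℝ) (k : ℕ) :
    ∫ y, resKernel σ ω s x y * (hermiteFun k y : ℂ) =
      s / (σ * s + ω * (2 * k + 1)) * (hermiteFun k x : ℂ) := by
  unfold resKernel
  simp_rw [← integral_mul_const]
  rw [integral_integral_swap]
  · have e : ∀ ρ ∈ Set.Ioi (0 : ℝ), ∫ y, (s : ℂ) * Complex.exp (-(σ * s) * ρ) * mehler (ω * ρ) x y *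
        (hermiteFun k y : ℂ) = s * hermiteFun k x * Complex.exp (-(σ * s + ω * (2 * k + 1)) * ρ) := by
      intro ρ hρ
      simp_rw [mul_assoc ((s : ℂ) * Complex.exp (-(σ * s) * ρ))]
      rw [integral_const_mul, integral_mehler (mul_re_pos hω hρ),
        show -(σ * s + ω * (2 * k + 1)) * (ρ : ℂ) =
          -(σ * s) * ρ + -(ω * ρ) * (2 * k + 1) by ring, Complex.exp_add]
      ring
    rw [setIntegral_congr_fun measurableSet_Ioi e, integral_const_mul, integral_exp_mul_complex_Ioi]
    · rw [Complex.ofReal_zero, mul_zero, Complex.exp_zero, neg_div_neg_eq]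
      ring
    · simp [hσ, hω]
      have : (0 : ℝ) ≤ k := Nat.cast_nonneg k
      linarith
  · have hI : Integrable (fun p : ℝ × ℝ => (hermiteFun k p.1) *
        (s * Real.exp (-(s * p.2)) * (Real.sqrt p.2)⁻¹)) (volume.prod (volume.restrict (Set.Ioi 0))) :=
      (integrable_hermiteFun k).mul_prod (integrableOn_res_bound hs)
    refine hI.norm.mono ?_ ?_
    · have h1 := (measurable_res_integrand σ ω s).comp
        (by fun_prop : Measurable fun p : ℝ × ℝ => ((x, p.1), p.2))
      have h2 : Measurable fun p : ℝ × ℝ => ((hermiteFun k p.1 : ℝ) : ℂ) :=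
        Complex.measurable_ofReal.comp ((continuous_hermiteFun k).measurable.comp measurable_fst)
      exact (h1.mul h2).aestronglyMeasurable
    · have : ∀ᵐ p : ℝ × ℝ ∂(volume.prod (volume.restrict (Set.Ioi 0))), 0 < p.2 := by
        have h := (Measure.quasiMeasurePreserving_snd (μ := (volume : Measure ℝ))
          (ν := volume.restrict (Set.Ioi (0 : ℝ)))).ae (ae_restrict_mem measurableSet_Ioi)
        exact h
      filter_upwards [this] with p hp
      simp only [Function.uncurry, norm_mul _ (hermiteFun k p.1 : ℂ), norm_norm]
      rw [norm_mul (hermiteFun k p.1), mul_comm ‖hermiteFun k p.1‖, Complex.norm_real]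
      gcongr
      refine (norm_res_integrand_le hσ hω hs x p.1 hp).trans ?_
      rw [Real.norm_of_nonneg (by positivity)]

end res

/-- The dyadic interval of generation `k` and index `n`. -/
def dyadic (k n : ℤ) : Set ℝ := Set.Ico (n * (2 : ℝ) ^ k) ((n + 1) * (2 : ℝ) ^ k)

lemma mem_dyadic {k n : ℤ} {x : ℝ} : x ∈ dyadic k n ↔ ⌊x / (2 : ℝ) ^ k⌋ = n := by
  have h : (0 : ℝ) < 2 ^ k := by positivity
  rw [Int.floor_eq_iff, dyadic, Set.mem_Ico, le_div_iff₀ h, div_lt_iff₀ h]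

lemma mem_dyadic_floor (k : ℤ) (x : ℝ) : x ∈ dyadic k ⌊x / (2 : ℝ) ^ k⌋ := mem_dyadic.2 rfl

lemma dyadic_subset_parent (k n : ℤ) : dyadic k n ⊆ dyadic (k + 1) (n / 2) := by
  have h : (0 : ℝ) < 2 ^ k := by positivity
  have h1 : 2 * (n / 2) ≤ n := by omega
  have h2 : n + 1 ≤ 2 * (n / 2) + 2 := by omega
  have h1' : 2 * ((n / 2 : ℤ) : ℝ) ≤ n := by exact_mod_cast h1
  have h2' : (n : ℝ) + 1 ≤ 2 * ((n / 2 : ℤ) : ℝ) + 2 := by exact_mod_cast h2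
  unfold dyadic
  rw [zpow_add₀ two_ne_zero, zpow_one]
  apply Set.Ico_subset_Ico <;> nlinarith

lemma dyadic_subset_of_mem {k k' n n' : ℤ} (hk : k ≤ k') {x : ℝ} (hx : x ∈ dyadic k n)
    (hx' : x ∈ dyadic k' n') : dyadic k n ⊆ dyadic k' n' := by
  induction k', hk using Int.leInduction generalizing n' with
  | base => rw [← mem_dyadic.1 hx, ← mem_dyadic.1 hx']
  | succ m hm ih =>
    have h1 := ih (mem_dyadic_floor m x)
    have h2 := dyadic_subset_parent m ⌊x / (2 : ℝ) ^ m⌋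
    have h3 := h2 (mem_dyadic_floor m x)
    have : ⌊x / (2 : ℝ) ^ m⌋ / 2 = n' := by rw [← mem_dyadic.1 h3, ← mem_dyadic.1 hx']
    rw [this] at h2
    exact h1.trans h2

lemma volume_dyadic (k n : ℤ) : volume (dyadic k n) = ENNReal.ofReal ((2 : ℝ) ^ k) := by
  rw [dyadic, Real.volume_Ico]; congr 1; ring

lemma measurableSet_dyadic (k n : ℤ) : MeasurableSet (dyadic k n) := measurableSet_Ico

section maximalIntervals
variable {E : Type*} [NormedAddCommGroup E]

/-- The average of `‖F‖` over the dyadic interval exceeds `s`. -/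
def DyadicBad (F : ℝ → E) (s : ℝ) (k n : ℤ) : Prop :=
  ENNReal.ofReal (s * (2 : ℝ) ^ k) < ∫⁻ x in dyadic k n, ‖F x‖ₑ

/-- Maximal intervals among those with large average. -/
def DyadicSel (F : ℝ → E) (s : ℝ) (q : ℤ × ℤ) : Prop :=
  DyadicBad F s q.1 q.2 ∧ ∀ k' n', q.1 < k' → dyadic q.1 q.2 ⊆ dyadic k' n' → ¬ DyadicBad F s k' n'

lemma dyadicSel_disjoint {F : ℝ → E} {s : ℝ} {q q' : ℤ × ℤ} (h : DyadicSel F s q)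
    (h' : DyadicSel F s q') (hne : q ≠ q') : Disjoint (dyadic q.1 q.2) (dyadic q'.1 q'.2) := by
  rw [Set.disjoint_left]
  intro x hx hx'
  rcases lt_trichotomy q.1 q'.1 with hl | he | hl
  · exact h.2 _ _ hl (dyadic_subset_of_mem hl.le hx hx') h'.1
  · apply hne
    refine Prod.ext he ?_
    rw [← mem_dyadic.1 hx, ← mem_dyadic.1 hx', he]
  · exact h'.2 _ _ hl (dyadic_subset_of_mem hl.le hx' hx) h.1

lemma exists_dyadicSel {F : ℝ → E} (hF : Integrable F) {s : ℝ} (hs : 0 < s) {k n : ℤ}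
    (hb : DyadicBad F s k n) {x : ℝ} (hx : x ∈ dyadic k n) :
    ∃ q, DyadicSel F s q ∧ x ∈ dyadic q.1 q.2 := by
  set I := ∫⁻ x, ‖F x‖ₑ with hI
  have hfin : I ≠ ∞ := hF.2.ne
  obtain ⟨N, hN⟩ := pow_unbounded_of_one_lt (I.toReal / s) (one_lt_two (α := ℝ))
  have hbd : ∀ z : ℤ, DyadicBad F s z ⌊x / (2 : ℝ) ^ z⌋ → z ≤ N := by
    intro z hz
    by_contra hlt
    push Not at hlt
    have h1 : ENNReal.ofReal (s * (2 : ℝ) ^ z) < I := lt_of_lt_of_le hz (setLIntegral_le_lintegral _ _)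
    rw [ENNReal.ofReal_lt_iff_lt_toReal (by positivity) hfin] at h1
    have h2 : (2 : ℝ) ^ N ≤ 2 ^ z := by
      rw [← zpow_natCast]; exact zpow_le_zpow_right₀ one_le_two hlt.le
    rw [div_lt_iff₀ hs] at hN
    nlinarith
  rw [← mem_dyadic.1 hx] at hb
  obtain ⟨K, hK, hmax⟩ := Int.exists_greatest_of_bdd ⟨N, hbd⟩ ⟨k, hb⟩
  refine ⟨(K, ⌊x / (2 : ℝ) ^ K⌋), ⟨hK, fun k' n' hlt hsub hbad => ?_⟩, mem_dyadic_floor K x⟩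
  have := hsub (mem_dyadic_floor K x)
  rw [← mem_dyadic.1 this] at hbad
  exact absurd (hmax _ hbad) (not_le.2 hlt)

lemma exists_dyadicBad {F : ℝ → E} (hF : Continuous F) {s : ℝ} (hs : 0 < s) {x : ℝ}
    (hx : s < ‖F x‖) : ∃ k n, DyadicBad F s k n ∧ x ∈ dyadic k n := by
  obtain ⟨t, hst, ht⟩ := exists_between hx
  have hopen : IsOpen {y | t < ‖F y‖} := isOpen_lt continuous_const hF.norm
  obtain ⟨ε, hε, hball⟩ := Metric.isOpen_iff.1 hopen x ht
  obtain ⟨N, hN⟩ := exists_pow_lt_of_lt_one hε (show (1 / 2 : ℝ) < 1 by norm_num)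
  have hp : (2 : ℝ) ^ (-(N : ℤ)) < ε := by
    rw [zpow_neg, zpow_natCast]; simpa using hN
  have h0 : (0 : ℝ) < 2 ^ (-(N : ℤ)) := by positivity
  refine ⟨-N, ⌊x / (2 : ℝ) ^ (-(N : ℤ))⌋, ?_, mem_dyadic_floor _ x⟩
  have hx0 := mem_dyadic_floor (-(N : ℤ)) x
  set n := ⌊x / (2 : ℝ) ^ (-(N : ℤ))⌋
  unfold DyadicBad
  calc ENNReal.ofReal (s * 2 ^ (-(N : ℤ))) < ENNReal.ofReal (t * 2 ^ (-(N : ℤ))) := by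
        apply (ENNReal.ofReal_lt_ofReal_iff (mul_pos (hs.trans hst) h0)).2
        gcongr
    _ = ∫⁻ y in dyadic (-N) n, ENNReal.ofReal t := by
        rw [setLIntegral_const, volume_dyadic, ENNReal.ofReal_mul (hs.trans hst).le]
    _ ≤ _ := by
        refine setLIntegral_mono' (measurableSet_dyadic _ _) fun y hy => ?_
        rw [← ofReal_norm]
        apply ENNReal.ofReal_le_ofReal
        have : y ∈ Metric.ball x ε := by
          rw [Metric.mem_ball, Real.dist_eq, abs_lt]
          unfold dyadic at hx0 hy
          constructor <;> linarith [hx0.1, hx0.2, hy.1, hy.2]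
        exact (hball this).le

/-- A Calderón–Zygmund family of intervals for `F` at height `s`. -/
structure CZFamily (F : ℝ → E) (s : ℝ) (Q : Type) (I : Q → Set ℝ) (c r : Q → ℝ) : Prop where
  r_pos : ∀ q, 0 < r q
  meas : ∀ q, MeasurableSet (I q)
  disj : Pairwise (Function.onFun Disjoint I)
  sub : ∀ q, ∀ y ∈ I q, |y - c q| ≤ r q
  vol : ∀ q, volume (I q) = ENNReal.ofReal (2 * r q)
  lower : ∀ q, ENNReal.ofReal s * volume (I q) ≤ ∫⁻ x in I q, ‖F x‖ₑ
  upper : ∀ q, ∫⁻ x in I q, ‖F x‖ₑ ≤ 2 * ENNReal.ofReal s * volume (I q)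
  off : ∀ x, (∀ q, x ∉ I q) → ‖F x‖ ≤ s

lemma exists_czFamily {F : ℝ → E} (hF : Continuous F) (hFi : Integrable F) {s : ℝ} (hs : 0 < s) :
    CZFamily F s {q // DyadicSel F s q} (fun q => dyadic q.1.1 q.1.2)
      (fun q => (q.1.2 + 1 / 2) * (2 : ℝ) ^ q.1.1) (fun q => (2 : ℝ) ^ q.1.1 / 2) where
  r_pos q := by positivity
  meas q := measurableSet_dyadic _ _
  disj q q' h := dyadicSel_disjoint q.2 q'.2 fun e => h (Subtype.ext e)
  sub q y hy := by
    unfold dyadic at hy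
    rw [abs_le]
    constructor <;> linarith [hy.1, hy.2]
  vol q := by rw [volume_dyadic]; congr 1; ring
  lower q := by
    rw [volume_dyadic, ← ENNReal.ofReal_mul hs.le]; exact q.2.1.le
  upper q := by
    have h := q.2.2 (q.1.1 + 1) (q.1.2 / 2) (by omega) (dyadic_subset_parent _ _)
    unfold DyadicBad at h
    push Not at h
    refine (lintegral_mono_set (dyadic_subset_parent q.1.1 q.1.2)).trans (h.trans (le_of_eq ?_))
    rw [volume_dyadic, zpow_add₀ two_ne_zero, zpow_one, ENNReal.ofReal_mul hs.le,
      ENNReal.ofReal_mul (by positivity), ENNReal.ofReal_ofNat]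
    ring
  off x hx := by
    by_contra hlt
    push Not at hlt
    obtain ⟨k, n, hb, hxm⟩ := exists_dyadicBad hF hs hlt
    obtain ⟨q, hq, hxq⟩ := exists_dyadicSel hFi hs hb hxm
    exact hx ⟨q, hq⟩ hxq

end maximalIntervals

section cz
variable {E E' : Type*} [NormedAddCommGroup E] [NormedSpace ℂ E] [CompleteSpace E]
  [NormedAddCommGroup E'] [NormedSpace ℂ E'] [CompleteSpace E']

/-- The integral operator with kernel `K`. -/
noncomputable def opT (K : ℝ → ℝ → E →L[ℂ] E') (F : ℝ → E) (x : ℝ) : E' := ∫ y, K x y (F y)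

/-- A bounded measurable kernel satisfying Hörmander's condition. -/
structure CZKernel (K : ℝ → ℝ → E →L[ℂ] E') (D : ℝ) (A : ℝ≥0∞) : Prop where
  meas : StronglyMeasurable (Function.uncurry K)
  sup : ∀ x y, ‖K x y‖ ≤ D
  hor : ∀ c r : ℝ, 0 < r → ∀ y, |y - c| ≤ r →
    ∫⁻ x in {x | 2 * r ≤ |x - c|}, ‖K x y - K x c‖ₑ ≤ A

variable {K : ℝ → ℝ → E →L[ℂ] E'} {D : ℝ} {A : ℝ≥0∞}

lemma aestronglyMeasurable_clm_apply {α : Type*} [MeasurableSpace α] {μ : Measure α}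
    {L : α → E →L[ℂ] E'} {f : α → E} (hL : AEStronglyMeasurable L μ)
    (hf : AEStronglyMeasurable f μ) : AEStronglyMeasurable (fun a => L a (f a)) μ :=
  (isBoundedBilinearMap_apply (𝕜 := ℂ) (E := E) (F := E')).continuous.comp_aestronglyMeasurable
    (hL.prodMk hf)

lemma CZKernel.stronglyMeasurable_right (hK : CZKernel K D A) (x : ℝ) :
    StronglyMeasurable (K x) :=
  hK.meas.comp_measurable (by fun_prop : Measurable fun y : ℝ => (x, y))

lemma CZKernel.stronglyMeasurable_left (hK : CZKernel K D A) (y : ℝ) :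
    StronglyMeasurable (fun x => K x y) :=
  hK.meas.comp_measurable (by fun_prop : Measurable fun x : ℝ => (x, y))

lemma CZKernel.integrable (hK : CZKernel K D A) {F : ℝ → E} (hF : Integrable F) (x : ℝ) :
    Integrable (fun y => K x y (F y)) := by
  refine (hF.norm.const_mul D).mono'
    (aestronglyMeasurable_clm_apply (hK.stronglyMeasurable_right x).aestronglyMeasurable hF.1) ?_
  exact Filter.Eventually.of_forall fun y => (K x y).le_of_opNorm_le (hK.sup x y) _

lemma CZKernel.aestronglyMeasurable_opT (hK : CZKernel K D A) {F : ℝ → E}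
    (hF : AEStronglyMeasurable F) : AEStronglyMeasurable (opT K F) := by
  have : AEStronglyMeasurable (fun p : ℝ × ℝ => K p.1 p.2 (F p.2)) (volume.prod volume) :=
    aestronglyMeasurable_clm_apply hK.meas.aestronglyMeasurable hF.comp_snd
  exact this.integral_prod_right'

section family
variable {F : ℝ → E} {s : ℝ} {Q : Type} {I : Q → Set ℝ} {c r : Q → ℝ}

open Classical in
/-- The good part of the decomposition. -/
noncomputable def czGood (F : ℝ → E) (I : Q → Set ℝ) (x : ℝ) : E :=
  if h : ∃ q, x ∈ I q then ⨍ y in I h.choose, F y else F x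

lemma CZFamily.good_on (h : CZFamily F s Q I c r) {q : Q} {x : ℝ} (hx : x ∈ I q) :
    czGood F I x = ⨍ y in I q, F y := by
  have hex : ∃ q, x ∈ I q := ⟨q, hx⟩
  unfold czGood
  rw [dif_pos hex]
  have : hex.choose = q := by
    by_contra hne
    exact Set.disjoint_left.1 (h.disj hne) hex.choose_spec hx
  rw [this]

lemma good_off {x : ℝ} (hx : x ∉ ⋃ q, I q) : czGood F I x = F x := by
  unfold czGood
  rw [dif_neg]
  simpa using hx

lemma CZFamily.vol_ne_zero (h : CZFamily F s Q I c r) (q : Q) : volume (I q) ≠ 0 := by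
  rw [h.vol]; have := h.r_pos q; simp; linarith

lemma CZFamily.vol_ne_top (h : CZFamily F s Q I c r) (q : Q) : volume (I q) ≠ ∞ := by
  rw [h.vol]; exact ENNReal.ofReal_ne_top

lemma CZFamily.enorm_avg_mul_le (h : CZFamily F s Q I c r) (q : Q) :
    ‖⨍ y in I q, F y‖ₑ * volume (I q) ≤ ∫⁻ y in I q, ‖F y‖ₑ := by
  have h1 : ‖(volume.real (I q))⁻¹‖ₑ = (volume (I q))⁻¹ := by
    have hp : 0 < volume.real (I q) := ENNReal.toReal_pos (h.vol_ne_zero q) (h.vol_ne_top q)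
    rw [← ofReal_norm, Real.norm_of_nonneg (by positivity), ENNReal.ofReal_inv_of_pos hp,
      Measure.real, ENNReal.ofReal_toReal (h.vol_ne_top q)]
  rw [setAverage_eq, enorm_smul, h1, mul_comm, ← mul_assoc,
    ENNReal.mul_inv_cancel (h.vol_ne_zero q) (h.vol_ne_top q), one_mul]
  exact enorm_integral_le_lintegral_enorm _

lemma CZFamily.enorm_avg_le (h : CZFamily F s Q I c r) (q : Q) :
    ‖⨍ y in I q, F y‖ₑ ≤ 2 * ENNReal.ofReal s := by
  have := (h.enorm_avg_mul_le q).trans (h.upper q)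
  exact (ENNReal.mul_le_mul_iff_left (h.vol_ne_zero q) (h.vol_ne_top q)).1 this

lemma CZFamily.enorm_good_le (h : CZFamily F s Q I c r) (x : ℝ) :
    ‖czGood F I x‖ₑ ≤ 2 * ENNReal.ofReal s := by
  by_cases hx : x ∈ ⋃ q, I q
  · obtain ⟨q, hq⟩ := Set.mem_iUnion.1 hx
    rw [h.good_on hq]; exact h.enorm_avg_le q
  · rw [good_off hx, ← ofReal_norm]
    have := ENNReal.ofReal_le_ofReal (h.off x (by simpa using hx))
    exact this.trans (le_mul_of_one_le_left' one_le_two)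

lemma CZFamily.lintegral_good_le (h : CZFamily F s Q I c r) (q : Q) :
    ∫⁻ x in I q, ‖czGood F I x‖ₑ ≤ ∫⁻ x in I q, ‖F x‖ₑ := by
  rw [setLIntegral_congr_fun (h.meas q) (fun x hx => by rw [h.good_on hx]), setLIntegral_const]
  exact h.enorm_avg_mul_le q

variable [Countable Q]

lemma CZFamily.measurableSet_union (h : CZFamily F s Q I c r) : MeasurableSet (⋃ q, I q) :=
  MeasurableSet.iUnion h.meas

lemma CZFamily.good_aesm (h : CZFamily F s Q I c r) (hF : AEStronglyMeasurable F) :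
    AEStronglyMeasurable (czGood F I) := by
  rw [← Measure.restrict_univ (μ := volume), ← Set.union_compl_self (⋃ q, I q),
    aestronglyMeasurable_union_iff]
  refine ⟨aestronglyMeasurable_iUnion_iff.2 fun q => ?_, ?_⟩
  · refine (aestronglyMeasurable_const (b := ⨍ y in I q, F y)).congr ?_
    filter_upwards [ae_restrict_mem (h.meas q)] with x hx
    rw [h.good_on hx]
  · refine (hF.restrict (s := (⋃ q, I q)ᶜ)).congr ?_
    filter_upwards [ae_restrict_mem h.measurableSet_union.compl] with x hx
    rw [good_off hx]

lemma CZFamily.lintegral_union (h : CZFamily F s Q I c r) (f : ℝ → ℝ≥0∞) :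
    ∫⁻ x in ⋃ q, I q, f x = ∑' q, ∫⁻ x in I q, f x :=
  lintegral_iUnion h.meas h.disj f

lemma CZFamily.good_integrable (h : CZFamily F s Q I c r) (hF : Integrable F) :
    Integrable (czGood F I) := by
  refine ⟨h.good_aesm hF.1, ?_⟩
  have h1 := lintegral_add_compl (μ := volume) (fun x => ‖czGood F I x‖ₑ) h.measurableSet_union
  have h2 := lintegral_add_compl (μ := volume) (fun x => ‖F x‖ₑ) h.measurableSet_union
  unfold HasFiniteIntegral
  refine lt_of_le_of_lt ?_ hF.2
  rw [← h1, ← h2]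
  apply add_le_add
  · rw [h.lintegral_union, h.lintegral_union]
    exact ENNReal.tsum_le_tsum fun q => h.lintegral_good_le q
  · apply le_of_eq
    exact setLIntegral_congr_fun h.measurableSet_union.compl fun x hx => by rw [good_off hx]

lemma CZFamily.lintegral_good_sq_le (h : CZFamily F s Q I c r) :
    ∫⁻ x, ‖czGood F I x‖ₑ ^ 2 ≤ (∫⁻ x in {x | ‖F x‖ ≤ s}, ‖F x‖ₑ ^ 2) +
      4 * ENNReal.ofReal s ^ 2 * volume (⋃ q, I q) := by
  rw [← lintegral_add_compl (μ := volume) (fun x => ‖czGood F I x‖ₑ ^ 2) h.measurableSet_union,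
    add_comm]
  apply add_le_add
  · rw [setLIntegral_congr_fun h.measurableSet_union.compl fun x hx => by rw [good_off hx]]
    apply lintegral_mono_set
    intro x hx
    exact h.off x (by simpa using hx)
  · calc _ ≤ ∫⁻ x in ⋃ q, I q, (2 * ENNReal.ofReal s) ^ 2 := by
          refine lintegral_mono fun x => ?_
          gcongr; exact h.enorm_good_le x
      _ = _ := by rw [setLIntegral_const]; ring

lemma CZFamily.volume_union_eq (h : CZFamily F s Q I c r) :
    volume (⋃ q, I q) = ∑' q, volume (I q) := measure_iUnion h.disj h.meas

lemma CZFamily.volume_star_le (h : CZFamily F s Q I c r) :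
    volume (⋃ q, {x | |x - c q| < 2 * r q}) ≤ 2 * volume (⋃ q, I q) := by
  rw [h.volume_union_eq, ← ENNReal.tsum_mul_left]
  refine (measure_iUnion_le _).trans (ENNReal.tsum_le_tsum fun q => ?_)
  have : {x | |x - c q| < 2 * r q} = Metric.ball (c q) (2 * r q) := by
    ext x; rw [Metric.mem_ball, Real.dist_eq]; rfl
  rw [this, Real.volume_ball, h.vol, ENNReal.ofReal_mul zero_le_two, ENNReal.ofReal_ofNat]

lemma CZFamily.volume_union_le (h : CZFamily F s Q I c r) (hs : 0 < s)
    (hm : Continuous F) :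
    volume (⋃ q, I q) ≤ 2 * (ENNReal.ofReal s)⁻¹ * ∫⁻ x in {x | s < 2 * ‖F x‖}, ‖F x‖ₑ := by
  have hs0 : ENNReal.ofReal s ≠ 0 := by simpa using hs
  have hst : ENNReal.ofReal s ≠ ∞ := ENNReal.ofReal_ne_top
  have hmS : MeasurableSet {x | s < 2 * ‖F x‖} :=
    (isOpen_lt continuous_const (hm.norm.const_smul (2 : ℝ))).measurableSet
  have key : ∀ q, ENNReal.ofReal s * volume (I q) ≤
      2 * ∫⁻ x in I q ∩ {x | s < 2 * ‖F x‖}, ‖F x‖ₑ := by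
    intro q
    have h1 : ENNReal.ofReal s * volume (I q) + ENNReal.ofReal s * volume (I q) ≤
        2 * (∫⁻ x in I q ∩ {x | s < 2 * ‖F x‖}, ‖F x‖ₑ) + ENNReal.ofReal s * volume (I q) := by
      rw [← two_mul]
      calc _ ≤ 2 * ∫⁻ x in I q, ‖F x‖ₑ := by gcongr; exact h.lower q
        _ = 2 * ((∫⁻ x in I q ∩ {x | s < 2 * ‖F x‖}, ‖F x‖ₑ) +
            ∫⁻ x in I q \ {x | s < 2 * ‖F x‖}, ‖F x‖ₑ) := by
            rw [lintegral_inter_add_sdiff _ _ hmS]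
        _ ≤ 2 * ((∫⁻ x in I q ∩ {x | s < 2 * ‖F x‖}, ‖F x‖ₑ) +
            ENNReal.ofReal (s / 2) * volume (I q)) := by
            gcongr
            calc _ ≤ ∫⁻ x in I q \ {x | s < 2 * ‖F x‖}, ENNReal.ofReal (s / 2) := by
                  refine setLIntegral_mono' ((h.meas q).diff hmS) fun x hx => ?_
                  rw [← ofReal_norm]
                  apply ENNReal.ofReal_le_ofReal
                  have := hx.2
                  simp only [Set.mem_ofPred_eq, not_lt] at this
                  linarith
              _ ≤ _ := by
                  rw [setLIntegral_const]; gcongr; exact Set.sdiff_subset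
        _ = _ := by
            rw [mul_add, ← mul_assoc 2 (ENNReal.ofReal (s / 2)), ← ENNReal.ofReal_ofNat,
              ← ENNReal.ofReal_mul (by norm_num)]
            congr 3; ring
    exact (ENNReal.add_le_add_iff_right (ENNReal.mul_ne_top hst (h.vol_ne_top q))).1 h1
  have h2 : ENNReal.ofReal s * volume (⋃ q, I q) ≤ 2 * ∫⁻ x in {x | s < 2 * ‖F x‖}, ‖F x‖ₑ := by
    rw [h.volume_union_eq, ← ENNReal.tsum_mul_left]
    calc _ ≤ ∑' q, 2 * ∫⁻ x in I q ∩ {x | s < 2 * ‖F x‖}, ‖F x‖ₑ := ENNReal.tsum_le_tsum key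
      _ = 2 * ∫⁻ x in ⋃ q, (I q ∩ {x | s < 2 * ‖F x‖}), ‖F x‖ₑ := by
          rw [ENNReal.tsum_mul_left, lintegral_iUnion (fun q => (h.meas q).inter hmS)]
          exact fun q q' hq => (h.disj hq).mono Set.inter_subset_left Set.inter_subset_left
      _ ≤ _ := by
          gcongr
          exact Set.iUnion_subset fun q => Set.inter_subset_right
  rw [mul_comm 2, mul_assoc]
  calc volume (⋃ q, I q) = (ENNReal.ofReal s)⁻¹ * (ENNReal.ofReal s * volume (⋃ q, I q)) := by
        rw [← mul_assoc, ENNReal.inv_mul_cancel hs0 hst, one_mul]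
    _ ≤ _ := by gcongr

lemma CZFamily.lintegral_bad_le (h : CZFamily F s Q I c r) (hF : Integrable F) (q : Q) :
    ∫⁻ x in I q, ‖F x - czGood F I x‖ₑ ≤ 4 * ENNReal.ofReal s * volume (I q) := by
  calc _ ≤ ∫⁻ x in I q, (‖F x‖ₑ + ‖czGood F I x‖ₑ) := lintegral_mono fun x => enorm_sub_le
    _ = (∫⁻ x in I q, ‖F x‖ₑ) + ∫⁻ x in I q, ‖czGood F I x‖ₑ :=
        lintegral_add_left' hF.1.enorm.restrict _
    _ ≤ (∫⁻ x in I q, ‖F x‖ₑ) + ∫⁻ x in I q, ‖F x‖ₑ :=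
        add_le_add le_rfl (h.lintegral_good_le q)
    _ ≤ 2 * ENNReal.ofReal s * volume (I q) + 2 * ENNReal.ofReal s * volume (I q) :=
        add_le_add (h.upper q) (h.upper q)
    _ = _ := by ring

lemma CZFamily.integral_bad (h : CZFamily F s Q I c r) (hF : Integrable F) (q : Q) :
    ∫ x in I q, (F x - czGood F I x) = 0 := by
  rw [integral_sub hF.integrableOn (h.good_integrable hF).integrableOn,
    setIntegral_congr_fun (g := fun _ => ⨍ y in I q, F y) (h.meas q) (fun x hx => h.good_on hx),
    setIntegral_const, setAverage_eq, smul_smul, mul_inv_cancel₀, one_smul, sub_self]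
  exact (ENNReal.toReal_pos (h.vol_ne_zero q) (h.vol_ne_top q)).ne'

lemma CZFamily.enorm_opT_bad_le (h : CZFamily F s Q I c r) (hK : CZKernel K D A)
    (hF : Integrable F) (x : ℝ) :
    ‖opT K (fun y => F y - czGood F I y) x‖ₑ ≤
      ∑' q, ∫⁻ y in I q, ‖K x y - K x (c q)‖ₑ * ‖F y - czGood F I y‖ₑ := by
  have hb : Integrable (fun y => F y - czGood F I y) := hF.sub (h.good_integrable hF)
  have e1 : opT K (fun y => F y - czGood F I y) x =
      ∫ y in ⋃ q, I q, K x y (F y - czGood F I y) := by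
    unfold opT
    rw [eq_comm]
    apply setIntegral_eq_integral_of_forall_compl_eq_zero
    intro y hy
    rw [good_off hy, sub_self, map_zero]
  rw [e1, integral_iUnion h.meas h.disj (hK.integrable hb x).integrableOn]
  refine enorm_tsum_le_tsum_enorm.trans (ENNReal.tsum_le_tsum fun q => ?_)
  have e2 : ∫ y in I q, K x y (F y - czGood F I y) =
      ∫ y in I q, (K x y - K x (c q)) (F y - czGood F I y) := by
    have h0 : ∫ y in I q, K x (c q) (F y - czGood F I y) = 0 := by
      rw [ContinuousLinearMap.integral_comp_comm _ hb.integrableOn, h.integral_bad hF, map_zero]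
    simp only [sub_apply]
    rw [integral_sub (hK.integrable hb x).integrableOn, h0, sub_zero]
    exact ((K x (c q)).integrable_comp hb).integrableOn
  rw [e2]
  refine (enorm_integral_le_lintegral_enorm _).trans (lintegral_mono fun y => ?_)
  exact ContinuousLinearMap.le_opENorm _ _

lemma CZFamily.lintegral_opT_bad_le (h : CZFamily F s Q I c r) (hK : CZKernel K D A)
    (hF : Integrable F) :
    ∫⁻ x in (⋃ q, {x | |x - c q| < 2 * r q})ᶜ, ‖opT K (fun y => F y - czGood F I y) x‖ₑ ≤
      4 * A * ENNReal.ofReal s * volume (⋃ q, I q) := by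
  have hb : Integrable (fun y => F y - czGood F I y) := hF.sub (h.good_integrable hF)
  set S := (⋃ q, {x | |x - c q| < 2 * r q})ᶜ
  have hm : ∀ (q : Q), AEMeasurable (fun p : ℝ × ℝ =>
      ‖K p.1 p.2 - K p.1 (c q)‖ₑ * ‖F p.2 - czGood F I p.2‖ₑ)
      ((volume.restrict S).prod (volume.restrict (I q))) := by
    intro q
    have h1 : StronglyMeasurable fun p : ℝ × ℝ => K p.1 p.2 - K p.1 (c q) :=
      hK.meas.sub ((hK.stronglyMeasurable_left (c q)).comp_measurable measurable_fst)
    exact h1.aestronglyMeasurable.enorm.mul hb.1.restrict.comp_snd.enorm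
  calc _ ≤ ∫⁻ x in S, ∑' q, ∫⁻ y in I q, ‖K x y - K x (c q)‖ₑ * ‖F y - czGood F I y‖ₑ :=
        lintegral_mono fun x => h.enorm_opT_bad_le hK hF x
    _ = ∑' q, ∫⁻ x in S, ∫⁻ y in I q, ‖K x y - K x (c q)‖ₑ * ‖F y - czGood F I y‖ₑ := by
        rw [lintegral_tsum]
        exact fun q => (hm q).lintegral_prod_right'
    _ = ∑' q, ∫⁻ y in I q, ∫⁻ x in S, ‖K x y - K x (c q)‖ₑ * ‖F y - czGood F I y‖ₑ := by
        congr 1; funext q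
        exact lintegral_lintegral_swap (hm q)
    _ ≤ ∑' q, ∫⁻ y in I q, A * ‖F y - czGood F I y‖ₑ := by
        refine ENNReal.tsum_le_tsum fun q => setLIntegral_mono' (h.meas q) fun y hy => ?_
        rw [lintegral_mul_const' _ _ enorm_ne_top]
        gcongr
        refine (lintegral_mono_set ?_).trans (hK.hor (c q) (r q) (h.r_pos q) y (h.sub q y hy))
        intro x hx
        simp only [S, Set.mem_compl_iff, Set.mem_iUnion, Set.mem_ofPred_eq, not_exists, not_lt] at hx
        exact hx q
    _ ≤ ∑' q, A * (4 * ENNReal.ofReal s * volume (I q)) := by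
        refine ENNReal.tsum_le_tsum fun q => ?_
        rw [lintegral_const_mul'' _ hb.1.restrict.enorm]
        gcongr
        exact h.lintegral_bad_le hF q
    _ = _ := by
        rw [h.volume_union_eq, ENNReal.tsum_mul_left, ENNReal.tsum_mul_left]; ring

end family

/-- The distributional Calderón–Zygmund estimate. -/
lemma CZKernel.distribution_le (hK : CZKernel K D A) {B : ℝ≥0∞}
    (hL2 : ∀ G : ℝ → E, Integrable G → (∃ M : ℝ, ∀ x, ‖G x‖ ≤ M) →
      ∫⁻ x, ‖opT K G x‖ₑ ^ 2 ≤ B * ∫⁻ x, ‖G x‖ₑ ^ 2)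
    {F : ℝ → E} (hF : Continuous F) (hFi : Integrable F) {s : ℝ} (hs : 0 < s) :
    volume {x | 2 * s < ‖opT K F x‖} ≤
      B * ((ENNReal.ofReal s)⁻¹ ^ 2 * ∫⁻ x in {x | ‖F x‖ ≤ s}, ‖F x‖ₑ ^ 2) +
      (8 * B + 8 * A + 4) * ((ENNReal.ofReal s)⁻¹ * ∫⁻ x in {x | s < 2 * ‖F x‖}, ‖F x‖ₑ) := by
  have h := exists_czFamily hF hFi hs
  set I : {q // DyadicSel F s q} → Set ℝ := fun q => dyadic q.1.1 q.1.2
  set c : {q // DyadicSel F s q} → ℝ := fun q => (q.1.2 + 1 / 2) * (2 : ℝ) ^ q.1.1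
  set r : {q // DyadicSel F s q} → ℝ := fun q => (2 : ℝ) ^ q.1.1 / 2
  have hs0 : ENNReal.ofReal s ≠ 0 := by simpa using hs
  have hst : ENNReal.ofReal s ≠ ∞ := ENNReal.ofReal_ne_top
  have hgi := h.good_integrable hFi
  have hb : Integrable (fun y => F y - czGood F I y) := hFi.sub hgi
  set Ωs := ⋃ q, {x | |x - c q| < 2 * r q}
  have hsplit : ∀ x, opT K F x = opT K (czGood F I) x + opT K (fun y => F y - czGood F I y) x := by
    intro x
    unfold opT
    rw [← integral_add (hK.integrable hgi x) (hK.integrable hb x)]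
    congr 1; funext y
    rw [← map_add]; congr 1; abel
  have hgood : volume {x | ENNReal.ofReal s ≤ ‖opT K (czGood F I) x‖ₑ} ≤
      (ENNReal.ofReal s)⁻¹ ^ 2 * (B * ((∫⁻ x in {x | ‖F x‖ ≤ s}, ‖F x‖ₑ ^ 2) +
      4 * ENNReal.ofReal s ^ 2 * volume (⋃ q, I q))) := by
    have h1 := mul_meas_ge_le_lintegral₀ (μ := volume)
      ((hK.aestronglyMeasurable_opT hgi.1).enorm.pow_const 2) (ENNReal.ofReal s ^ 2)
    have h2 : {x | ENNReal.ofReal s ≤ ‖opT K (czGood F I) x‖ₑ} ⊆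
        {x | ENNReal.ofReal s ^ 2 ≤ ‖opT K (czGood F I) x‖ₑ ^ 2} := fun x hx => by
      simp only [Set.mem_ofPred_eq] at hx ⊢; gcongr
    have h3 : ∫⁻ x, ‖opT K (czGood F I) x‖ₑ ^ 2 ≤ B * ((∫⁻ x in {x | ‖F x‖ ≤ s}, ‖F x‖ₑ ^ 2) +
        4 * ENNReal.ofReal s ^ 2 * volume (⋃ q, I q)) := by
      refine (hL2 _ hgi ⟨2 * s, fun x => ?_⟩).trans (by gcongr; exact h.lintegral_good_sq_le)
      have := h.enorm_good_le x
      rw [← ENNReal.ofReal_ofNat, ← ENNReal.ofReal_mul (by norm_num), ← ofReal_norm] at this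
      exact (ENNReal.ofReal_le_ofReal_iff (by positivity)).1 this
    calc _ ≤ (ENNReal.ofReal s)⁻¹ ^ 2 * (ENNReal.ofReal s ^ 2 *
          volume {x | ENNReal.ofReal s ^ 2 ≤ ‖opT K (czGood F I) x‖ₑ ^ 2}) := by
          rw [← mul_assoc, ← mul_pow, ENNReal.inv_mul_cancel hs0 hst, one_pow, one_mul]
          exact measure_mono h2
      _ ≤ _ := mul_le_mul' le_rfl (h1.trans h3)
  have hbad : volume ({x | ENNReal.ofReal s ≤ ‖opT K (fun y => F y - czGood F I y) x‖ₑ} ∩ Ωsᶜ) ≤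
      (ENNReal.ofReal s)⁻¹ * (4 * A * ENNReal.ofReal s * volume (⋃ q, I q)) := by
    have h1 := mul_meas_ge_le_lintegral₀ (μ := volume.restrict Ωsᶜ)
      ((hK.aestronglyMeasurable_opT hb.1).enorm.restrict) (ENNReal.ofReal s)
    have h2 := Measure.le_restrict_apply (μ := volume) Ωsᶜ
      {x | ENNReal.ofReal s ≤ ‖opT K (fun y => F y - czGood F I y) x‖ₑ}
    calc _ ≤ (ENNReal.ofReal s)⁻¹ * (ENNReal.ofReal s * (volume.restrict Ωsᶜ)
          {x | ENNReal.ofReal s ≤ ‖opT K (fun y => F y - czGood F I y) x‖ₑ}) := by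
          rw [← mul_assoc, ENNReal.inv_mul_cancel hs0 hst, one_mul]
          exact h2
      _ ≤ _ := mul_le_mul' le_rfl (h1.trans (h.lintegral_opT_bad_le hK hFi))
  have hcover : {x | 2 * s < ‖opT K F x‖} ⊆ {x | ENNReal.ofReal s ≤ ‖opT K (czGood F I) x‖ₑ} ∪
      (Ωs ∪ ({x | ENNReal.ofReal s ≤ ‖opT K (fun y => F y - czGood F I y) x‖ₑ} ∩ Ωsᶜ)) := by
    intro x hx
    by_contra hcon
    simp only [Set.mem_union, Set.mem_inter_iff, Set.mem_compl_iff, not_or, not_and, not_not,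
      Set.mem_ofPred_eq] at hcon
    obtain ⟨h1, h2, h3⟩ := hcon
    have h4 : ¬ ENNReal.ofReal s ≤ ‖opT K (fun y => F y - czGood F I y) x‖ₑ := fun hh => h2 (h3 hh)
    rw [← ofReal_norm, ENNReal.ofReal_le_ofReal_iff (norm_nonneg _)] at h1 h4
    have hx' : 2 * s < ‖opT K F x‖ := hx
    rw [hsplit x] at hx'
    have := norm_add_le (opT K (czGood F I) x) (opT K (fun y => F y - czGood F I y) x)
    linarith
  have hV := h.volume_union_le hs hF
  set S := ENNReal.ofReal s
  set V := volume (⋃ q, I q)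
  set X := ∫⁻ x in {x | ‖F x‖ ≤ s}, ‖F x‖ₑ ^ 2
  set Y := ∫⁻ x in {x | s < 2 * ‖F x‖}, ‖F x‖ₑ
  have hSS : S⁻¹ * S = 1 := ENNReal.inv_mul_cancel hs0 hst
  calc _ ≤ S⁻¹ ^ 2 * (B * (X + 4 * S ^ 2 * V)) + (2 * V + S⁻¹ * (4 * A * S * V)) :=
        (measure_mono hcover).trans ((measure_union_le _ _).trans (add_le_add hgood
          ((measure_union_le _ _).trans (add_le_add h.volume_star_le hbad))))
    _ = B * (S⁻¹ ^ 2 * X) + (4 * B * (S⁻¹ * S) ^ 2 + 2 + 4 * A * (S⁻¹ * S)) * V := by ring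
    _ = B * (S⁻¹ ^ 2 * X) + (4 * B + 2 + 4 * A) * V := by rw [hSS]; ring
    _ ≤ B * (S⁻¹ ^ 2 * X) + (4 * B + 2 + 4 * A) * (2 * S⁻¹ * Y) := by gcongr
    _ = _ := by ring

end cz

lemma lintegral_tail_rpow {p φ : ℝ} (hp2 : p < 2) (hφ : 0 ≤ φ) :
    ∫⁻ t in Set.Ioi (0 : ℝ), (Set.Ici φ).indicator (fun t => ENNReal.ofReal (φ ^ 2 * t ^ (p - 3))) t ≤
      ENNReal.ofReal ((2 - p)⁻¹ * φ ^ p) := by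
  rcases hφ.eq_or_lt with rfl | hφ
  · simp
  calc _ ≤ ∫⁻ t, (Set.Ici φ).indicator (fun t => ENNReal.ofReal (φ ^ 2 * t ^ (p - 3))) t :=
        setLIntegral_le_lintegral _ _
    _ = ∫⁻ t in Set.Ioi φ, ENNReal.ofReal (φ ^ 2 * t ^ (p - 3)) := by
        rw [lintegral_indicator measurableSet_Ici]
        exact setLIntegral_congr Ioi_ae_eq_Ici.symm
    _ = ENNReal.ofReal (∫ t in Set.Ioi φ, φ ^ 2 * t ^ (p - 3)) := by
        rw [ofReal_integral_eq_lintegral_ofReal]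
        · exact (integrableOn_Ioi_rpow_of_lt (by linarith) hφ).const_mul _
        · filter_upwards [ae_restrict_mem measurableSet_Ioi] with t ht
          have : 0 < t := hφ.trans ht
          simp only [Pi.zero_apply]; positivity
    _ = ENNReal.ofReal ((2 - p)⁻¹ * φ ^ p) := by
        congr 1
        rw [integral_const_mul, integral_Ioi_rpow_of_lt (by linarith) hφ]
        have h1 : φ ^ p = φ ^ 2 * φ ^ (p - 3 + 1) := by
          rw [← Real.rpow_natCast, ← rpow_add hφ]; congr 1; push_cast; ring
        have h2 : p - 3 + 1 = -(2 - p) := by ring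
        have h3 : 2 - p ≠ 0 := by linarith
        rw [h1, h2]
        field_simp
    _ ≤ _ := le_rfl

lemma lintegral_head_rpow {p φ : ℝ} (hp1 : 1 < p) (hp2 : p < 2) (hφ : 0 ≤ φ) :
    ∫⁻ t in Set.Ioi (0 : ℝ), {t | t < 2 * φ}.indicator (fun t => ENNReal.ofReal (φ * t ^ (p - 2))) t ≤
      ENNReal.ofReal (2 * (p - 1)⁻¹ * φ ^ p) := by
  have hInt : IntervalIntegrable (fun t : ℝ => φ * t ^ (p - 2)) volume 0 (2 * φ) :=
    (intervalIntegral.intervalIntegrable_rpow' (by linarith)).const_mul _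
  calc _ = ∫⁻ t in Set.Ioo 0 (2 * φ), ENNReal.ofReal (φ * t ^ (p - 2)) := by
        rw [setLIntegral_indicator (by measurability)]
        congr 2
        ext t; simp [and_comm]
    _ = ∫⁻ t in Set.Ioc 0 (2 * φ), ENNReal.ofReal (φ * t ^ (p - 2)) :=
        setLIntegral_congr Ioo_ae_eq_Ioc
    _ = ENNReal.ofReal (∫ t in Set.Ioc 0 (2 * φ), φ * t ^ (p - 2)) := by
        rw [ofReal_integral_eq_lintegral_ofReal]
        · exact (intervalIntegrable_iff_integrableOn_Ioc_of_le (by positivity)).1 hInt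
        · filter_upwards [ae_restrict_mem measurableSet_Ioc] with t ht
          have : 0 < t := ht.1
          simp only [Pi.zero_apply]; positivity
    _ ≤ _ := by
        apply ENNReal.ofReal_le_ofReal
        rw [← intervalIntegral.integral_of_le (by positivity), intervalIntegral.integral_const_mul,
          integral_rpow (Or.inl (by linarith)), show p - 2 + 1 = p - 1 by ring,
          zero_rpow (by linarith), sub_zero, mul_rpow (by norm_num) hφ]
        have h0 : 0 < p - 1 := by linarith
        have h1 : φ * φ ^ (p - 1) = φ ^ p := by
          nth_rewrite 1 [← rpow_one φ]
          rw [← rpow_add' hφ (by linarith)]; congr 1; ring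
        have h2 : (2 : ℝ) ^ (p - 1) ≤ 2 := by
          calc (2 : ℝ) ^ (p - 1) ≤ 2 ^ (1 : ℝ) :=
                rpow_le_rpow_of_exponent_le (by norm_num) (by linarith)
            _ = 2 := rpow_one 2
        calc _ = 2 ^ (p - 1) * (p - 1)⁻¹ * (φ * φ ^ (p - 1)) := by rw [div_eq_mul_inv]; ring
          _ ≤ _ := by rw [h1]; gcongr

variable {E E' : Type*} [NormedAddCommGroup E] [NormedSpace ℂ E] [CompleteSpace E]
  [NormedAddCommGroup E'] [NormedSpace ℂ E'] [CompleteSpace E']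
variable {K : ℝ → ℝ → E →L[ℂ] E'} {D : ℝ} {A : ℝ≥0∞}

/-- The constant in the interpolated estimate. -/
noncomputable def interpConst (p : ℝ) (A B : ℝ≥0∞) : ℝ≥0∞ :=
  2 ^ p * ENNReal.ofReal p * (B * ENNReal.ofReal (2 - p)⁻¹ +
    (8 * B + 8 * A + 4) * ENNReal.ofReal (2 * (p - 1)⁻¹))

lemma interpConst_ne_top {p : ℝ} {A B : ℝ≥0∞} (hp : 0 < p) (hA : A ≠ ∞) (hB : B ≠ ∞) :
    interpConst p A B ≠ ∞ := by
  unfold interpConst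
  have : (2 : ℝ≥0∞) ^ p ≠ ∞ := ENNReal.rpow_ne_top_of_nonneg hp.le (by norm_num)
  finiteness

lemma CZKernel.lintegral_rpow_le (hK : CZKernel K D A) {B : ℝ≥0∞}
    (hL2 : ∀ G : ℝ → E, Integrable G → (∃ M : ℝ, ∀ x, ‖G x‖ ≤ M) →
      ∫⁻ x, ‖opT K G x‖ₑ ^ 2 ≤ B * ∫⁻ x, ‖G x‖ₑ ^ 2)
    {F : ℝ → E} (hF : Continuous F) (hFi : Integrable F) {p : ℝ} (hp1 : 1 < p) (hp2 : p < 2) :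
    ∫⁻ x, ‖opT K F x‖ₑ ^ p ≤ interpConst p A B * ∫⁻ x, ‖F x‖ₑ ^ p := by
  have hp0 : 0 < p := by linarith
  have hm := hK.aestronglyMeasurable_opT hFi.1
  have hlc := lintegral_rpow_eq_lintegral_meas_lt_mul volume (f := fun x => ‖opT K F x‖ / 2)
    (Filter.Eventually.of_forall fun x => by positivity) (hm.norm.aemeasurable.div_const 2) hp0
  have hlhs : ∫⁻ x, ‖opT K F x‖ₑ ^ p = 2 ^ p * ∫⁻ x, ENNReal.ofReal ((‖opT K F x‖ / 2) ^ p) := by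
    rw [← lintegral_const_mul']
    · congr 1; funext x
      rw [← ENNReal.ofReal_rpow_of_nonneg (by positivity) hp0.le, ← ENNReal.mul_rpow_of_nonneg _ _ hp0.le,
        ENNReal.ofReal_div_of_pos (by norm_num), ofReal_norm, ENNReal.ofReal_ofNat,
        ENNReal.mul_div_cancel (by norm_num) (by norm_num)]
    · exact ENNReal.rpow_ne_top_of_nonneg hp0.le (by norm_num)
  set g1 : ℝ → ℝ → ℝ≥0∞ := fun t x =>
    (Set.Ici ‖F x‖).indicator (fun t => ENNReal.ofReal (‖F x‖ ^ 2 * t ^ (p - 3))) t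
  set g2 : ℝ → ℝ → ℝ≥0∞ := fun t x =>
    {t | t < 2 * ‖F x‖}.indicator (fun t => ENNReal.ofReal (‖F x‖ * t ^ (p - 2))) t
  have hφm : Measurable fun q : ℝ × ℝ => ‖F q.2‖ := (hF.norm.comp continuous_snd).measurable
  have hg1 : Measurable (Function.uncurry g1) := by
    have : Function.uncurry g1 = {q : ℝ × ℝ | ‖F q.2‖ ≤ q.1}.indicator
        (fun q => ENNReal.ofReal (‖F q.2‖ ^ 2 * q.1 ^ (p - 3))) := by
      ext ⟨t, x⟩; simp [g1, Set.indicator]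
    rw [this]
    refine Measurable.indicator ?_ (measurableSet_le ?_ ?_) <;>
      fun_prop
  have hg2 : Measurable (Function.uncurry g2) := by
    have : Function.uncurry g2 = {q : ℝ × ℝ | q.1 < 2 * ‖F q.2‖}.indicator
        (fun q => ENNReal.ofReal (‖F q.2‖ * q.1 ^ (p - 2))) := by
      ext ⟨t, x⟩; simp [g2, Set.indicator]
    rw [this]
    refine Measurable.indicator ?_ (measurableSet_lt ?_ ?_) <;>
      fun_prop
  have hpt : ∀ t ∈ Set.Ioi (0 : ℝ), volume {x | t < ‖opT K F x‖ / 2} * ENNReal.ofReal (t ^ (p - 1)) ≤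
      B * (∫⁻ x, g1 t x) + (8 * B + 8 * A + 4) * ∫⁻ x, g2 t x := by
    intro t ht
    have ht : 0 < t := ht
    have hd := hK.distribution_le hL2 hF hFi ht
    have hset : {x | t < ‖opT K F x‖ / 2} = {x | 2 * t < ‖opT K F x‖} := by
      ext x; simp only [Set.mem_ofPred_eq]; constructor <;> intro h <;> linarith
    rw [hset]
    have e1 : ∫⁻ x, g1 t x = (ENNReal.ofReal t)⁻¹ ^ 2 * (∫⁻ x in {x | ‖F x‖ ≤ t}, ‖F x‖ₑ ^ 2) *
        ENNReal.ofReal (t ^ (p - 1)) := by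
      rw [mul_comm, ← mul_assoc, ← lintegral_const_mul' _ _ (by
        rw [← ENNReal.ofReal_inv_of_pos ht]; finiteness),
        ← lintegral_indicator (measurableSet_le hF.norm.measurable measurable_const)]
      congr 1; funext x
      by_cases hx : ‖F x‖ ≤ t
      · have e : t ^ (p - 3) = t ^ (p - 1) * t⁻¹ ^ 2 := by
          rw [← Real.rpow_natCast, ← Real.rpow_neg_one, ← rpow_mul ht.le, ← rpow_add ht]
          congr 1; push_cast; ring
        rw [Set.indicator_of_mem (by exact hx)]
        simp only [g1]
        rw [Set.indicator_of_mem (by exact hx), e, ← ENNReal.ofReal_inv_of_pos ht, ← ofReal_norm,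
          ← ENNReal.ofReal_pow (by positivity), ← ENNReal.ofReal_pow (by positivity),
          ← ENNReal.ofReal_mul (by positivity), ← ENNReal.ofReal_mul (by positivity)]
        congr 1; ring
      · rw [Set.indicator_of_notMem (by exact hx)]
        simp only [g1]
        rw [Set.indicator_of_notMem (by exact hx)]
    have e2 : ∫⁻ x, g2 t x = (ENNReal.ofReal t)⁻¹ * (∫⁻ x in {x | t < 2 * ‖F x‖}, ‖F x‖ₑ) *
        ENNReal.ofReal (t ^ (p - 1)) := by
      rw [mul_comm, ← mul_assoc, ← lintegral_const_mul' _ _ (by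
        rw [← ENNReal.ofReal_inv_of_pos ht]; finiteness),
        ← lintegral_indicator (measurableSet_lt measurable_const (hF.norm.measurable.const_mul 2))]
      congr 1; funext x
      by_cases hx : t < 2 * ‖F x‖
      · have e : t ^ (p - 2) = t ^ (p - 1) * t⁻¹ := by
          rw [← Real.rpow_neg_one, ← rpow_add ht]
          congr 1; ring
        rw [Set.indicator_of_mem (by exact hx)]
        simp only [g2]
        rw [Set.indicator_of_mem (by exact hx), e, ← ENNReal.ofReal_inv_of_pos ht, ← ofReal_norm,
          ← ENNReal.ofReal_mul (by positivity), ← ENNReal.ofReal_mul (by positivity)]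
        congr 1; ring
      · rw [Set.indicator_of_notMem (by exact hx)]
        simp only [g2]
        rw [Set.indicator_of_notMem (by exact hx)]
    calc _ ≤ _ := mul_le_mul_left hd _
      _ = _ := by rw [e1, e2]; ring
  have hswap1 : ∫⁻ t in Set.Ioi (0 : ℝ), ∫⁻ x, g1 t x ≤
      ENNReal.ofReal (2 - p)⁻¹ * ∫⁻ x, ‖F x‖ₑ ^ p := by
    rw [lintegral_lintegral_swap hg1.aemeasurable, ← lintegral_const_mul' _ _ ENNReal.ofReal_ne_top]
    refine lintegral_mono fun x => (lintegral_tail_rpow hp2 (norm_nonneg _)).trans (le_of_eq ?_)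
    rw [ENNReal.ofReal_mul (by rw [inv_nonneg]; linarith),
      ← ENNReal.ofReal_rpow_of_nonneg (norm_nonneg _) hp0.le, ofReal_norm]
  have hswap2 : ∫⁻ t in Set.Ioi (0 : ℝ), ∫⁻ x, g2 t x ≤
      ENNReal.ofReal (2 * (p - 1)⁻¹) * ∫⁻ x, ‖F x‖ₑ ^ p := by
    rw [lintegral_lintegral_swap hg2.aemeasurable, ← lintegral_const_mul' _ _ ENNReal.ofReal_ne_top]
    refine lintegral_mono fun x => (lintegral_head_rpow hp1 hp2 (norm_nonneg _)).trans (le_of_eq ?_)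
    rw [ENNReal.ofReal_mul (mul_nonneg (by norm_num) (by rw [inv_nonneg]; linarith)),
      ← ENNReal.ofReal_rpow_of_nonneg (norm_nonneg _) hp0.le, ofReal_norm]
  have hm1 : Measurable fun t => ∫⁻ x, g1 t x := hg1.lintegral_prod_right'
  have hm2 : Measurable fun t => ∫⁻ x, g2 t x := hg2.lintegral_prod_right'
  rw [hlhs, hlc]
  calc _ ≤ 2 ^ p * (ENNReal.ofReal p * ∫⁻ t in Set.Ioi (0 : ℝ),
        (B * (∫⁻ x, g1 t x) + (8 * B + 8 * A + 4) * ∫⁻ x, g2 t x)) :=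
        mul_le_mul' le_rfl (mul_le_mul' le_rfl (setLIntegral_mono' measurableSet_Ioi hpt))
    _ = 2 ^ p * (ENNReal.ofReal p * (B * (∫⁻ t in Set.Ioi (0 : ℝ), ∫⁻ x, g1 t x) +
        (8 * B + 8 * A + 4) * ∫⁻ t in Set.Ioi (0 : ℝ), ∫⁻ x, g2 t x)) := by
        rw [lintegral_add_left (hm1.const_mul _), lintegral_const_mul _ hm1,
          lintegral_const_mul _ hm2]
    _ ≤ 2 ^ p * (ENNReal.ofReal p * (B * (ENNReal.ofReal (2 - p)⁻¹ * ∫⁻ x, ‖F x‖ₑ ^ p) +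
        (8 * B + 8 * A + 4) * (ENNReal.ofReal (2 * (p - 1)⁻¹) * ∫⁻ x, ‖F x‖ₑ ^ p))) := by
        gcongr
    _ = _ := by unfold interpConst; ring

open scoped FourierTransform SchwartzMap ContDiff in
lemma ae_eq_zero_of_fourier_eq_zero {F : ℝ → ℂ} (hF : Integrable F) (h : ∀ ξ, 𝓕 F ξ = 0) :
    ∀ᵐ x, F x = 0 := by
  refine ae_eq_zero_of_integral_contDiff_smul_eq_zero hF.locallyIntegrable fun g hg hgc => ?_
  have h1 : ContDiff ℝ ∞ (fun x => (g x : ℂ)) := Complex.ofRealCLM.contDiff.comp hg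
  have h2 : HasCompactSupport (fun x => (g x : ℂ)) :=
    hgc.comp_left (g := fun y : ℝ => (y : ℂ)) Complex.ofReal_zero
  set φ : 𝓢(ℝ, ℂ) := h2.toSchwartzMap h1
  set ψ : 𝓢(ℝ, ℂ) := 𝓕⁻ φ
  have hψ : 𝓕 ψ = φ := FourierTransform.fourier_fourierInv_eq φ
  have key := VectorFourier.integral_bilin_fourierIntegral_eq_flip (ContinuousLinearMap.mul ℂ ℂ)
    (L := innerₗ ℝ) (μ := volume) (ν := volume) continuous_fourierChar continuous_inner hF ψ.integrable
  have e1 : ∀ ξ, VectorFourier.fourierIntegral 𝐞 volume (innerₗ ℝ) F ξ = 0 := h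
  have e2 : ∀ x, VectorFourier.fourierIntegral 𝐞 volume (innerₗ ℝ).flip ψ x = g x := by
    intro x
    have : (𝓕 ψ : 𝓢(ℝ, ℂ)) x = φ x := by rw [hψ]
    rw [SchwartzMap.fourier_coe] at this
    simpa using! this
  simp only [e1, e2, map_zero, zero_apply, integral_zero,
    ContinuousLinearMap.mul_apply'] at key
  rw [key]
  congr 1; funext x
  rw [Complex.real_smul, mul_comm]

/-- A continuous function dominated by a Gaussian is square integrable. -/
lemma memLp_two_of_gauss_bound {g : ℝ → ℂ} (hg : Continuous g) {C : ℝ}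
    (h : ∀ u, ‖g u‖ ≤ C * Real.exp (-u ^ 2 / 4)) : MemLp g 2 := by
  have hC : 0 ≤ C := by have := (norm_nonneg _).trans (h 0); simpa using this
  rw [memLp_two_iff_integrable_sq_norm hg.aestronglyMeasurable]
  refine integrable_of_gauss_bound (C := C ^ 2) (by fun_prop) fun u => ?_
  rw [Real.norm_of_nonneg (by positivity)]
  have h1 : Real.exp (-u ^ 2 / 4) ^ 2 ≤ Real.exp (-u ^ 2 / 4) := by
    rw [← Real.exp_nat_mul]; apply Real.exp_le_exp.2; push_cast; nlinarith [sq_nonneg u]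
  calc ‖g u‖ ^ 2 ≤ (C * Real.exp (-u ^ 2 / 4)) ^ 2 := by gcongr; exact h u
    _ ≤ _ := by rw [mul_pow]; gcongr

lemma memLp_hermiteFun (k : ℕ) : MemLp (fun u => (hermiteFun k u : ℂ)) 2 := by
  obtain ⟨C, hC, h⟩ := hermiteFun_bound k
  exact memLp_two_of_gauss_bound (by have := continuous_hermiteFun k; fun_prop)
    fun u => by rw [Complex.norm_real]; exact h u

lemma integrable_gauss_bound_mul {f : ℝ → ℂ} (hf : MemLp f 2) {g : ℝ → ℂ} (hg : Continuous g) {C : ℝ}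
    (h : ∀ u, ‖g u‖ ≤ C * Real.exp (-u ^ 2 / 4)) : Integrable (fun u => g u * f u) :=
  (memLp_two_of_gauss_bound hg h).integrable_mul hf

lemma pow_mul_hgauss_bound (j k : ℕ) : ∃ C : ℝ, 0 ≤ C ∧ ∀ u : ℝ,
    ‖((u ^ j * hgauss k u : ℝ) : ℂ)‖ ≤ C * Real.exp (-u ^ 2 / 4) := by
  obtain ⟨C, hC, h⟩ := poly_gauss_bound (Polynomial.X ^ j * hpoly k)
  refine ⟨C, hC, fun u => ?_⟩
  have := h u
  rw [Complex.norm_real, Real.norm_eq_abs]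
  unfold hgauss
  rwa [← mul_assoc, abs_mul, Real.abs_exp, ← Polynomial.eval_X_pow (R := ℝ) (x := u), ← Polynomial.eval_mul]

lemma integrable_pow_mul_hgauss_mul {f : ℝ → ℂ} (hf : MemLp f 2) (j k : ℕ) :
    Integrable (fun u => ((u ^ j * hgauss k u : ℝ) : ℂ) * f u) := by
  obtain ⟨C, hC, h⟩ := pow_mul_hgauss_bound j k
  exact integrable_gauss_bound_mul hf (by have := continuous_hgauss k; fun_prop) h

lemma integral_pow_mul_hgauss_mul {f : ℝ → ℂ} (hf : MemLp f 2)
    (h0 : ∀ k, ∫ u, (hermiteFun k u : ℂ) * f u = 0) (j k : ℕ) :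
    ∫ u, ((u ^ j * hgauss k u : ℝ) : ℂ) * f u = 0 := by
  induction j generalizing k with
  | zero =>
    have := h0 k
    simp_rw [hermiteFun_eq, Complex.ofReal_mul, mul_assoc] at this
    rw [integral_const_mul] at this
    simpa [hnorm_ne_zero] using this
  | succ j ih =>
    have e : ∀ u, ((u ^ (j + 1) * hgauss k u : ℝ) : ℂ) * f u =
        (1 / 2 : ℂ) * (((u ^ j * hgauss (k + 1) u : ℝ) : ℂ) * f u) +
        (k : ℂ) * (((u ^ j * hgauss (k - 1) u : ℝ) : ℂ) * f u) := by
      intro u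
      have := congrArg (fun x : ℝ => (x : ℂ)) (two_mul_hgauss k u)
      push_cast at this ⊢
      linear_combination (u : ℂ) ^ j * f u / 2 * this
    simp_rw [e]
    rw [integral_add ((integrable_pow_mul_hgauss_mul hf _ _).const_mul _)
      ((integrable_pow_mul_hgauss_mul hf _ _).const_mul _), integral_const_mul, integral_const_mul,
      ih, ih]
    simp

open scoped FourierTransform in
/-- Completeness of the Hermite functions. -/
lemma ae_eq_zero_of_hermite {f : ℝ → ℂ} (hf : MemLp f 2)
    (h0 : ∀ k, ∫ u, (hermiteFun k u : ℂ) * f u = 0) : ∀ᵐ u, f u = 0 := by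
  have hmom : ∀ j, ∫ u, ((u ^ j * hgauss 0 u : ℝ) : ℂ) * f u = 0 := fun j =>
    integral_pow_mul_hgauss_mul hf h0 j 0
  have hI0 := integrable_pow_mul_hgauss_mul hf 0 0
  simp only [pow_zero, one_mul] at hI0
  have key : ∀ᵐ u, ((hgauss 0 u : ℝ) : ℂ) * f u = 0 := by
    apply ae_eq_zero_of_fourier_eq_zero hI0
    intro ξ
    rw [Real.fourier_real_eq_integral_exp_smul]
    obtain ⟨z, hz⟩ : ∃ z : ℂ, z = -2 * π * ξ * I := ⟨_, rfl⟩
    set t : ℝ := ‖z‖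
    have hs := hasSum_integral_of_dominated_convergence (μ := volume)
      (F := fun (j : ℕ) u => z ^ j / j.factorial * (((u ^ j * hgauss 0 u : ℝ) : ℂ) * f u))
      (f := fun u => Complex.exp (↑(-2 * π * u * ξ) * I) • (((hgauss 0 u : ℝ) : ℂ) * f u))
      (fun (j : ℕ) u => (t * |u|) ^ j / j.factorial * (hgauss 0 u * ‖f u‖)) ?_ ?_ ?_ ?_ ?_
    · simp_rw [integral_const_mul, hmom, mul_zero] at hs
      exact hs.unique hasSum_zero
    · intro j
      exact ((integrable_pow_mul_hgauss_mul hf j 0).const_mul _).1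
    · intro j
      filter_upwards with u
      rw [norm_mul, norm_mul, norm_div, norm_pow, Complex.norm_real, Complex.norm_natCast, norm_mul,
        norm_pow, hgauss_zero, Real.norm_of_nonneg (Real.exp_pos _).le, Real.norm_eq_abs]
      apply le_of_eq; ring
    · filter_upwards with u
      exact (Real.summable_pow_div_factorial _).mul_right _
    · have e : ∀ u, ∑' j : ℕ, (t * |u|) ^ j / j.factorial * (hgauss 0 u * ‖f u‖) =
          Real.exp (t * |u|) * hgauss 0 u * ‖f u‖ := by
        intro u
        rw [tsum_mul_right, Real.exp_eq_exp_ℝ, NormedSpace.exp_eq_tsum_div, mul_assoc]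
      simp_rw [e]
      have := (integrable_gauss_bound_mul (C := Real.exp (t ^ 2)) hf
        (g := fun u => ((Real.exp (t * |u|) * hgauss 0 u : ℝ) : ℂ))
        (by have := continuous_hgauss 0; fun_prop) fun u => ?_).norm
      · refine this.congr (Filter.Eventually.of_forall fun u => ?_)
        simp only [norm_mul, Complex.norm_real, hgauss_zero]
        rw [Real.norm_of_nonneg (by positivity), Real.norm_of_nonneg (Real.exp_pos _).le]
      · rw [hgauss_zero, ← Real.exp_add, Complex.norm_real, Real.norm_of_nonneg (Real.exp_pos _).le,
          ← Real.exp_add]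
        apply Real.exp_le_exp.2
        nlinarith [sq_nonneg (t - |u| / 2), sq_abs u]
    · filter_upwards with u
      have h1 := NormedSpace.expSeries_div_hasSum_exp (𝔸 := ℂ) (z * u)
      rw [← Complex.exp_eq_exp_ℂ] at h1
      have h2 := h1.mul_right (((hgauss 0 u : ℝ) : ℂ) * f u)
      have e : Complex.exp (↑(-2 * π * u * ξ) * I) • (((hgauss 0 u : ℝ) : ℂ) * f u) =
          Complex.exp (z * u) * (((hgauss 0 u : ℝ) : ℂ) * f u) := by
        rw [smul_eq_mul, hz]; congr 2; push_cast; ring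
      rw [e]
      refine h2.congr_fun fun j => ?_
      push_cast; ring
  filter_upwards [key] with u hu
  have : ((hgauss 0 u : ℝ) : ℂ) ≠ 0 := by
    rw [hgauss_zero]; exact_mod_cast (Real.exp_pos _).ne'
  simpa [this] using hu

/-- The Hermite coefficient of a vector-valued function on the line. -/
noncomputable def hcoef {E : Type*} [NormedAddCommGroup E] [NormedSpace ℂ E] (k : ℕ) (G : ℝ → E) : E :=
  ∫ u, (hermiteFun k u : ℂ) • G u

lemma hasSum_hcoef {f : ℝ → ℂ} (hf : MemLp f 2) :
    HasSum (fun k => ‖hcoef k f‖ ^ 2) (∫ u, ‖f u‖ ^ 2) := by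
  set v : ℕ → Lp ℂ 2 (volume : Measure ℝ) := fun k => (memLp_hermiteFun k).toLp
  have hin : ∀ k (g : ℝ → ℂ) (hg : MemLp g 2), inner ℂ (v k) hg.toLp = hcoef k g := by
    intro k g hg
    rw [L2.inner_def]
    apply integral_congr_ae
    filter_upwards [(memLp_hermiteFun k).coeFn_toLp, hg.coeFn_toLp] with u h1 h2
    rw [h1, h2]
    simp [mul_comm]
  have hv : Orthonormal ℂ v := by
    rw [orthonormal_iff_ite]
    intro i j
    rw [hin]
    unfold hcoef
    have := congrArg (fun x : ℝ => (x : ℂ)) (integral_hermiteFun_mul i j)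
    rw [← integral_complex_ofReal] at this
    simp only [smul_eq_mul, Complex.ofReal_mul] at this ⊢
    rw [this]; split_ifs <;> simp
  have hbot : (Submodule.span ℂ (Set.range v))ᗮ = ⊥ := by
    rw [Submodule.eq_bot_iff]
    intro g hg
    have h1 : ∀ k, inner ℂ (v k) g = 0 := fun k =>
      (Submodule.mem_orthogonal _ _).1 hg _ (Submodule.subset_span ⟨k, rfl⟩)
    have h2 := ae_eq_zero_of_hermite (Lp.memLp g) fun k => by
      have := hin k g (Lp.memLp g)
      rw [Lp.toLp_coeFn, h1] at this
      exact this.symm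
    rw [Lp.eq_zero_iff_ae_eq_zero]
    exact h2
  set b := HilbertBasis.mkOfOrthogonalEqBot hv hbot
  have hb : ∀ k, b k = v k := fun k => by
    rw [show (b : ℕ → _) = v from HilbertBasis.coe_mkOfOrthogonalEqBot hv hbot]
  have := b.hasSum_inner_mul_inner hf.toLp hf.toLp
  have e1 : ∀ k, inner ℂ hf.toLp (b k) * inner ℂ (b k) hf.toLp = ((‖hcoef k f‖ ^ 2 : ℝ) : ℂ) := by
    intro k
    rw [hb, ← inner_conj_symm, RCLike.conj_mul, hin]; norm_cast
  have e2 : inner ℂ hf.toLp hf.toLp = ((∫ u, ‖f u‖ ^ 2 : ℝ) : ℂ) := by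
    rw [L2.inner_def, ← integral_complex_ofReal]
    apply integral_congr_ae
    filter_upwards [hf.coeFn_toLp] with u h1
    rw [h1, inner_self_eq_norm_sq_to_K]; norm_cast
  simp_rw [e1] at this
  rw [e2] at this
  exact Complex.hasSum_ofReal.1 this

section vector
variable {ι : Type*} [Fintype ι]

lemma hcoef_apply {G : ℝ → EuclideanSpace ℂ ι} (hG : MemLp G 2) (k : ℕ) (i : ι) :
    hcoef k G i = hcoef k (fun u => G u i) := by
  have hI : Integrable (fun u => (hermiteFun k u : ℂ) • G u) :=
    memLp_one_iff_integrable.1 (hG.smul (memLp_hermiteFun k))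
  exact ((EuclideanSpace.proj (𝕜 := ℂ) i).integral_comp_comm hI).symm

lemma memLp_apply {G : ℝ → EuclideanSpace ℂ ι} (hG : MemLp G 2) (i : ι) :
    MemLp (fun u => G u i) 2 :=
  (EuclideanSpace.proj (𝕜 := ℂ) i).comp_memLp' hG

/-- Parseval's identity for the Hermite expansion of a vector-valued function. -/
lemma hasSum_hcoef_vec {G : ℝ → EuclideanSpace ℂ ι} (hG : MemLp G 2) :
    HasSum (fun k => ‖hcoef k G‖ ^ 2) (∫ u, ‖G u‖ ^ 2) := by
  simp_rw [EuclideanSpace.norm_sq_eq]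
  rw [integral_finsetSum]
  · simp_rw [hcoef_apply hG]
    exact hasSum_sum fun i _ => hasSum_hcoef (memLp_apply hG i)
  · intro i _
    exact (memLp_two_iff_integrable_sq_norm (memLp_apply hG i).1).1 (memLp_apply hG i)

lemma lintegral_sq_eq_tsum_hcoef {G : ℝ → EuclideanSpace ℂ ι} (hG : MemLp G 2) :
    ∫⁻ u, ‖G u‖ₑ ^ 2 = ∑' k, ‖hcoef k G‖ₑ ^ 2 := by
  have h := hasSum_hcoef_vec hG
  have h1 : ∫⁻ u, ‖G u‖ₑ ^ 2 = ENNReal.ofReal (∫ u, ‖G u‖ ^ 2) := by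
    rw [ofReal_integral_eq_lintegral_ofReal ((memLp_two_iff_integrable_sq_norm hG.1).1 hG)
      (Filter.Eventually.of_forall fun _ => by positivity)]
    congr 1; funext u
    rw [ENNReal.ofReal_pow (norm_nonneg _), ofReal_norm]
  rw [h1, ← h.tsum_eq, ENNReal.ofReal_tsum_of_nonneg (fun _ => by positivity) h.summable]
  congr 1; funext k
  rw [ENNReal.ofReal_pow (norm_nonneg _), ofReal_norm]

end vector

lemma summable_exp_neg_abs_int : Summable fun m : ℤ => Real.exp (-|(m : ℝ)| / 2) := by
  have h : Summable fun n : ℕ => Real.exp (-(n : ℝ) / 2) := by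
    have := Real.summable_exp_nat_mul_of_ge (c := -1 / 2) (by norm_num) (f := fun n => n) (fun n => le_rfl)
    refine this.congr fun n => ?_
    congr 1; ring
  refine Summable.of_nat_of_neg ?_ ?_
  · simpa using h
  · simpa using h

/-- A bound for `∑ exp (-|j + β| / 2)`. -/
noncomputable def dyadSum : ℝ := Real.exp (1 / 2) * ∑' m : ℤ, Real.exp (-|(m : ℝ)| / 2)

lemma dyadSum_nonneg : 0 ≤ dyadSum :=
  mul_nonneg (Real.exp_pos _).le (tsum_nonneg fun _ => (Real.exp_pos _).le)

lemma sum_exp_neg_abs_le (J : Finset ℤ) (β : ℝ) :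
    ∑ j ∈ J, Real.exp (-|(j : ℝ) + β| / 2) ≤ dyadSum := by
  set n : ℤ := ⌊β⌋
  calc _ ≤ ∑ j ∈ J, Real.exp (1 / 2) * Real.exp (-|((j + n : ℤ) : ℝ)| / 2) := by
        refine Finset.sum_le_sum fun j _ => ?_
        rw [← Real.exp_add]
        apply Real.exp_le_exp.2
        have h1 : |((j + n : ℤ) : ℝ)| ≤ |(j : ℝ) + β| + |(n : ℝ) - β| := by
          push_cast
          calc _ = |((j : ℝ) + β) + (n - β)| := by congr 1; ring
            _ ≤ _ := abs_add_le _ _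
        have h2 : |(n : ℝ) - β| ≤ 1 := by
          have := Int.floor_le β; have := Int.lt_floor_add_one β
          rw [abs_le]; constructor <;> linarith
        linarith
    _ = Real.exp (1 / 2) * ∑ m ∈ J.map (Equiv.addRight n).toEmbedding, Real.exp (-|(m : ℝ)| / 2) := by
        rw [Finset.mul_sum, Finset.sum_map]; rfl
    _ ≤ _ := by
        unfold dyadSum
        gcongr
        exact summable_exp_neg_abs_int.sum_le_tsum _ fun _ _ => (Real.exp_pos _).le

lemma min_exp_eq (t : ℝ) : min (Real.exp t) (Real.exp (-t)) = Real.exp (-|t|) := by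
  rcases le_total 0 t with h | h
  · rw [abs_of_nonneg h, min_eq_right (Real.exp_le_exp.2 (by linarith))]
  · rw [abs_of_nonpos h, min_eq_left (Real.exp_le_exp.2 (by linarith)), neg_neg]

/-- A family of kernels acting diagonally on the Hermite functions, with symbols decaying at `0` and
at infinity. -/
structure HFamily (κ : ℝ → ℝ → ℝ → ℂ) (φ : ℝ → ℝ → ℂ) (C : ℝ) : Prop where
  ker : HKernel κ C
  act : ∀ s, 0 < s → ∀ x (k : ℕ), ∫ y, κ s x y * (hermiteFun k y : ℂ) =
    φ s (2 * k + 1) * hermiteFun k x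
  dec_zero : ∀ s l, 0 < s → 0 < l → ‖φ s l‖ ≤ C * (s / l)
  dec_top : ∀ s l, 0 < s → 0 < l → ‖φ s l‖ ≤ C * (l / s)

lemma HFamily.star {κ : ℝ → ℝ → ℝ → ℂ} {φ : ℝ → ℝ → ℂ} {C : ℝ} (h : HFamily κ φ C) :
    HFamily (fun s x y => (starRingEnd ℂ) (κ s x y)) (fun s l => (starRingEnd ℂ) (φ s l)) C where
  ker := h.ker.star
  act s hs x k := by
    have := congrArg (starRingEnd ℂ) (h.act s hs x k)
    rw [← integral_conj] at this
    simpa only [map_mul, Complex.conj_ofReal] using this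
  dec_zero s l hs hl := by simpa only [RCLike.norm_conj] using h.dec_zero s l hs hl
  dec_top s l hs hl := by simpa only [RCLike.norm_conj] using h.dec_top s l hs hl

lemma HFamily.norm_le {κ : ℝ → ℝ → ℝ → ℂ} {φ : ℝ → ℝ → ℂ} {C : ℝ} (h : HFamily κ φ C) {s l : ℝ}
    (hs : 0 < s) (hl : 0 < l) : ‖φ s l‖ ≤ C * Real.exp (-|Real.log s - Real.log l| / 2) := by
  have hC := h.ker.nonneg
  have h1 : ‖φ s l‖ ≤ C * Real.exp (-|Real.log s - Real.log l|) := by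
    rw [← min_exp_eq, mul_min_of_nonneg _ _ hC]
    refine le_min ?_ ?_
    · rw [Real.exp_sub, Real.exp_log hs, Real.exp_log hl]; exact h.dec_zero s l hs hl
    · rw [neg_sub, Real.exp_sub, Real.exp_log hs, Real.exp_log hl]; exact h.dec_top s l hs hl
  refine h1.trans ?_
  gcongr
  have := abs_nonneg (Real.log s - Real.log l)
  linarith

lemma HFamily.sum_norm_le {κ : ℝ → ℝ → ℝ → ℂ} {φ : ℝ → ℝ → ℂ} {C : ℝ} (h : HFamily κ φ C)
    (J : Finset ℤ) (v : ℝ) {l : ℝ} (hl : 0 < l) :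
    ∑ j ∈ J, ‖φ (Real.exp (v + j)) l‖ ≤ C * dyadSum := by
  calc _ ≤ ∑ j ∈ J, C * Real.exp (-|(j : ℝ) + (v - Real.log l)| / 2) := by
        refine Finset.sum_le_sum fun j _ => (h.norm_le (Real.exp_pos _) hl).trans (le_of_eq ?_)
        rw [Real.log_exp, show v + (j : ℝ) - Real.log l = j + (v - Real.log l) by ring]
    _ ≤ _ := by
        rw [← Finset.mul_sum]
        exact mul_le_mul_of_nonneg_left (sum_exp_neg_abs_le J _) h.ker.nonneg

lemma HKernel.lintegral_far_le {κ : ℝ → ℝ → ℝ → ℂ} {C : ℝ} (h : HKernel κ C) {s : ℝ} (hs : 0 < s)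
    {c r : ℝ} (hr : 0 < r) {y : ℝ} (hy : |y - c| ≤ r) :
    ∫⁻ x in {x | 2 * r ≤ |x - c|}, ‖κ s x y‖ₑ ≤ ENNReal.ofReal (C * (Real.sqrt s * r)⁻¹) := by
  have hrr : ENNReal.ofReal r⁻¹ ≠ ∞ := ENNReal.ofReal_ne_top
  calc _ ≤ ∫⁻ x in {x | 2 * r ≤ |x - c|}, ENNReal.ofReal r⁻¹ * (ENNReal.ofReal |x - y| * ‖κ s x y‖ₑ) := by
        refine setLIntegral_mono' (measurableSet_le (by fun_prop) (by fun_prop)) fun x hx => ?_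
        have hx : 2 * r ≤ |x - c| := hx
        have h1 : r ≤ |x - y| := by
          have : |x - c| ≤ |x - y| + |y - c| := abs_sub_le x y c
          linarith
        rw [← mul_assoc, ← ENNReal.ofReal_mul (by positivity)]
        nth_rewrite 1 [← one_mul ‖κ s x y‖ₑ]
        refine mul_le_mul' ?_ le_rfl
        rw [ENNReal.one_le_ofReal, inv_mul_eq_div, le_div_iff₀ hr, one_mul]
        exact h1
    _ ≤ ∫⁻ x, ENNReal.ofReal r⁻¹ * (ENNReal.ofReal |x - y| * ‖κ s x y‖ₑ) :=
        setLIntegral_le_lintegral _ _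
    _ ≤ ENNReal.ofReal r⁻¹ * ENNReal.ofReal (C * (Real.sqrt s)⁻¹) := by
        rw [lintegral_const_mul' _ _ hrr]
        exact mul_le_mul' le_rfl (h.mom s hs y)
    _ = _ := by
        rw [← ENNReal.ofReal_mul (by positivity), mul_inv]; congr 1; ring

lemma HKernel.lintegral_hor_le {κ : ℝ → ℝ → ℝ → ℂ} {C : ℝ} (h : HKernel κ C) {s : ℝ} (hs : 0 < s)
    {c r : ℝ} (hr : 0 < r) {y : ℝ} (hy : |y - c| ≤ r) :
    ∫⁻ x in {x | 2 * r ≤ |x - c|}, ‖κ s x y - κ s x c‖ₑ ≤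
      ENNReal.ofReal (2 * C * Real.exp (-|Real.log s + 2 * Real.log r| / 2)) := by
  have hC := h.nonneg
  have e1 : Real.sqrt s * r = Real.exp ((Real.log s + 2 * Real.log r) / 2) := by
    rw [show (Real.log s + 2 * Real.log r) / 2 = Real.log s / 2 + Real.log r by ring, Real.exp_add,
      Real.exp_log hr, ← Real.log_sqrt hs.le, Real.exp_log (Real.sqrt_pos.2 hs)]
  have e2 : Real.exp (-|Real.log s + 2 * Real.log r| / 2) =
      min (Real.sqrt s * r) (Real.sqrt s * r)⁻¹ := by
    rw [e1, ← Real.exp_neg, min_exp_eq, abs_div, abs_two, neg_div]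
  rw [e2, mul_min_of_nonneg _ _ (by positivity), ENNReal.ofReal_mono.map_min]
  refine le_min ?_ ?_
  · refine (setLIntegral_le_lintegral _ _).trans ((h.diff s hs y c).trans ?_)
    apply ENNReal.ofReal_le_ofReal
    calc C * Real.sqrt s * |y - c| ≤ C * Real.sqrt s * r := by gcongr
      _ ≤ 2 * C * (Real.sqrt s * r) := by
        have : 0 ≤ C * (Real.sqrt s * r) := by positivity
        linarith
  · calc _ ≤ ∫⁻ x in {x | 2 * r ≤ |x - c|}, (‖κ s x y‖ₑ + ‖κ s x c‖ₑ) :=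
          lintegral_mono fun x => enorm_sub_le
      _ = (∫⁻ x in {x | 2 * r ≤ |x - c|}, ‖κ s x y‖ₑ) + ∫⁻ x in {x | 2 * r ≤ |x - c|}, ‖κ s x c‖ₑ :=
          lintegral_add_left (h.measurable_left hs y).enorm _
      _ ≤ _ := add_le_add (h.lintegral_far_le hs hr hy)
          (h.lintegral_far_le hs hr (by simpa using hr.le))
      _ = _ := by rw [← ENNReal.ofReal_add (by positivity) (by positivity)]; congr 1; ring

section operators
variable {ι ι' : Type*} [Fintype ι] [Fintype ι']

/-- The kernel `∑ⱼ κ_{e^{v+j}}(x,y) Aⱼ`. -/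
noncomputable def dyadKernel (κ : ℝ → ℝ → ℝ → ℂ) (J : Finset ℤ) (v : ℝ)
    (A : ℤ → EuclideanSpace ℂ ι →L[ℂ] EuclideanSpace ℂ ι') (x y : ℝ) :
    EuclideanSpace ℂ ι →L[ℂ] EuclideanSpace ℂ ι' :=
  ∑ j ∈ J, κ (Real.exp (v + j)) x y • A j

variable {κ : ℝ → ℝ → ℝ → ℂ} {φ : ℝ → ℝ → ℂ} {C : ℝ}
  {A : ℤ → EuclideanSpace ℂ ι →L[ℂ] EuclideanSpace ℂ ι'}

lemma HKernel.norm_le (h : HKernel κ C) {s : ℝ} (hs : 0 < s) (x y : ℝ) :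
    ‖κ s x y‖ ≤ C * Real.sqrt s := by
  have := h.sup s hs x y
  have hC := h.nonneg
  rwa [← ofReal_norm, ENNReal.ofReal_le_ofReal_iff (by positivity)] at this

lemma HKernel.czKernel_dyadKernel (h : HKernel κ C) (J : Finset ℤ) (v : ℝ) (hA : ∀ j, ‖A j‖ ≤ 1) :
    CZKernel (dyadKernel κ J v A) (∑ j ∈ J, C * Real.sqrt (Real.exp (v + j)))
      (ENNReal.ofReal (2 * C * dyadSum)) where
  meas := by
    have : Function.uncurry (dyadKernel κ J v A) =
        fun q => ∑ j ∈ J, Function.uncurry (κ (Real.exp (v + j))) q • A j := by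
      ext q; simp [dyadKernel, Function.uncurry]
    rw [this]
    exact Finset.stronglyMeasurable_fun_sum _ fun j _ =>
      (h.meas _ (Real.exp_pos _)).stronglyMeasurable.smul_const _
  sup x y := by
    refine (norm_sum_le _ _).trans (Finset.sum_le_sum fun j _ => ?_)
    rw [norm_smul]
    calc _ ≤ C * Real.sqrt (Real.exp (v + j)) * 1 :=
          mul_le_mul (h.norm_le (Real.exp_pos _) x y) (hA j) (norm_nonneg _)
            ((norm_nonneg _).trans (h.norm_le (Real.exp_pos _) x y))
      _ = _ := mul_one _
  hor c r hr y hy := by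
    have hC := h.nonneg
    have e : ∀ x, ‖dyadKernel κ J v A x y - dyadKernel κ J v A x c‖ₑ ≤
        ∑ j ∈ J, ‖κ (Real.exp (v + j)) x y - κ (Real.exp (v + j)) x c‖ₑ := by
      intro x
      unfold dyadKernel
      rw [← Finset.sum_sub_distrib]
      refine (enorm_sum_le (ε := EuclideanSpace ℂ ι →L[ℂ] EuclideanSpace ℂ ι') _ _).trans
        (Finset.sum_le_sum fun j _ => ?_)
      have e0 : κ (Real.exp (v + j)) x y • A j - κ (Real.exp (v + j)) x c • A j =
          (κ (Real.exp (v + j)) x y - κ (Real.exp (v + j)) x c) • A j := (sub_smul _ _ _).symm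
      rw [e0, enorm_smul]
      have : ‖A j‖ₑ ≤ 1 := by rw [← ofReal_norm]; exact ENNReal.ofReal_le_one.2 (hA j)
      exact (mul_le_mul' le_rfl this).trans (mul_one _).le
    calc _ ≤ ∫⁻ x in {x | 2 * r ≤ |x - c|},
          ∑ j ∈ J, ‖κ (Real.exp (v + j)) x y - κ (Real.exp (v + j)) x c‖ₑ := lintegral_mono e
      _ = ∑ j ∈ J, ∫⁻ x in {x | 2 * r ≤ |x - c|},
          ‖κ (Real.exp (v + j)) x y - κ (Real.exp (v + j)) x c‖ₑ :=
          lintegral_finsetSum _ fun j _ => ((h.measurable_left (Real.exp_pos _) y).sub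
            (h.measurable_left (Real.exp_pos _) c)).enorm
      _ ≤ ∑ j ∈ J, ENNReal.ofReal (2 * C * Real.exp (-|(j : ℝ) + (v + 2 * Real.log r)| / 2)) := by
          refine Finset.sum_le_sum fun j _ =>
            (h.lintegral_hor_le (Real.exp_pos _) hr hy).trans (le_of_eq ?_)
          rw [Real.log_exp, show v + (j : ℝ) + 2 * Real.log r = j + (v + 2 * Real.log r) by ring]
      _ = ENNReal.ofReal (∑ j ∈ J, 2 * C * Real.exp (-|(j : ℝ) + (v + 2 * Real.log r)| / 2)) :=
          (ENNReal.ofReal_sum_of_nonneg fun j _ => by positivity).symm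
      _ ≤ _ := by
          apply ENNReal.ofReal_le_ofReal
          rw [← Finset.mul_sum]
          exact mul_le_mul_of_nonneg_left (sum_exp_neg_abs_le J _) (by positivity)

end operators

lemma memLp_two_of_bounded {E : Type*} [NormedAddCommGroup E] {f : ℝ → E} (hf : Integrable f) {M : ℝ}
    (hM : ∀ x, ‖f x‖ ≤ M) : MemLp f 2 := by
  rw [memLp_two_iff_integrable_sq_norm hf.1]
  refine (hf.norm.const_mul M).mono' (hf.1.norm.pow 2) (Filter.Eventually.of_forall fun x => ?_)
  rw [Real.norm_of_nonneg (by positivity), sq]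
  exact mul_le_mul_of_nonneg_right (hM x) (norm_nonneg _)

lemma integrable_hermiteFun_smul {E : Type*} [NormedAddCommGroup E] [NormedSpace ℂ E] {f : ℝ → E}
    (hf : Integrable f) (k : ℕ) : Integrable (fun u => (hermiteFun k u : ℂ) • f u) := by
  obtain ⟨C, h⟩ := hermiteFun_abs_le k
  refine hf.bdd_smul C (by have := continuous_hermiteFun k
                           exact (by fun_prop : Continuous _).aestronglyMeasurable) ?_
  exact Filter.Eventually.of_forall fun u => by rw [Complex.norm_real]; exact h u

section scalar
variable {E : Type*} [NormedAddCommGroup E] [NormedSpace ℂ E] [CompleteSpace E]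
  {κ : ℝ → ℝ → ℝ → ℂ} {φ : ℝ → ℝ → ℂ} {C : ℝ} {G : ℝ → E}

/-- The integral operator with a scalar kernel. -/
noncomputable def scalarOp (κ : ℝ → ℝ → ℂ) (G : ℝ → E) (x : ℝ) : E := ∫ y, κ x y • G y

lemma HKernel.integrable_smul (h : HKernel κ C) {s : ℝ} (hs : 0 < s) (hG : Integrable G) (x : ℝ) :
    Integrable (fun y => κ s x y • G y) := by
  refine hG.bdd_smul (C * Real.sqrt s) ?_ (Filter.Eventually.of_forall fun y => h.norm_le hs x y)
  exact ((h.meas s hs).comp (by fun_prop : Measurable fun y : ℝ => (x, y))).aestronglyMeasurable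

lemma HKernel.norm_scalarOp_le (h : HKernel κ C) {s : ℝ} (hs : 0 < s) (hG : Integrable G) (x : ℝ) :
    ‖scalarOp (κ s) G x‖ ≤ C * Real.sqrt s * ∫ y, ‖G y‖ := by
  unfold scalarOp
  rw [← integral_const_mul]
  refine norm_integral_le_of_norm_le (hG.norm.const_mul _) (Filter.Eventually.of_forall fun y => ?_)
  rw [norm_smul]
  exact mul_le_mul_of_nonneg_right (h.norm_le hs x y) (norm_nonneg _)

lemma HKernel.integrable_scalarOp (h : HKernel κ C) {s : ℝ} (hs : 0 < s) (hG : Integrable G) :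
    Integrable (scalarOp (κ s) G) := by
  have : Integrable (fun q : ℝ × ℝ => κ s q.1 q.2 • G q.2) (volume.prod volume) := by
    have hm : AEStronglyMeasurable (fun q : ℝ × ℝ => κ s q.1 q.2 • G q.2) (volume.prod volume) :=
      (h.meas s hs).aestronglyMeasurable.smul hG.1.comp_snd
    refine ⟨hm, ?_⟩
    unfold HasFiniteIntegral
    rw [lintegral_prod_symm _ hm.enorm]
    calc _ ≤ ∫⁻ y, ENNReal.ofReal C * ‖G y‖ₑ := by
          refine lintegral_mono fun y => ?_
          simp only [enorm_smul]
          rw [lintegral_mul_const' _ _ enorm_ne_top]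
          exact mul_le_mul' (h.int s hs y) le_rfl
      _ < ∞ := by
          rw [lintegral_const_mul' _ _ ENNReal.ofReal_ne_top]
          exact ENNReal.mul_lt_top ENNReal.ofReal_lt_top hG.2
  exact this.integral_prod_left

lemma HFamily.hcoef_scalarOp (h : HFamily κ φ C) {s : ℝ} (hs : 0 < s) (hG : Integrable G) (k : ℕ) :
    hcoef k (scalarOp (κ s) G) = φ s (2 * k + 1) • hcoef k G := by
  unfold hcoef scalarOp
  have hI : Integrable (fun q : ℝ × ℝ => (hermiteFun k q.1 : ℂ) • κ s q.1 q.2 • G q.2)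
      (volume.prod volume) := by
    have hm : AEStronglyMeasurable (fun q : ℝ × ℝ => (hermiteFun k q.1 : ℂ) • κ s q.1 q.2 • G q.2)
        (volume.prod volume) := by
      refine AEStronglyMeasurable.smul ?_ ((h.ker.meas s hs).aestronglyMeasurable.smul hG.1.comp_snd)
      have := continuous_hermiteFun k
      exact (by fun_prop : Continuous fun q : ℝ × ℝ => (hermiteFun k q.1 : ℂ)).aestronglyMeasurable
    refine (((integrable_hermiteFun k).norm.mul_prod hG.norm).const_mul (C * Real.sqrt s)).mono' hm
      (Filter.Eventually.of_forall fun q => ?_)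
    rw [norm_smul, norm_smul, Complex.norm_real]
    calc _ ≤ ‖hermiteFun k q.1‖ * ((C * Real.sqrt s) * ‖G q.2‖) := by
          gcongr; exact h.ker.norm_le hs _ _
      _ = _ := by ring
  simp_rw [← integral_smul]
  rw [integral_integral_swap hI]
  congr 1; funext y
  simp_rw [smul_smul]
  rw [integral_smul_const]
  congr 1
  rw [← h.act s hs y k]
  congr 1; funext x
  rw [h.ker.symm s x y, mul_comm]

end scalar

section operators
variable {ι ι' : Type*} [Fintype ι] [Fintype ι']
variable {κ : ℝ → ℝ → ℝ → ℂ} {φ : ℝ → ℝ → ℂ} {C : ℝ}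
  {A : ℤ → EuclideanSpace ℂ ι →L[ℂ] EuclideanSpace ℂ ι'} {G : ℝ → EuclideanSpace ℂ ι}

lemma HKernel.opT_dyadKernel (h : HKernel κ C) (J : Finset ℤ) (v : ℝ) (hG : Integrable G) (x : ℝ) :
    opT (dyadKernel κ J v A) G x = ∑ j ∈ J, A j (scalarOp (κ (Real.exp (v + j))) G x) := by
  unfold opT dyadKernel scalarOp
  simp_rw [sum_apply, smul_apply]
  rw [integral_finsetSum]
  · refine Finset.sum_congr rfl fun j _ => ?_
    rw [← (A j).integral_comp_comm (h.integrable_smul (Real.exp_pos _) hG x)]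
    simp_rw [map_smul]
  · intro j _
    have := (A j).integrable_comp (h.integrable_smul (Real.exp_pos (v + j)) hG x)
    simpa only [map_smul] using this

lemma HFamily.hcoef_opT_dyadKernel (h : HFamily κ φ C) (J : Finset ℤ) (v : ℝ) (hG : Integrable G)
    (k : ℕ) : hcoef k (opT (dyadKernel κ J v A) G) =
      ∑ j ∈ J, φ (Real.exp (v + j)) (2 * k + 1) • A j (hcoef k G) := by
  have e : opT (dyadKernel κ J v A) G = fun x => ∑ j ∈ J, A j (scalarOp (κ (Real.exp (v + j))) G x) :=
    funext (h.ker.opT_dyadKernel J v hG)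
  rw [e]
  unfold hcoef
  simp_rw [Finset.smul_sum, ← map_smul]
  rw [integral_finsetSum]
  · refine Finset.sum_congr rfl fun j _ => ?_
    rw [(A j).integral_comp_comm (integrable_hermiteFun_smul
      (h.ker.integrable_scalarOp (Real.exp_pos _) hG) k)]
    congr 1
    exact h.hcoef_scalarOp (Real.exp_pos _) hG k
  · intro j _
    exact (A j).integrable_comp (integrable_hermiteFun_smul
      (h.ker.integrable_scalarOp (Real.exp_pos _) hG) k)

lemma HFamily.integrable_opT (h : HFamily κ φ C) (J : Finset ℤ) (v : ℝ) (hG : Integrable G) :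
    Integrable (opT (dyadKernel κ J v A) G) := by
  have e : opT (dyadKernel κ J v A) G = fun x => ∑ j ∈ J, A j (scalarOp (κ (Real.exp (v + j))) G x) :=
    funext (h.ker.opT_dyadKernel J v hG)
  rw [e]
  exact integrable_finsetSum _ fun j _ => (A j).integrable_comp
    (h.ker.integrable_scalarOp (Real.exp_pos _) hG)

lemma HFamily.memLp_opT (h : HFamily κ φ C) (J : Finset ℤ) (v : ℝ) (hG : Integrable G) :
    MemLp (opT (dyadKernel κ J v A) G) 2 := by
  refine memLp_two_of_bounded (h.integrable_opT J v hG)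
    (M := ∑ j ∈ J, ‖A j‖ * (C * Real.sqrt (Real.exp (v + j)) * ∫ y, ‖G y‖)) fun x => ?_
  rw [h.ker.opT_dyadKernel J v hG x]
  refine (norm_sum_le _ _).trans (Finset.sum_le_sum fun j _ => ?_)
  exact (A j).le_opNorm_of_le (h.ker.norm_scalarOp_le (Real.exp_pos _) hG x)

/-- Boundedness on `L²`. -/
lemma HFamily.lintegral_sq_opT_le (h : HFamily κ φ C) (J : Finset ℤ) (v : ℝ) (hA : ∀ j, ‖A j‖ ≤ 1)
    (hG : Integrable G) (hGb : ∃ M : ℝ, ∀ x, ‖G x‖ ≤ M) :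
    ∫⁻ x, ‖opT (dyadKernel κ J v A) G x‖ₑ ^ 2 ≤
      ENNReal.ofReal (C * dyadSum) ^ 2 * ∫⁻ x, ‖G x‖ₑ ^ 2 := by
  obtain ⟨M, hM⟩ := hGb
  rw [lintegral_sq_eq_tsum_hcoef (h.memLp_opT J v hG),
    lintegral_sq_eq_tsum_hcoef (memLp_two_of_bounded hG hM), ← ENNReal.tsum_mul_left]
  refine ENNReal.tsum_le_tsum fun k => ?_
  rw [← mul_pow]
  gcongr
  rw [h.hcoef_opT_dyadKernel J v hG]
  have hn : ‖∑ j ∈ J, φ (Real.exp (v + j)) (2 * k + 1) • A j (hcoef k G)‖ ≤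
      (C * dyadSum) * ‖hcoef k G‖ := by
    refine (norm_sum_le _ _).trans ?_
    calc _ ≤ ∑ j ∈ J, ‖φ (Real.exp (v + j)) (2 * k + 1)‖ * ‖hcoef k G‖ := by
          refine Finset.sum_le_sum fun j _ => ?_
          rw [norm_smul]
          gcongr
          exact ((A j).le_of_opNorm_le (hA j) _).trans (one_mul _).le
      _ ≤ _ := by
          rw [← Finset.sum_mul]
          gcongr
          exact h.sum_norm_le J v (by positivity)
  have hC := h.ker.nonneg
  rw [← ofReal_norm, ← ofReal_norm, ← ENNReal.ofReal_mul (mul_nonneg hC dyadSum_nonneg)]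
  exact ENNReal.ofReal_le_ofReal hn

end operators

section duality
variable {E E' : Type*} [NormedAddCommGroup E] [InnerProductSpace ℂ E] [CompleteSpace E]
  [NormedAddCommGroup E'] [InnerProductSpace ℂ E'] [CompleteSpace E']
  {K : ℝ → ℝ → E →L[ℂ] E'} {K' : ℝ → ℝ → E' →L[ℂ] E} {D D' : ℝ} {A A' : ℝ≥0∞}

/-- The transposed kernel gives the adjoint operator. -/
lemma CZKernel.integral_inner_opT (hK : CZKernel K D A) (hK' : CZKernel K' D' A')
    (hadj : ∀ x y, ∀ (e : E) (e' : E'), inner ℂ e' (K x y e) = inner ℂ (K' y x e') e)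
    {F : ℝ → E} {G : ℝ → E'} (hF : Integrable F) (hG : Integrable G) :
    ∫ x, inner ℂ (G x) (opT K F x) = ∫ y, inner ℂ (opT K' G y) (F y) := by
  have hI : Integrable (fun q : ℝ × ℝ => (inner ℂ (G q.1) (K q.1 q.2 (F q.2)) : ℂ))
      (volume.prod volume) := by
    have hm : AEStronglyMeasurable (fun q : ℝ × ℝ => (inner ℂ (G q.1) (K q.1 q.2 (F q.2)) : ℂ))
        (volume.prod volume) :=
      hG.1.comp_fst.inner
        (aestronglyMeasurable_clm_apply hK.meas.aestronglyMeasurable hF.1.comp_snd)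
    refine ((hG.norm.mul_prod hF.norm).const_mul D).mono' hm (Filter.Eventually.of_forall fun q => ?_)
    calc _ ≤ ‖G q.1‖ * ‖K q.1 q.2 (F q.2)‖ := norm_inner_le_norm _ _
      _ ≤ ‖G q.1‖ * (D * ‖F q.2‖) := by
        gcongr; exact (K q.1 q.2).le_of_opNorm_le (hK.sup _ _) _
      _ = _ := by ring
  have e1 : ∀ x, inner ℂ (G x) (opT K F x) = ∫ y, (inner ℂ (G x) (K x y (F y)) : ℂ) := fun x =>
    ((innerSL ℂ (G x)).integral_comp_comm (hK.integrable hF x)).symm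
  have e2 : ∀ y, inner ℂ (opT K' G y) (F y) = ∫ x, (inner ℂ (G x) (K x y (F y)) : ℂ) := by
    intro y
    rw [← inner_conj_symm]
    have := (innerSL ℂ (F y)).integral_comp_comm (hK'.integrable hG y)
    simp only [innerSL_apply_apply] at this
    unfold opT
    rw [← this, ← integral_conj]
    congr 1; funext x
    rw [inner_conj_symm, hadj]
  simp_rw [e1, e2]
  exact integral_integral_swap hI

lemma CZKernel.lintegral_rpow_le_of_two_lt (hK : CZKernel K D A) (hK' : CZKernel K' D' A')
    (hadj : ∀ x y, ∀ (e : E) (e' : E'), inner ℂ e' (K x y e) = inner ℂ (K' y x e') e)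
    {B : ℝ≥0∞} (hL2 : ∀ G : ℝ → E', Integrable G → (∃ M : ℝ, ∀ x, ‖G x‖ ≤ M) →
      ∫⁻ x, ‖opT K' G x‖ₑ ^ 2 ≤ B * ∫⁻ x, ‖G x‖ₑ ^ 2)
    {F : ℝ → E} (hFi : Integrable F) (hc : Continuous (opT K F)) (hi : Integrable (opT K F))
    (hb : ∃ M : ℝ, ∀ x, ‖opT K F x‖ ≤ M) {p : ℝ} (hp : 2 < p) :
    ∫⁻ x, ‖opT K F x‖ₑ ^ p ≤ interpConst (p / (p - 1)) A' B ^ (p - 1) * ∫⁻ x, ‖F x‖ₑ ^ p := by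
  obtain ⟨M, hM⟩ := hb
  set H := opT K F with hH
  set p' := p / (p - 1) with hp'
  have hp1 : 0 < p - 1 := by linarith
  have hp0 : 0 < p := by linarith
  have hp'1 : 1 < p' := by rw [hp', lt_div_iff₀ hp1]; linarith
  have hp'2 : p' < 2 := by rw [hp', div_lt_iff₀ hp1]; linarith
  have hconj : p'.HolderConjugate p := by
    rw [Real.holderConjugate_iff]
    refine ⟨hp'1, ?_⟩
    rw [hp']; field_simp; ring
  set G : ℝ → E' := fun x => ((‖H x‖ ^ (p - 2) : ℝ) : ℂ) • H x with hGdef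
  have hGc : Continuous G := by
    have : Continuous fun x => ‖H x‖ ^ (p - 2) := hc.norm.rpow_const fun x => Or.inr (by linarith)
    fun_prop
  have hGn : ∀ x, ‖G x‖ = ‖H x‖ ^ (p - 1) := by
    intro x
    rw [hGdef]
    simp only [norm_smul, Complex.norm_real, Real.norm_of_nonneg (Real.rpow_nonneg (norm_nonneg _) _)]
    rw [show p - 1 = p - 2 + 1 by ring, Real.rpow_add_one' (norm_nonneg _) (by linarith)]
  have hGi : Integrable G := by
    refine hi.bdd_smul (M ^ (p - 2)) ?_ (Filter.Eventually.of_forall fun x => ?_)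
    · have : Continuous fun x => ‖H x‖ ^ (p - 2) := hc.norm.rpow_const fun x => Or.inr (by linarith)
      exact (by fun_prop : Continuous _).aestronglyMeasurable
    · rw [Complex.norm_real, Real.norm_of_nonneg (Real.rpow_nonneg (norm_nonneg _) _)]
      exact Real.rpow_le_rpow (norm_nonneg _) (hM x) (by linarith)
  have hGp : ∀ x, ‖G x‖ₑ ^ p' = ‖H x‖ₑ ^ p := by
    intro x
    rw [← ofReal_norm, hGn, ← ENNReal.ofReal_rpow_of_nonneg (norm_nonneg _) hp1.le, ofReal_norm,
      ← ENNReal.rpow_mul]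
    congr 1; rw [hp']; field_simp
  have hpt : ∀ x, inner ℂ (G x) (H x) = ((‖H x‖ ^ p : ℝ) : ℂ) := by
    intro x
    rw [hGdef]
    simp only [inner_smul_left, Complex.conj_ofReal, inner_self_eq_norm_sq_to_K]
    rw [show p = p - 2 + (2 : ℕ) by push_cast; ring,
      Real.rpow_add_natCast' (norm_nonneg _) (by push_cast; linarith)]
    push_cast
    simp
  set X := ∫⁻ x, ‖H x‖ₑ ^ p with hX
  set Y := ∫⁻ x, ‖F x‖ₑ ^ p with hY
  set c := interpConst p' A' B with hcdef
  have hHp : Integrable fun x => ‖H x‖ ^ p := by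
    have : ∀ x, ‖H x‖ ^ p = ‖H x‖ ^ (p - 1) * ‖H x‖ := fun x => by
      rw [← Real.rpow_add_one' (norm_nonneg _) (by linarith)]; congr 1; ring
    simp_rw [this]
    refine hi.norm.bdd_mul (c := M ^ (p - 1)) ?_ (Filter.Eventually.of_forall fun x => ?_)
    · have : Continuous fun x => ‖H x‖ ^ (p - 1) := hc.norm.rpow_const fun x => Or.inr (by linarith)
      exact this.aestronglyMeasurable
    · rw [Real.norm_of_nonneg (Real.rpow_nonneg (norm_nonneg _) _)]
      exact Real.rpow_le_rpow (norm_nonneg _) (hM x) (by linarith)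
  have hXeq : X = ENNReal.ofReal (∫ x, ‖H x‖ ^ p) := by
    rw [ofReal_integral_eq_lintegral_ofReal hHp
      (Filter.Eventually.of_forall fun x => Real.rpow_nonneg (norm_nonneg _) _)]
    rw [hX]
    congr 1; funext x
    rw [← ENNReal.ofReal_rpow_of_nonneg (norm_nonneg _) hp0.le, ofReal_norm]
  have hXfin : X ≠ ∞ := by rw [hXeq]; exact ENNReal.ofReal_ne_top
  have hdual := hK.integral_inner_opT hK' hadj hFi hGi
  rw [← hH] at hdual
  simp_rw [hpt] at hdual
  rw [integral_complex_ofReal] at hdual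
  have hle : X ≤ (c * X) ^ (1 / p') * Y ^ (1 / p) := by
    calc X = ‖((∫ x, ‖H x‖ ^ p : ℝ) : ℂ)‖ₑ := by
          rw [hXeq, ← ofReal_norm, Complex.norm_real, Real.norm_of_nonneg]
          exact integral_nonneg fun x => Real.rpow_nonneg (norm_nonneg _) _
      _ ≤ ∫⁻ y, ‖(inner ℂ (opT K' G y) (F y) : ℂ)‖ₑ := by
          rw [hdual]; exact enorm_integral_le_lintegral_enorm _
      _ ≤ ∫⁻ y, ‖opT K' G y‖ₑ * ‖F y‖ₑ := by
          refine lintegral_mono fun y => ?_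
          simp only [← ofReal_norm]
          rw [← ENNReal.ofReal_mul (norm_nonneg _)]
          exact ENNReal.ofReal_le_ofReal (norm_inner_le_norm _ _)
      _ ≤ (∫⁻ y, ‖opT K' G y‖ₑ ^ p') ^ (1 / p') * (∫⁻ y, ‖F y‖ₑ ^ p) ^ (1 / p) :=
          ENNReal.lintegral_mul_le_Lp_mul_Lq volume hconj
            (hK'.aestronglyMeasurable_opT hGi.1).enorm hFi.1.enorm
      _ ≤ _ := by
          refine mul_le_mul' (ENNReal.rpow_le_rpow ?_ (by positivity)) le_rfl
          have := hK'.lintegral_rpow_le hL2 hGc hGi hp'1 hp'2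
          simpa only [hGp] using this
  rcases eq_or_ne X 0 with h0 | h0
  · rw [h0]; exact zero_le
  have e1 : 1 / p' = 1 - 1 / p := by rw [hp']; field_simp
  have hX' : X = X ^ (1 / p') * X ^ (1 / p) := by
    rw [← ENNReal.rpow_add _ _ h0 hXfin, e1, sub_add_cancel, ENNReal.rpow_one]
  rw [ENNReal.mul_rpow_of_nonneg _ _ (by positivity)] at hle
  have h2 : X ^ (1 / p) ≤ c ^ (1 / p') * Y ^ (1 / p) := by
    have hz : X ^ (1 / p') ≠ 0 := by
      rw [Ne, ENNReal.rpow_eq_zero_iff]; rintro (h | h)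
      · exact h0 h.1
      · exact hXfin h.1
    have ht : X ^ (1 / p') ≠ ∞ := ENNReal.rpow_ne_top_of_nonneg (by positivity) hXfin
    rw [← ENNReal.mul_le_mul_iff_right hz ht, ← hX']
    refine hle.trans (le_of_eq ?_); ring
  calc X = (X ^ (1 / p)) ^ p := by
        rw [← ENNReal.rpow_mul, one_div_mul_cancel hp0.ne', ENNReal.rpow_one]
    _ ≤ (c ^ (1 / p') * Y ^ (1 / p)) ^ p := ENNReal.rpow_le_rpow h2 hp0.le
    _ = _ := by
        rw [ENNReal.mul_rpow_of_nonneg _ _ hp0.le, ← ENNReal.rpow_mul, ← ENNReal.rpow_mul,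
          one_div_mul_cancel hp0.ne', ENNReal.rpow_one, e1]
        congr 2; field_simp

end duality

/-- A finite Hermite expansion with vector coefficients. -/
noncomputable def hexp {E : Type*} [AddCommGroup E] [Module ℂ E] (N : ℕ) (a : ℕ → E) (x : ℝ) : E :=
  ∑ k ∈ Finset.range N, (hermiteFun k x : ℂ) • a k

section hexp
variable {E : Type*} [NormedAddCommGroup E] [NormedSpace ℂ E] (N : ℕ) (a : ℕ → E)

lemma continuous_hexp : Continuous (hexp N a) := by
  unfold hexp
  refine continuous_finsetSum _ fun k _ => ?_
  have := continuous_hermiteFun k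
  fun_prop

lemma integrable_hexp : Integrable (hexp N a) := by
  unfold hexp
  exact integrable_finsetSum _ fun k _ => (integrable_hermiteFun k).ofReal.smul_const _

lemma hexp_bounded : ∃ M : ℝ, ∀ x, ‖hexp N a x‖ ≤ M := by
  choose C hC using hermiteFun_abs_le
  refine ⟨∑ k ∈ Finset.range N, C k * ‖a k‖, fun x => (norm_sum_le _ _).trans ?_⟩
  refine Finset.sum_le_sum fun k _ => ?_
  rw [norm_smul, Complex.norm_real]
  gcongr
  exact hC k x

end hexp

/-- The constant in the one-dimensional `L^p` estimate. -/
noncomputable def lpConst (p C : ℝ) : ℝ≥0∞ :=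
  max (ENNReal.ofReal (C * dyadSum) ^ 2)
    (max (interpConst p (ENNReal.ofReal (2 * C * dyadSum)) (ENNReal.ofReal (C * dyadSum) ^ 2))
    (interpConst (p / (p - 1)) (ENNReal.ofReal (2 * C * dyadSum))
      (ENNReal.ofReal (C * dyadSum) ^ 2) ^ (p - 1)))

lemma lpConst_ne_top {p C : ℝ} (hp : 1 < p) : lpConst p C ≠ ∞ := by
  unfold lpConst
  have h1 : ENNReal.ofReal (C * dyadSum) ^ 2 ≠ ∞ := by finiteness
  have hp1 : 0 < p - 1 := by linarith
  refine max_ne_top h1 (max_ne_top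
    (interpConst_ne_top (by linarith) ENNReal.ofReal_ne_top h1) ?_)
  exact ENNReal.rpow_ne_top_of_nonneg hp1.le
    (interpConst_ne_top (div_pos (by linarith) hp1) ENNReal.ofReal_ne_top h1)

section main
variable {ι ι' : Type*} [Fintype ι] [Fintype ι'] {κ : ℝ → ℝ → ℝ → ℂ} {φ : ℝ → ℝ → ℂ} {C : ℝ}
  {A : ℤ → EuclideanSpace ℂ ι →L[ℂ] EuclideanSpace ℂ ι'}

lemma HFamily.opT_hexp (h : HFamily κ φ C) (J : Finset ℤ) (v : ℝ) (N : ℕ)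
    (a : ℕ → EuclideanSpace ℂ ι) :
    opT (dyadKernel κ J v A) (hexp N a) =
      hexp N (fun k => ∑ j ∈ J, φ (Real.exp (v + j)) (2 * k + 1) • A j (a k)) := by
  funext x
  rw [h.ker.opT_dyadKernel J v (integrable_hexp N a) x]
  have e : ∀ j : ℤ, scalarOp (κ (Real.exp (v + j))) (hexp N a) x =
      ∑ k ∈ Finset.range N, (φ (Real.exp (v + j)) (2 * k + 1) * hermiteFun k x) • a k := by
    intro j
    unfold scalarOp hexp
    simp_rw [Finset.smul_sum, smul_smul]
    rw [integral_finsetSum]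
    · refine Finset.sum_congr rfl fun k _ => ?_
      rw [integral_smul_const, h.act _ (Real.exp_pos _)]
    · intro k _
      have := h.ker.integrable_smul (Real.exp_pos (v + j)) ((integrable_hermiteFun k).ofReal (𝕜 := ℂ)) x
      exact Integrable.smul_const this _
  simp_rw [e]
  unfold hexp
  simp_rw [map_sum, map_smul, Finset.smul_sum]
  rw [Finset.sum_comm]
  refine Finset.sum_congr rfl fun k _ => Finset.sum_congr rfl fun j _ => ?_
  rw [smul_smul, mul_comm]

/-- The one-dimensional `L^p` estimate for dyadic sums. -/
theorem HFamily.lintegral_rpow_le (h : HFamily κ φ C) (J : Finset ℤ) (v : ℝ) (hA : ∀ j, ‖A j‖ ≤ 1)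
    {p : ℝ} (hp : 1 < p) (N : ℕ) (a : ℕ → EuclideanSpace ℂ ι) :
    ∫⁻ x, ‖hexp N (fun k => ∑ j ∈ J, φ (Real.exp (v + j)) (2 * k + 1) • A j (a k)) x‖ₑ ^ p ≤
      lpConst p C * ∫⁻ x, ‖hexp N a x‖ₑ ^ p := by
  rw [← h.opT_hexp J v N a]
  have hK := h.ker.czKernel_dyadKernel J v hA
  rcases lt_trichotomy p 2 with h2 | h2 | h2
  · refine (hK.lintegral_rpow_le (fun G hG hGb => h.lintegral_sq_opT_le J v hA hG hGb)
      (continuous_hexp N a) (integrable_hexp N a) hp h2).trans (mul_le_mul' ?_ le_rfl)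
    exact (le_max_left _ _).trans (le_max_right _ _)
  · subst h2
    have := h.lintegral_sq_opT_le J v hA (integrable_hexp N a) (hexp_bounded N a)
    simp only [ENNReal.rpow_two]
    exact this.trans (mul_le_mul' (le_max_left _ _) le_rfl)
  · have hA' : ∀ j, ‖ContinuousLinearMap.adjoint (A j)‖ ≤ 1 := fun j => by
      rw [LinearIsometryEquiv.norm_map]; exact hA j
    have hK' := h.star.ker.czKernel_dyadKernel J v hA'
    refine (hK.lintegral_rpow_le_of_two_lt hK' ?_
      (fun G hG hGb => h.star.lintegral_sq_opT_le J v hA' hG hGb) (integrable_hexp N a)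
      ?_ ?_ ?_ h2).trans (mul_le_mul' ?_ le_rfl)
    · intro x y e e'
      unfold dyadKernel
      rw [sum_apply, sum_apply, inner_sum, sum_inner]
      refine Finset.sum_congr rfl fun j _ => ?_
      rw [smul_apply, smul_apply, inner_smul_left,
        inner_smul_right, ContinuousLinearMap.adjoint_inner_left, Complex.conj_conj,
        h.ker.symm _ x y]
    · rw [h.opT_hexp J v N a]; exact continuous_hexp _ _
    · exact h.integrable_opT J v (integrable_hexp N a)
    · rw [h.opT_hexp J v N a]; exact hexp_bounded _ _
    · exact (le_max_right _ _).trans (le_max_right _ _)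

end main

/-- The symbol `λ s / (λ² + 2 i s²)`. -/
noncomputable def sqSymbol (s l : ℝ) : ℂ := l * s / (l ^ 2 + 2 * I * s ^ 2)

/-- The kernel with symbol `sqSymbol`. -/
noncomputable def sqKernel (s x y : ℝ) : ℂ :=
  1 / 2 * (resKernel (1 - I) 1 s x y + (1 - 2 * I) * resKernel (1 + 3 * I) (1 - 2 * I) s x y)

/-- The constant of the family `sqKernel`. -/
noncomputable def sqConst : ℝ := ‖(1 / 2 : ℂ)‖ * (72 + ‖(1 - 2 * I : ℂ)‖ * 72)

lemma one_le_sqConst : 1 ≤ sqConst := by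
  unfold sqConst
  have := norm_nonneg (1 - 2 * I : ℂ)
  have e : ‖(1 / 2 : ℂ)‖ = 1 / 2 := by simp
  rw [e]; linarith

lemma sqSymbol_den_ne_zero {s l : ℝ} (hl : 0 < l) : (l ^ 2 + 2 * I * s ^ 2 : ℂ) ≠ 0 := by
  intro h
  have := congrArg Complex.re h
  norm_num [← Complex.ofReal_pow] at this
  exact hl.ne' this

lemma hKernel_sqKernel : HKernel sqKernel sqConst := by
  have h1 : HKernel (resKernel (1 - I) 1) 72 := resKernel_hKernel (by simp) (by simp) (by simp)
  have h2 : HKernel (resKernel (1 + 3 * I) (1 - 2 * I)) 72 :=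
    resKernel_hKernel (by simp) (by simp) (by simp)
  exact (h1.add (h2.const_mul (1 - 2 * I))).const_mul (1 / 2)

lemma norm_sqSymbol_le_left {s l : ℝ} (hs : 0 < s) (hl : 0 < l) : ‖sqSymbol s l‖ ≤ s / l := by
  unfold sqSymbol
  rw [norm_div, norm_mul, Complex.norm_real, Complex.norm_real, Real.norm_of_nonneg hl.le,
    Real.norm_of_nonneg hs.le]
  have : l ^ 2 ≤ ‖(l ^ 2 + 2 * I * s ^ 2 : ℂ)‖ := by
    refine le_trans ?_ (Complex.re_le_norm _)
    norm_num [← Complex.ofReal_pow]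
  calc l * s / ‖(l ^ 2 + 2 * I * s ^ 2 : ℂ)‖ ≤ l * s / l ^ 2 := by gcongr
    _ = s / l := by field_simp

lemma norm_sqSymbol_le_right {s l : ℝ} (hs : 0 < s) (hl : 0 < l) : ‖sqSymbol s l‖ ≤ l / s := by
  unfold sqSymbol
  rw [norm_div, norm_mul, Complex.norm_real, Complex.norm_real, Real.norm_of_nonneg hl.le,
    Real.norm_of_nonneg hs.le]
  have : s ^ 2 ≤ ‖(l ^ 2 + 2 * I * s ^ 2 : ℂ)‖ := by
    refine le_trans ?_ ((le_abs_self _).trans (Complex.abs_im_le_norm _))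
    norm_num [← Complex.ofReal_pow]
    nlinarith [sq_nonneg s]
  calc l * s / ‖(l ^ 2 + 2 * I * s ^ 2 : ℂ)‖ ≤ l * s / s ^ 2 := by gcongr
    _ = l / s := by field_simp

lemma partial_fraction {s a b c h l : ℂ} (ha : a ≠ 0) (hb : b ≠ 0) (hc : c ≠ 0)
    (hl : 2 * l = a + b) :
    1 / 2 * (s / a * h + c * (s / (c * b) * h)) = l * s / (a * b) * h := by
  rw [show l = (a + b) / 2 by rw [← hl]; ring]
  field_simp
  ring

lemma hFamily_sqKernel : HFamily sqKernel sqSymbol sqConst where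
  ker := hKernel_sqKernel
  act s hs x k := by
    have e1 := integral_resKernel (σ := 1 - I) (ω := 1) (by simp) (by simp) hs x k
    have e2 := integral_resKernel (σ := 1 + 3 * I) (ω := 1 - 2 * I) (by simp) (by simp) hs x k
    have h1 : HKernel (resKernel (1 - I) 1) 72 := resKernel_hKernel (by simp) (by simp) (by simp)
    have h2 : HKernel (resKernel (1 + 3 * I) (1 - 2 * I)) 72 :=
      resKernel_hKernel (by simp) (by simp) (by simp)
    have i1 := h1.integrable_smul hs ((integrable_hermiteFun k).ofReal (𝕜 := ℂ)) x
    have i2 := h2.integrable_smul hs ((integrable_hermiteFun k).ofReal (𝕜 := ℂ)) x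
    unfold sqKernel
    simp_rw [mul_assoc (1 / 2 : ℂ), add_mul, mul_assoc (1 - 2 * I)]
    rw [integral_const_mul, integral_add (by exact i1) (by exact i2.const_mul _), integral_const_mul]
    rw [e1, e2]
    have hl : (0 : ℝ) < 2 * k + 1 := by positivity
    have hd := sqSymbol_den_ne_zero (s := s) hl
    unfold sqSymbol
    push_cast at hd ⊢
    have hf : ((2 * k + 1 : ℂ) ^ 2 + 2 * I * s ^ 2) =
        ((1 - I) * s + 1 * (2 * k + 1)) * ((2 * k + 1) - (1 - I) * s) := by
      linear_combination ((s : ℂ) ^ 2) * I_sq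
    have hg : ((1 + 3 * I) * s + (1 - 2 * I) * (2 * k + 1) : ℂ) =
        (1 - 2 * I) * ((2 * k + 1) - (1 - I) * s) := by
      linear_combination (2 * (s : ℂ)) * I_sq
    have hc : (1 - 2 * I : ℂ) ≠ 0 := by
      intro h; have := congrArg Complex.re h; simp at this
    rw [hg, hf]
    rw [hf] at hd
    obtain ⟨d1, d2⟩ := mul_ne_zero_iff.1 hd
    exact partial_fraction d1 d2 hc (by ring)
  dec_zero s l hs hl := (norm_sqSymbol_le_left hs hl).trans
    (le_mul_of_one_le_left (by positivity) one_le_sqConst)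
  dec_top s l hs hl := (norm_sqSymbol_le_right hs hl).trans
    (le_mul_of_one_le_left (by positivity) one_le_sqConst)

lemma EuclideanSpace.enorm_rpow_eq {ι : Type*} [Fintype ι] (w : EuclideanSpace ℂ ι) (p : ℝ) :
    ‖w‖ₑ ^ p = (∑ i, ‖w i‖ₑ ^ 2) ^ (p / 2) := by
  have h : ‖w‖ₑ ^ 2 = ∑ i, ‖w i‖ₑ ^ 2 := by
    simp only [← ofReal_norm, ← ENNReal.ofReal_pow (norm_nonneg _)]
    rw [EuclideanSpace.norm_sq_eq, ENNReal.ofReal_sum_of_nonneg fun i _ => by positivity]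
  rw [← h, ← ENNReal.rpow_natCast, ← ENNReal.rpow_mul]
  congr 1; push_cast; ring

section insertion
variable {ι : Type*} [Fintype ι] (J : Finset ℤ)

/-- The `j`-th insertion. -/
noncomputable def insertJ (j : ℤ) : EuclideanSpace ℂ ι →L[ℂ] EuclideanSpace ℂ (ι × J) :=
  LinearMap.mkContinuous
    { toFun := fun w => WithLp.toLp 2 fun q => if (q.2 : ℤ) = j then w q.1 else 0
      map_add' := fun w w' => by ext q; by_cases h : (q.2 : ℤ) = j <;> simp [h]
      map_smul' := fun c w => by ext q; by_cases h : (q.2 : ℤ) = j <;> simp [h] } 1 (by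
    intro w
    rw [one_mul, ← sq_le_sq₀ (norm_nonneg _) (norm_nonneg _), EuclideanSpace.norm_sq_eq,
      EuclideanSpace.norm_sq_eq, Fintype.sum_prod_type]
    refine Finset.sum_le_sum fun i _ => ?_
    by_cases hj : j ∈ J
    · rw [Finset.sum_eq_single ⟨j, hj⟩]
      · simp
      · intro b _ hb
        have : (b : ℤ) ≠ j := fun h => hb (Subtype.ext h)
        simp [this]
      · simp
    · rw [Finset.sum_eq_zero]
      · positivity
      · intro b _
        have : (b : ℤ) ≠ j := fun h => hj (h ▸ b.2)
        simp [this])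

lemma insertJ_apply (j : ℤ) (w : EuclideanSpace ℂ ι) (q : ι × J) :
    insertJ J j w q = if (q.2 : ℤ) = j then w q.1 else 0 := rfl

lemma norm_insertJ_le (j : ℤ) : ‖insertJ (ι := ι) J j‖ ≤ 1 :=
  LinearMap.mkContinuous_norm_le _ zero_le_one _

/-- The `j`-th projection. -/
noncomputable def projJ (j : ℤ) : EuclideanSpace ℂ (ι × J) →L[ℂ] EuclideanSpace ℂ ι :=
  LinearMap.mkContinuous
    { toFun := fun w => WithLp.toLp 2 fun i => if h : j ∈ J then w (i, ⟨j, h⟩) else 0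
      map_add' := fun w w' => by ext q; by_cases h : j ∈ J <;> simp [h]
      map_smul' := fun c w => by ext q; by_cases h : j ∈ J <;> simp [h] } 1 (by
    intro w
    rw [one_mul, ← sq_le_sq₀ (norm_nonneg _) (norm_nonneg _), EuclideanSpace.norm_sq_eq,
      EuclideanSpace.norm_sq_eq, Fintype.sum_prod_type]
    refine Finset.sum_le_sum fun i _ => ?_
    by_cases hj : j ∈ J
    · simpa [hj] using Finset.single_le_sum (f := fun b : J => ‖w (i, b)‖ ^ 2)
        (fun b _ => by positivity) (Finset.mem_univ ⟨j, hj⟩)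
    · simpa [hj] using Finset.sum_nonneg fun (b : J) _ => sq_nonneg ‖w (i, b)‖)

lemma projJ_apply (j : J) (w : EuclideanSpace ℂ (ι × J)) (i : ι) :
    projJ J j w i = w (i, j) := by
  change (if h : (j : ℤ) ∈ J then w (i, ⟨j, h⟩) else 0) = _
  simp

lemma norm_projJ_le (j : ℤ) : ‖projJ (ι := ι) J j‖ ≤ 1 :=
  LinearMap.mkContinuous_norm_le _ zero_le_one _

lemma hexp_apply {ι : Type*} [Fintype ι] (N : ℕ) (a : ℕ → EuclideanSpace ℂ ι) (x : ℝ) (i : ι) :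
    hexp N a x i = ∑ k ∈ Finset.range N, (hermiteFun k x : ℂ) * a k i := by
  unfold hexp
  rw [WithLp.ofLp_sum, Finset.sum_apply]
  rfl

/-- Square function estimate for the analysis operator. -/
lemma analysis_le (v : ℝ) {p : ℝ} (hp : 1 < p) (N : ℕ) (a : ι → ℕ → ℂ) :
    ∫⁻ x, (∑ q : ι × J, ‖∑ k ∈ Finset.range N, (hermiteFun k x : ℂ) *
        (sqSymbol (Real.exp (v + (q.2 : ℤ))) (2 * k + 1) * a q.1 k)‖ₑ ^ 2) ^ (p / 2) ≤
      lpConst p sqConst *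
        ∫⁻ x, (∑ i, ‖∑ k ∈ Finset.range N, (hermiteFun k x : ℂ) * a i k‖ₑ ^ 2) ^ (p / 2) := by
  have h := hFamily_sqKernel.lintegral_rpow_le J v (norm_insertJ_le (ι := ι) J) hp N
    (fun k => WithLp.toLp 2 fun i => a i k)
  simp only [EuclideanSpace.enorm_rpow_eq, hexp_apply] at h
  refine le_trans (le_of_eq ?_) h
  refine lintegral_congr fun x => ?_
  congr 1
  refine Finset.sum_congr rfl fun q _ => ?_
  congr 2
  refine Finset.sum_congr rfl fun k _ => ?_
  congr 1
  rw [WithLp.ofLp_sum, Finset.sum_apply, Finset.sum_eq_single (q.2 : ℤ)]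
  · rw [PiLp.smul_apply, insertJ_apply]; simp
  · intro j _ hj
    rw [PiLp.smul_apply, insertJ_apply, if_neg (Ne.symm hj), smul_zero]
  · intro hq; exact absurd q.2.2 hq

/-- Square function estimate for the synthesis operator. -/
lemma synthesis_le (v : ℝ) {p : ℝ} (hp : 1 < p) (N : ℕ) (a : ι × J → ℕ → ℂ) :
    ∫⁻ x, (∑ i, ‖∑ k ∈ Finset.range N, (hermiteFun k x : ℂ) *
        ∑ j : J, (starRingEnd ℂ) (sqSymbol (Real.exp (v + (j : ℤ))) (2 * k + 1)) * a (i, j) k‖ₑ ^ 2)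
          ^ (p / 2) ≤
      lpConst p sqConst *
        ∫⁻ x, (∑ q, ‖∑ k ∈ Finset.range N, (hermiteFun k x : ℂ) * a q k‖ₑ ^ 2) ^ (p / 2) := by
  have h := hFamily_sqKernel.star.lintegral_rpow_le J v (norm_projJ_le (ι := ι) J) hp N
    (fun k => WithLp.toLp 2 fun i => a i k)
  simp only [EuclideanSpace.enorm_rpow_eq, hexp_apply] at h
  refine le_trans (le_of_eq ?_) h
  refine lintegral_congr fun x => ?_
  congr 1
  refine Finset.sum_congr rfl fun i _ => ?_
  congr 2
  refine Finset.sum_congr rfl fun k _ => ?_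
  congr 1
  rw [WithLp.ofLp_sum, Finset.sum_apply]
  refine Eq.trans ?_ (Finset.sum_coe_sort J _)
  refine Finset.sum_congr rfl fun j _ => ?_
  rw [PiLp.smul_apply, projJ_apply, smul_eq_mul]

end insertion

section poisson

lemma inv_cosh_le (x : ℝ) : (Real.cosh (2 * x))⁻¹ ≤ (1 + x ^ 2)⁻¹ := by
  have h : 1 + x ^ 2 ≤ Real.cosh (2 * x) := by
    rw [Real.cosh_two_mul, Real.cosh_sq]
    have : x ^ 2 ≤ Real.sinh x ^ 2 := by
      rw [sq_le_sq]
      rcases le_total 0 x with h | h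
      · rw [abs_of_nonneg h]; exact (Real.self_le_sinh_iff.2 h).trans (le_abs_self _)
      · rw [abs_of_nonpos h]
        refine le_trans ?_ (neg_le_abs _)
        have := Real.sinh_le_self_iff.2 h
        linarith
    nlinarith [sq_nonneg (Real.sinh x)]
  gcongr

lemma integrable_inv_cosh : Integrable fun x : ℝ => (Real.cosh (2 * x))⁻¹ := by
  refine integrable_inv_one_add_sq.mono' ?_ (Filter.Eventually.of_forall fun x => ?_)
  · exact (Continuous.inv₀ (by fun_prop) fun x => (Real.cosh_pos _).ne').aestronglyMeasurable
  · rw [Real.norm_of_nonneg (inv_nonneg.2 (Real.cosh_pos _).le)]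
    exact inv_cosh_le x

/-- The total mass of `1 / cosh (2x)`. -/
noncomputable def coshMass : ℝ := ∫ x : ℝ, (Real.cosh (2 * x))⁻¹

lemma integrable_inv_cosh_complex :
    Integrable fun x : ℝ => (((Real.cosh (2 * x))⁻¹ : ℝ) : ℂ) := integrable_inv_cosh.ofReal

lemma coshMass_pos : 0 < coshMass := by
  unfold coshMass
  rw [integral_pos_iff_support_of_nonneg (fun x => inv_nonneg.2 (Real.cosh_pos _).le)
    integrable_inv_cosh]
  have : (Function.support fun x : ℝ => (Real.cosh (2 * x))⁻¹) = Set.univ := by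
    ext x; simp [(Real.cosh_pos (2 * x)).ne']
  rw [this]; simp

lemma sinh_two_mul_ne_zero {w : ℂ} (hw : w ≠ 0) (hi : |w.im| ≤ Real.pi / 4) :
    Complex.sinh (2 * w) ≠ 0 := by
  intro h
  have h1 : Complex.exp (4 * w) = 1 := by
    have h2 : Complex.exp (2 * w) = Complex.exp (-(2 * w)) := by
      unfold Complex.sinh at h
      have := (div_eq_zero_iff.1 h).resolve_right two_ne_zero
      exact sub_eq_zero.1 this
    calc Complex.exp (4 * w) = Complex.exp (2 * w) * Complex.exp (2 * w) := by
          rw [← Complex.exp_add]; congr 1; ring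
      _ = Complex.exp (2 * w) * Complex.exp (-(2 * w)) := by rw [← h2]
      _ = 1 := by rw [← Complex.exp_add, add_neg_cancel, Complex.exp_zero]
  obtain ⟨n, hn⟩ := Complex.exp_eq_one_iff.1 h1
  have hre := congrArg Complex.re hn
  have him := congrArg Complex.im hn
  norm_num at hre him
  have hn0 : n = 0 := by
    by_contra hne
    have h1 : (1 : ℝ) ≤ |(n : ℝ)| := by exact_mod_cast Int.one_le_abs hne
    have h2 : |w.im| = |(n : ℝ)| * (Real.pi / 2) := by
      have : w.im = n * (Real.pi / 2) := by linarith
      rw [this, abs_mul, abs_of_pos (by positivity : (0 : ℝ) < Real.pi / 2)]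
    nlinarith [Real.pi_pos]
  apply hw
  apply Complex.ext
  · simpa using hre
  · rw [hn0] at him; simpa using him

lemma sinh_le_norm_sinh (z : ℂ) : Real.sinh |z.re| ≤ ‖Complex.sinh z‖ := by
  have h1 : |Real.exp z.re - Real.exp (-z.re)| / 2 ≤ ‖Complex.sinh z‖ := by
    unfold Complex.sinh
    rw [norm_div, Complex.norm_two]
    gcongr
    have := abs_norm_sub_norm_le (Complex.exp z) (Complex.exp (-z))
    rwa [Complex.norm_exp, Complex.norm_exp, Complex.neg_re] at this
  refine le_trans ?_ h1
  rw [Real.sinh_eq]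
  gcongr
  rcases le_total 0 z.re with h | h
  · rw [abs_of_nonneg h]; exact le_abs_self _
  · rw [abs_of_nonpos h, neg_neg]
    refine le_trans (le_of_eq ?_) (neg_le_abs _); ring

/-- Poisson formula at the centre of a strip. -/
lemma poisson_strip {G : ℂ → ℂ} {M : ℝ}
    (hG : ∀ w : ℂ, |w.im| ≤ Real.pi / 4 → DifferentiableAt ℂ G w)
    (hM : ∀ w : ℂ, |w.im| ≤ Real.pi / 4 → ‖G w‖ ≤ M) :
    Integrable (fun x : ℝ => (G (x + (Real.pi / 4 : ℝ) * I) + G (x + (-(Real.pi / 4) : ℝ) * I)) *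
      ((Real.cosh (2 * x))⁻¹ : ℝ)) ∧
    ∫ x : ℝ, (G (x + (Real.pi / 4 : ℝ) * I) + G (x + (-(Real.pi / 4) : ℝ) * I)) *
      ((Real.cosh (2 * x))⁻¹ : ℝ) = 2 * coshMass * G 0 := by
  have hpi := Real.pi_pos
  have hM0 : 0 ≤ M := (norm_nonneg _).trans (hM 0 (by simp; positivity))
  have hcont : ∀ c : ℝ, |c| ≤ Real.pi / 4 → Continuous fun x : ℝ => G (x + c * I) := by
    intro c hc
    rw [continuous_iff_continuousAt]
    intro x
    have h1 : ContinuousAt G ((x : ℂ) + c * I) := (hG _ (by simpa using hc)).continuousAt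
    exact ContinuousAt.comp (f := fun x : ℝ => (x : ℂ) + c * I) h1 (by fun_prop)
  have hab : |Real.pi / 4| ≤ Real.pi / 4 := (abs_of_pos (by positivity)).le
  have hab' : |-(Real.pi / 4)| ≤ Real.pi / 4 := by rw [abs_neg]; exact hab
  have hInt : Integrable (fun x : ℝ =>
      (G (x + (Real.pi / 4 : ℝ) * I) + G (x + (-(Real.pi / 4) : ℝ) * I)) *
      ((Real.cosh (2 * x))⁻¹ : ℝ)) := by
    refine integrable_inv_cosh_complex.bdd_mul (c := M + M)
      ((hcont _ hab).add (hcont _ hab')).aestronglyMeasurable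
      (Filter.Eventually.of_forall fun x => ?_)
    exact (norm_add_le _ _).trans (add_le_add (hM _ (by simpa using hab)) (hM _ (by simpa using hab')))
  refine ⟨hInt, ?_⟩
  set S : ℂ → ℂ := fun w => Complex.sinh (2 * w) with hS
  have hSd : Differentiable ℂ S := by
    intro w; rw [hS]; exact (by fun_prop : DifferentiableAt ℂ (fun w => Complex.sinh (2 * w)) w)
  have hS0 : S 0 = 0 := by simp [hS]
  have hS' : deriv S 0 = 2 := by
    have h1 : HasDerivAt S (Complex.cosh (2 * 0) * 2) 0 := by
      have h2 : HasDerivAt (fun w : ℂ => 2 * w) 2 0 := by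
        simpa using (hasDerivAt_id (0 : ℂ)).const_mul 2
      exact h2.csinh
    simpa using h1.deriv
  have hdS : ∀ w : ℂ, |w.im| ≤ Real.pi / 4 → dslope S 0 w ≠ 0 := by
    intro w hw
    rcases eq_or_ne w 0 with rfl | h0
    · rw [dslope_same, hS']; norm_num
    · rw [dslope_of_ne _ h0, slope_def_field, hS0, sub_zero, sub_zero]
      exact div_ne_zero (sinh_two_mul_ne_zero h0 hw) h0
  set f : ℂ → ℂ := fun w => dslope G 0 w / dslope S 0 w with hf
  have hfv : ∀ w : ℂ, w ≠ 0 → f w = (G w - G 0) / S w := by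
    intro w h0
    rw [hf]
    simp only
    rw [dslope_of_ne _ h0, dslope_of_ne _ h0, slope_def_field, slope_def_field, hS0, sub_zero,
      sub_zero, div_div_div_cancel_right₀ h0]
  have hcd : ∀ {g : ℂ → ℂ} {w : ℂ}, DifferentiableAt ℂ g 0 → DifferentiableAt ℂ g w →
      ContinuousAt (dslope g 0) w := by
    intro g w h0 hw
    rcases eq_or_ne w 0 with rfl | hne
    · exact continuousAt_dslope_same.2 h0
    · exact (continuousAt_dslope_of_ne hne).2 hw.continuousAt
  have hG0 : DifferentiableAt ℂ G 0 := hG 0 (by simp; positivity)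
  have hfc : ∀ w : ℂ, |w.im| ≤ Real.pi / 4 → ContinuousAt f w := fun w hw =>
    (hcd hG0 (hG w hw)).div (hcd (hSd 0) (hSd w)) (hdS w hw)
  have hfd : ∀ w : ℂ, |w.im| ≤ Real.pi / 4 → w ≠ 0 → DifferentiableAt ℂ f w := fun w hw h0 =>
    ((differentiableAt_dslope_of_ne h0).2 (hG w hw)).div
      ((differentiableAt_dslope_of_ne h0).2 (hSd w)) (hdS w hw)
  have hrect : ∀ R : ℝ, 0 < R →
      ((∫ x : ℝ in -R..R, f (x + (-(Real.pi / 4) : ℝ) * I)) - ∫ x : ℝ in -R..R, f (x + (Real.pi / 4 : ℝ) * I)) =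
        I * (∫ y : ℝ in -(Real.pi / 4)..(Real.pi / 4), f ((-R : ℝ) + y * I)) -
        I * ∫ y : ℝ in -(Real.pi / 4)..(Real.pi / 4), f ((R : ℝ) + y * I) := by
    intro R hR
    have himabs : ∀ y ∈ Set.uIcc (-(Real.pi / 4)) (Real.pi / 4), |y| ≤ Real.pi / 4 := by
      intro y hy
      rw [Set.uIcc_of_le (by linarith)] at hy
      exact abs_le.2 hy
    have := Complex.integral_boundary_rect_eq_zero_of_differentiable_on_off_countable f
      ⟨-R, -(Real.pi / 4)⟩ ⟨R, Real.pi / 4⟩ {0} (Set.countable_singleton _)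
      (fun w hw => (hfc w (himabs _ hw.2)).continuousWithinAt)
      (fun w hw => hfd w (by
        have := hw.1.2
        simp only [min_eq_left (by linarith : -(Real.pi / 4) ≤ Real.pi / 4),
          max_eq_right (by linarith : -(Real.pi / 4) ≤ Real.pi / 4)] at this
        exact (abs_lt.2 this).le) hw.2)
    simp only [smul_eq_mul] at this
    linear_combination this
  have hvert : ∀ (R y : ℝ), R ≠ 0 → |y| ≤ Real.pi / 4 →
      ‖f ((R : ℝ) + y * I)‖ ≤ 2 * M / Real.sinh (2 * |R|) := by
    intro R y hR hy
    have h0 : ((R : ℂ) + y * I) ≠ 0 := by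
      intro h; apply hR; simpa using congrArg Complex.re h
    rw [hfv _ h0, norm_div]
    have hs : 0 < Real.sinh (2 * |R|) := Real.sinh_pos_iff.2 (by positivity)
    have h1 := sinh_le_norm_sinh (2 * ((R : ℂ) + y * I))
    have e : (2 * ((R : ℂ) + y * I)).re = 2 * R := by simp
    rw [e, abs_mul, abs_two] at h1
    gcongr
    calc _ ≤ ‖G (R + y * I)‖ + ‖G 0‖ := norm_sub_le _ _
      _ ≤ M + M := add_le_add (hM _ (by simpa using hy)) (hM _ (by simp; positivity))
      _ = 2 * M := by ring
  have hedge : ∀ (R : ℝ), R ≠ 0 → ‖∫ y : ℝ in -(Real.pi / 4)..(Real.pi / 4), f ((R : ℝ) + y * I)‖ ≤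
      2 * M / Real.sinh (2 * |R|) * (Real.pi / 2) := by
    intro R hR
    have := intervalIntegral.norm_integral_le_of_norm_le_const
      (f := fun y : ℝ => f ((R : ℝ) + y * I)) (a := -(Real.pi / 4)) (b := Real.pi / 4)
      (C := 2 * M / Real.sinh (2 * |R|)) (fun y hy => hvert R y hR (by
        rw [Set.uIoc_of_le (by linarith)] at hy
        exact abs_le.2 ⟨hy.1.le, hy.2⟩))
    refine this.trans (le_of_eq ?_)
    rw [show Real.pi / 4 - -(Real.pi / 4) = Real.pi / 2 by ring,
      abs_of_pos (show (0 : ℝ) < Real.pi / 2 by positivity)]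
  have hexpsh : ∀ x : ℝ, S (x + (Real.pi / 4 : ℝ) * I) = I * Real.cosh (2 * x) := by
    intro x
    rw [hS]
    simp only
    rw [show (2 * ((x : ℂ) + (Real.pi / 4 : ℝ) * I)) = 2 * x + Real.pi / 2 * I by push_cast; ring,
      Complex.sinh_add, Complex.cosh_mul_I, Complex.sinh_mul_I, Complex.cos_pi_div_two,
      Complex.sin_pi_div_two]
    push_cast; ring
  have hexpsh' : ∀ x : ℝ, S (x + (-(Real.pi / 4) : ℝ) * I) = -I * Real.cosh (2 * x) := by
    intro x
    rw [hS]
    simp only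
    rw [show (2 * ((x : ℂ) + (-(Real.pi / 4) : ℝ) * I)) = 2 * x + (-(Real.pi / 2)) * I by push_cast; ring,
      Complex.sinh_add, Complex.cosh_mul_I, Complex.sinh_mul_I, Complex.cos_neg, Complex.sin_neg,
      Complex.cos_pi_div_two, Complex.sin_pi_div_two]
    push_cast; ring
  set F : ℝ → ℂ := fun x => (G (x + (Real.pi / 4 : ℝ) * I) + G (x + (-(Real.pi / 4) : ℝ) * I)) *
      ((Real.cosh (2 * x))⁻¹ : ℝ) - 2 * G 0 * ((Real.cosh (2 * x))⁻¹ : ℝ) with hF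
  have hFi : Integrable F := hInt.sub (integrable_inv_cosh_complex.const_mul _)
  have hne : ∀ (x c : ℝ), 0 < |c| → ((x : ℂ) + c * I) ≠ 0 := by
    intro x c hc h
    have := congrArg Complex.im h
    simp at this
    simp [this] at hc
  have hFf : ∀ x : ℝ, f (x + (-(Real.pi / 4) : ℝ) * I) - f (x + (Real.pi / 4 : ℝ) * I) = I * F x := by
    intro x
    have hch : (Real.cosh (2 * x) : ℂ) ≠ 0 := Complex.ofReal_ne_zero.2 (Real.cosh_pos _).ne'
    rw [hfv _ (hne _ _ (by rw [abs_neg, abs_of_pos (by positivity)]; positivity)),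
      hfv _ (hne _ _ (by rw [abs_of_pos (by positivity)]; positivity)), hexpsh, hexpsh', hF]
    simp only [Complex.ofReal_inv]
    have hI := I_ne_zero
    field_simp
    rw [I_sq]; ring
  have hlim1 : Filter.Tendsto (fun R : ℝ => ∫ x in -R..R, F x) Filter.atTop (nhds (∫ x, F x)) :=
    intervalIntegral_tendsto_integral hFi Filter.tendsto_neg_atTop_atBot Filter.tendsto_id
  have hlim2 : Filter.Tendsto (fun R : ℝ => ∫ x in -R..R, F x) Filter.atTop (nhds 0) := by
    have hsinh : Filter.Tendsto (fun R : ℝ => 2 * (2 * M / Real.sinh (2 * |R|) * (Real.pi / 2)))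
        Filter.atTop (nhds 0) := by
      have h1 : Filter.Tendsto (fun R : ℝ => Real.sinh (2 * |R|)) Filter.atTop Filter.atTop := by
        refine Filter.tendsto_atTop_mono (fun R => Real.self_le_sinh_iff.2 (by positivity)) ?_
        exact Filter.tendsto_abs_atTop_atTop.const_mul_atTop two_pos
      have h2 := ((h1.const_div_atTop (2 * M)).mul_const (Real.pi / 2)).const_mul 2
      simpa using h2
    refine squeeze_zero_norm' ?_ hsinh
    filter_upwards [Filter.eventually_gt_atTop 0] with R hR
    have hcf : ∀ c : ℝ, |c| ≤ Real.pi / 4 → Continuous fun x : ℝ => f (x + c * I) := by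
      intro c hc
      rw [continuous_iff_continuousAt]
      intro x
      exact ContinuousAt.comp (f := fun x : ℝ => (x : ℂ) + c * I) (hfc _ (by simpa using hc))
        (by fun_prop)
    have e : ∫ x in -R..R, F x = -I * (I * (∫ y : ℝ in -(Real.pi / 4)..(Real.pi / 4), f ((-R : ℝ) + y * I)) -
        I * ∫ y : ℝ in -(Real.pi / 4)..(Real.pi / 4), f ((R : ℝ) + y * I)) := by
      rw [← hrect R hR, ← intervalIntegral.integral_sub ((hcf _ hab').intervalIntegrable _ _)
        ((hcf _ hab).intervalIntegrable _ _)]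
      simp_rw [hFf]
      rw [intervalIntegral.integral_const_mul, ← mul_assoc, neg_mul, I_mul_I, neg_neg, one_mul]
    rw [e, norm_mul, norm_neg, norm_I, one_mul, ← mul_sub, norm_mul, norm_I, one_mul, two_mul]
    refine (norm_sub_le _ _).trans (add_le_add ?_ (hedge R hR.ne'))
    have := hedge (-R) (by linarith)
    rwa [abs_neg] at this
  have hz := tendsto_nhds_unique hlim1 hlim2
  simp only [hF] at hz
  rw [integral_sub hInt (integrable_inv_cosh_complex.const_mul _), integral_const_mul,
    sub_eq_zero] at hz
  have hcm : ∫ x : ℝ, (((Real.cosh (2 * x))⁻¹ : ℝ) : ℂ) = (coshMass : ℂ) := by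
    unfold coshMass; exact integral_complex_ofReal
  rw [hz]
  rw [hcm]
  ring

end poisson

/-- The integers from `-n` to `n - 1`. -/
def dyadRange (n : ℕ) : Finset ℤ := (Finset.range (2 * n)).image fun k : ℕ => (k : ℤ) - n

lemma integral_sum_dyadRange {f : ℝ → ℂ} (hf : Integrable f) (n : ℕ) :
    ∫ v in (0 : ℝ)..1, ∑ j ∈ dyadRange n, f (v + (j : ℤ)) = ∫ v in (-n : ℝ)..n, f v := by
  have hi : ∀ a b : ℝ, IntervalIntegrable f volume a b := fun a b => hf.intervalIntegrable
  unfold dyadRange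
  simp_rw [Finset.sum_image (fun a _ b _ h => by simpa using h : Set.InjOn (fun k : ℕ => (k : ℤ) - n)
    (Finset.range (2 * n)))]
  rw [intervalIntegral.integral_finsetSum]
  · have e : ∀ k ∈ Finset.range (2 * n), ∫ v in (0 : ℝ)..1, f (v + (((k : ℤ) - n : ℤ) : ℝ)) =
        ∫ v in ((k : ℝ) - n)..(((k + 1 : ℕ) : ℝ) - n), f v := by
      intro k _
      rw [intervalIntegral.integral_comp_add_right]
      push_cast
      congr 1 <;> ring
    rw [Finset.sum_congr rfl e, intervalIntegral.sum_integral_adjacent_intervals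
      (a := fun k : ℕ => (k : ℝ) - n) fun k _ => hi _ _]
    congr 1 <;> push_cast <;> ring
  · intro k _
    exact (hf.comp_add_right _).intervalIntegrable

lemma arg_mul_exp {l : ℝ} (hl : 0 < l) {w : ℂ} (hw : |w.im| ≤ Real.pi / 4) :
    Complex.arg (l * Complex.exp w) = w.im := by
  have hpi := Real.pi_pos
  have := abs_le.1 hw
  rw [Complex.arg_real_mul _ hl, Complex.arg_exp, toIocMod_eq_self]
  constructor <;> linarith

lemma sqSymbol_mul_conj {l : ℝ} (hl : 0 < l) (x : ℝ) :
    sqSymbol (l * Real.exp x / Real.sqrt 2) l * (starRingEnd ℂ) (sqSymbol (l * Real.exp x / Real.sqrt 2) l) =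
      (((Real.cosh (2 * x))⁻¹ : ℝ) : ℂ) / 4 := by
  set s := l * Real.exp x / Real.sqrt 2 with hs
  have hs2 : s ^ 2 = l ^ 2 * Real.exp x ^ 2 / 2 := by
    rw [hs, div_pow, Real.sq_sqrt (by norm_num), mul_pow]
  have hreal : sqSymbol s l * (starRingEnd ℂ) (sqSymbol s l) =
      ((l ^ 2 * s ^ 2 / (l ^ 4 + 4 * s ^ 4) : ℝ) : ℂ) := by
    unfold sqSymbol
    rw [map_div₀, map_mul, Complex.conj_ofReal, Complex.conj_ofReal, map_add, map_mul, map_mul, map_pow,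
      map_pow, Complex.conj_ofReal, Complex.conj_ofReal, conj_I, div_mul_div_comm, map_ofNat]
    push_cast
    congr 1
    · ring
    · linear_combination (-4 * (s : ℂ) ^ 4) * I_sq
  have he := Real.exp_pos x
  have hc : Real.cosh (2 * x) = (Real.exp x ^ 4 + 1) / (2 * Real.exp x ^ 2) := by
    rw [Real.cosh_eq, show -(2 * x) = -x + -x by ring, show 2 * x = x + x by ring, Real.exp_add,
      Real.exp_add, Real.exp_neg]
    field_simp
  rw [hreal, hc]
  have : l ^ 2 * s ^ 2 / (l ^ 4 + 4 * s ^ 4) = ((Real.exp x ^ 4 + 1) / (2 * Real.exp x ^ 2))⁻¹ / 4 := by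
    rw [show s ^ 4 = (s ^ 2) ^ 2 by ring, hs2]
    field_simp
    ring
  rw [this]
  push_cast
  ring

/-- The reproducing formula obtained from the Poisson formula. -/
lemma sector_formula {ψ : ℝ} (hψ : Real.pi / 4 < ψ) {g : ℂ → ℂ} {M : ℝ}
    (hg : ∀ z : ℂ, |Complex.arg z| < ψ → DifferentiableAt ℂ g z)
    (hM : ∀ z : ℂ, |Complex.arg z| < ψ → ‖g z‖ ≤ M) {l : ℝ} (hl : 0 < l) :
    Filter.Tendsto (fun n : ℕ => ∫ v in (0 : ℝ)..1, ∑ j ∈ dyadRange n,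
      (2 / coshMass : ℂ) * (g ((1 + I) * Real.exp (v + (j : ℤ))) + g ((1 - I) * Real.exp (v + (j : ℤ)))) *
        (sqSymbol (Real.exp (v + (j : ℤ))) l * (starRingEnd ℂ) (sqSymbol (Real.exp (v + (j : ℤ))) l)))
      Filter.atTop (nhds (g l)) := by
  have harg : ∀ w : ℂ, |w.im| ≤ Real.pi / 4 → |Complex.arg (l * Complex.exp w)| < ψ := fun w hw => by
    rw [arg_mul_exp hl hw]; linarith
  obtain ⟨hInt, hval⟩ := poisson_strip (G := fun w => g (l * Complex.exp w)) (M := M)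
    (fun w hw => DifferentiableAt.comp w (hg _ (harg w hw)) (by fun_prop))
    (fun w hw => hM _ (harg w hw))
  set Ψ : ℝ → ℂ := fun v => (2 / coshMass : ℂ) *
    (g ((1 + I) * Real.exp v) + g ((1 - I) * Real.exp v)) *
      (sqSymbol (Real.exp v) l * (starRingEnd ℂ) (sqSymbol (Real.exp v) l)) with hΨ
  set c : ℝ := Real.log (l / Real.sqrt 2) with hc
  have h2 : (0 : ℝ) < Real.sqrt 2 := by positivity
  have hexp : ∀ x : ℝ, Real.exp (x + c) = l * Real.exp x / Real.sqrt 2 := by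
    intro x
    rw [Real.exp_add, hc, Real.exp_log (by positivity)]; ring
  have hsq : (Real.sqrt 2 : ℂ) ^ 2 = 2 := by
    rw [← Complex.ofReal_pow, Real.sq_sqrt (by norm_num)]; norm_num
  have h2c : (Real.sqrt 2 : ℂ) ≠ 0 := Complex.ofReal_ne_zero.2 h2.ne'
  have hp1 : ∀ x : ℝ, (1 + I) * (Real.exp (x + c) : ℂ) =
      l * Complex.exp (x + (Real.pi / 4 : ℝ) * I) := by
    intro x
    rw [hexp, Complex.exp_add, Complex.exp_mul_I, ← Complex.ofReal_cos, ← Complex.ofReal_sin,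
      Real.cos_pi_div_four, Real.sin_pi_div_four]
    push_cast
    field_simp
    rw [hsq]
  have hp2 : ∀ x : ℝ, (1 - I) * (Real.exp (x + c) : ℂ) =
      l * Complex.exp (x + (-(Real.pi / 4) : ℝ) * I) := by
    intro x
    rw [hexp, Complex.exp_add, Complex.exp_mul_I, ← Complex.ofReal_cos, ← Complex.ofReal_sin,
      Real.cos_neg, Real.sin_neg, Real.cos_pi_div_four, Real.sin_pi_div_four]
    push_cast
    field_simp
    rw [hsq]; ring
  have hΨc : ∀ x, Ψ (x + c) = (1 / (2 * coshMass) : ℂ) *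
      ((g (l * Complex.exp (x + (Real.pi / 4 : ℝ) * I)) +
        g (l * Complex.exp (x + (-(Real.pi / 4) : ℝ) * I))) * ((Real.cosh (2 * x))⁻¹ : ℝ)) := by
    intro x
    rw [hΨ]
    simp only
    rw [hp1, hp2, hexp, sqSymbol_mul_conj hl]
    ring
  have hΨi : Integrable Ψ := by
    have h1 : Integrable fun x => Ψ (x + c) := by
      simp_rw [hΨc]; exact hInt.const_mul _
    simpa using h1.comp_sub_right c
  have hΨv : ∫ v, Ψ v = g l := by
    rw [← integral_add_right_eq_self Ψ c]
    simp_rw [hΨc]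
    rw [integral_const_mul, hval]
    have : (coshMass : ℂ) ≠ 0 := Complex.ofReal_ne_zero.2 coshMass_pos.ne'
    simp only [Complex.exp_zero, mul_one]
    field_simp
  have := intervalIntegral_tendsto_integral hΨi
    (Filter.tendsto_neg_atTop_atBot.comp tendsto_natCast_atTop_atTop)
    (tendsto_natCast_atTop_atTop (R := ℝ))
  rw [hΨv] at this
  refine this.congr fun n => ?_
  exact (integral_sum_dyadRange hΨi n).symm

lemma arg_one_add_I_mul_exp {ψ : ℝ} (hψ : Real.pi / 4 < ψ) (v : ℝ) :
    |Complex.arg ((1 + I) * Real.exp v)| < ψ := by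
  have e : (1 + I) * (Real.exp v : ℂ) = ((Real.exp v : ℝ) : ℂ) * (1 + I) := mul_comm _ _
  have e2 : Complex.arg (1 + I) = Real.pi / 4 := by
    have := Complex.arg_mul_cos_add_sin_mul_I (r := Real.sqrt 2) (by positivity) (θ := Real.pi / 4)
      ⟨by linarith [Real.pi_pos], by linarith [Real.pi_pos]⟩
    rw [← this]
    congr 1
    rw [← Complex.ofReal_cos, ← Complex.ofReal_sin, Real.cos_pi_div_four, Real.sin_pi_div_four]
    have hsq : (Real.sqrt 2 : ℂ) ^ 2 = 2 := by
      rw [← Complex.ofReal_pow, Real.sq_sqrt (by norm_num)]; norm_num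
    push_cast
    linear_combination (-(1 + I) / 2) * hsq
  rw [e, Complex.arg_real_mul _ (Real.exp_pos v), e2, abs_of_pos (by positivity)]
  exact hψ

lemma arg_one_sub_I_mul_exp {ψ : ℝ} (hψ : Real.pi / 4 < ψ) (v : ℝ) :
    |Complex.arg ((1 - I) * Real.exp v)| < ψ := by
  have e : (1 - I) * (Real.exp v : ℂ) = (starRingEnd ℂ) ((1 + I) * Real.exp v) := by
    rw [map_mul, map_add, map_one, conj_I, Complex.conj_ofReal]; ring
  have h := arg_one_add_I_mul_exp hψ v
  rw [e, Complex.arg_conj]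
  split_ifs with h'
  · rwa [h'] at h
  · rwa [abs_neg]

/-- The multi-indices with entries less than `N`. -/
def box (N l : ℕ) : Finset (Fin l → ℕ) := Fintype.piFinset fun _ => Finset.range N

lemma sum_box_succ {E : Type*} [AddCommMonoid E] (N l : ℕ) (F : (Fin (l + 1) → ℕ) → E) :
    ∑ k ∈ box N (l + 1), F k = ∑ k₀ ∈ Finset.range N, ∑ k' ∈ box N l, F (Fin.cons k₀ k') := by
  rw [← Finset.sum_product']
  refine Finset.sum_nbij' (fun k => (k 0, Fin.tail k)) (fun q => Fin.cons q.1 q.2) ?_ ?_ ?_ ?_ ?_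
  · intro k hk
    simp only [box, Fintype.mem_piFinset, Finset.mem_product] at hk ⊢
    exact ⟨hk 0, fun j => hk j.succ⟩
  · intro q hq
    simp only [box, Fintype.mem_piFinset, Finset.mem_product] at hq ⊢
    intro j
    refine Fin.cases ?_ (fun j => ?_) j
    · exact hq.1
    · exact hq.2 j
  · intro k _; simp
  · intro q _; simp
  · intro k _; simp

lemma continuous_hermiteFunNC {l : ℕ} (k : Fin l → ℕ) : Continuous (hermiteFunNC k) := by
  unfold hermiteFunNC
  exact Complex.continuous_ofReal.comp (continuous_finsetProd _ fun j _ =>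
    (continuous_hermiteFun _).comp (continuous_apply j))

lemma hermiteFunNC_cons {l : ℕ} (k₀ : ℕ) (k' : Fin l → ℕ) (x₀ : ℝ) (x' : Fin l → ℝ) :
    hermiteFunNC (Fin.cons k₀ k' : Fin (l + 1) → ℕ) (Fin.cons x₀ x' : Fin (l + 1) → ℝ) =
      hermiteFun k₀ x₀ * hermiteFunNC k' x' := by
  simp [hermiteFunNC, Fin.prod_univ_succ]

lemma lintegral_finCons {l : ℕ} {F : (Fin (l + 1) → ℝ) → ℝ≥0∞} (hF : Measurable F) :
    ∫⁻ x, F x = ∫⁻ x₀ : ℝ, ∫⁻ x' : Fin l → ℝ, F (Fin.cons x₀ x') := by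
  have h := (volume_preserving_piFinSuccAbove (fun _ : Fin (l + 1) => ℝ) 0).symm
  rw [← h.lintegral_comp hF, Measure.volume_eq_prod, lintegral_prod]
  · simp
    rfl
  · exact (hF.comp h.measurable).aemeasurable

section

variable {ι : Type*} [Fintype ι] {l : ℕ} {p : ℝ} {N : ℕ}

/-- The square function of a family of Hermite sums. -/
noncomputable def sqSum (N : ℕ) (a : ι → (Fin l → ℕ) → ℂ) (x : Fin l → ℝ) : ℝ≥0∞ :=
  ∑ i, ‖∑ k ∈ box N l, hermiteFunNC k x * a i k‖ₑ ^ 2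

/-- The `p`-th power of the `L^p` norm of the square function of a family of Hermite sums. -/
noncomputable def sqInt (p : ℝ) (N : ℕ) (a : ι → (Fin l → ℕ) → ℂ) : ℝ≥0∞ :=
  ∫⁻ x : Fin l → ℝ, sqSum N a x ^ (p / 2)

lemma continuous_sqSum (N : ℕ) {X : Type*} [TopologicalSpace X] {a : X → ι → (Fin l → ℕ) → ℂ}
    (ha : ∀ i k, Continuous fun v => a v i k) :
    Continuous fun q : X × (Fin l → ℝ) => sqSum N (a q.1) q.2 := by
  unfold sqSum
  refine continuous_finsetSum _ fun i _ => (ENNReal.continuous_pow 2).comp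
    (Continuous.enorm (continuous_finsetSum _ fun k _ => ?_))
  exact ((continuous_hermiteFunNC k).comp continuous_snd).mul ((ha i k).comp continuous_fst)

lemma measurable_sqSum_rpow (a : ι → (Fin l → ℕ) → ℂ) :
    Measurable fun x => sqSum N a x ^ (p / 2) :=
  ((continuous_sqSum N (X := Unit) (a := fun _ => a) fun _ _ => continuous_const).comp
    (continuous_const (y := ()).prodMk continuous_id)).measurable.pow_const _

lemma sqSum_cons (a : ι → (Fin (l + 1) → ℕ) → ℂ) (x₀ : ℝ) (x' : Fin l → ℝ) :
    sqSum N a (Fin.cons x₀ x') = ∑ i, ‖∑ k₀ ∈ Finset.range N, (hermiteFun k₀ x₀ : ℂ) *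
      ∑ k' ∈ box N l, hermiteFunNC k' x' * a i (Fin.cons k₀ k')‖ₑ ^ 2 := by
  unfold sqSum
  simp_rw [sum_box_succ, hermiteFunNC_cons, Finset.mul_sum, mul_assoc]

lemma sqSum_cons' (a : ι → (Fin (l + 1) → ℕ) → ℂ) (x₀ : ℝ) (x' : Fin l → ℝ) :
    sqSum N a (Fin.cons x₀ x') = sqSum N (fun i k' => ∑ k₀ ∈ Finset.range N,
      (hermiteFun k₀ x₀ : ℂ) * a i (Fin.cons k₀ k')) x' := by
  unfold sqSum
  simp_rw [sum_box_succ, hermiteFunNC_cons, Finset.mul_sum]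
  refine Finset.sum_congr rfl fun i _ => ?_
  rw [Finset.sum_comm]
  congr 2
  refine Finset.sum_congr rfl fun k' _ => Finset.sum_congr rfl fun k₀ _ => by ring

lemma sqInt_succ (a : ι → (Fin (l + 1) → ℕ) → ℂ) :
    sqInt p N a = ∫⁻ x' : Fin l → ℝ, ∫⁻ x₀ : ℝ, (∑ i, ‖∑ k₀ ∈ Finset.range N, (hermiteFun k₀ x₀ : ℂ) *
      ∑ k' ∈ box N l, hermiteFunNC k' x' * a i (Fin.cons k₀ k')‖ₑ ^ 2) ^ (p / 2) := by
  unfold sqInt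
  have hm := measurable_sqSum_rpow (p := p) (N := N) a
  rw [lintegral_finCons hm, lintegral_lintegral_swap]
  · simp_rw [sqSum_cons]
  · refine (hm.comp ?_).aemeasurable
    refine Continuous.measurable ?_
    exact Continuous.finCons (A := fun _ => ℝ) continuous_fst continuous_snd

lemma sqInt_succ' (a : ι → (Fin (l + 1) → ℕ) → ℂ) :
    sqInt p N a = ∫⁻ x₀ : ℝ, sqInt p N (fun i k' => ∑ k₀ ∈ Finset.range N,
      (hermiteFun k₀ x₀ : ℂ) * a i (Fin.cons k₀ k')) := by
  unfold sqInt
  rw [lintegral_finCons (measurable_sqSum_rpow a)]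
  simp_rw [sqSum_cons']

lemma sqInt_synthesis_le (J : Finset ℤ) (v : ℝ) (hp : 1 < p) (a : ι × J → (Fin (l + 1) → ℕ) → ℂ) :
    sqInt p N (fun i k => ∑ j : J, (starRingEnd ℂ) (sqSymbol (Real.exp (v + (j : ℤ))) (2 * k 0 + 1)) *
      a (i, j) k) ≤ lpConst p sqConst * sqInt p N a := by
  rw [sqInt_succ, sqInt_succ, ← lintegral_const_mul' _ _ (lpConst_ne_top hp)]
  refine lintegral_mono fun x' => ?_
  refine le_of_eq_of_le ?_ (synthesis_le J v hp N fun q k₀ =>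
    ∑ k' ∈ box N l, hermiteFunNC k' x' * a q (Fin.cons k₀ k'))
  refine lintegral_congr fun x₀ => ?_
  congr 1
  refine Finset.sum_congr rfl fun i _ => ?_
  congr 2
  refine Finset.sum_congr rfl fun k₀ _ => ?_
  congr 1
  simp_rw [Finset.mul_sum, Fin.cons_zero]
  rw [Finset.sum_comm]
  exact Finset.sum_congr rfl fun j _ => Finset.sum_congr rfl fun k' _ => by ring

lemma sqInt_analysis_le (J : Finset ℤ) (v : ℝ) (hp : 1 < p) (a : ι → (Fin (l + 1) → ℕ) → ℂ) :
    sqInt p N (fun (q : ι × J) k => sqSymbol (Real.exp (v + (q.2 : ℤ))) (2 * k 0 + 1) * a q.1 k) ≤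
      lpConst p sqConst * sqInt p N a := by
  rw [sqInt_succ, sqInt_succ, ← lintegral_const_mul' _ _ (lpConst_ne_top hp)]
  refine lintegral_mono fun x' => ?_
  refine le_of_eq_of_le ?_ (analysis_le J v hp N fun i k₀ =>
    ∑ k' ∈ box N l, hermiteFunNC k' x' * a i (Fin.cons k₀ k'))
  refine lintegral_congr fun x₀ => ?_
  congr 1
  refine Finset.sum_congr rfl fun i _ => ?_
  congr 2
  refine Finset.sum_congr rfl fun k₀ _ => ?_
  congr 1
  simp_rw [Finset.mul_sum, Fin.cons_zero]
  exact Finset.sum_congr rfl fun k' _ => by ring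

lemma sqInt_integral_le (hp : 1 < p) {B : ℝ → ι → (Fin l → ℕ) → ℂ}
    (hB : ∀ i k, Continuous fun v => B v i k) {D : ℝ≥0∞} (hD : ∀ v, sqInt p N (B v) ≤ D) :
    sqInt p N (fun i k => ∫ v in (0 : ℝ)..1, B v i k) ≤ D := by
  set μ : Measure ℝ := volume.restrict (Set.Ioc 0 1) with hμ
  have : IsProbabilityMeasure μ := ⟨by simp [hμ]⟩
  have hp0 : 0 < p := by linarith
  have key : ∀ x, sqSum N (fun i k => ∫ v in (0 : ℝ)..1, B v i k) x ^ (p / 2) ≤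
      ∫⁻ v, sqSum N (B v) x ^ (p / 2) ∂μ := by
    intro x
    set w : ℝ → EuclideanSpace ℂ ι := fun v =>
      WithLp.toLp 2 fun i => ∑ k ∈ box N l, hermiteFunNC k x * B v i k with hw
    have hwc : Continuous w := by
      refine (PiLp.continuous_toLp 2 _).comp (continuous_pi fun i => continuous_finsetSum _ fun k _ => ?_)
      exact continuous_const.mul (hB i k)
    have hwi : Integrable w μ := (hwc.integrableOn_Icc (a := 0) (b := 1)).mono_set Set.Ioc_subset_Icc_self
    have hBi : ∀ i k, Integrable (fun v => B v i k) μ := fun i k =>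
      ((hB i k).integrableOn_Icc (a := 0) (b := 1)).mono_set Set.Ioc_subset_Icc_self
    have e1 : sqSum N (fun i k => ∫ v in (0 : ℝ)..1, B v i k) x ^ (p / 2) = ‖∫ v, w v ∂μ‖ₑ ^ p := by
      rw [EuclideanSpace.enorm_rpow_eq]
      unfold sqSum
      congr 1
      refine Finset.sum_congr rfl fun i _ => ?_
      congr 2
      have : ∫ v, w v i ∂μ = (∫ v, w v ∂μ) i :=
        (EuclideanSpace.proj (𝕜 := ℂ) i).integral_comp_comm hwi
      rw [← this, hw]
      simp only
      rw [integral_finsetSum _ fun k _ => (hBi i k).const_mul _]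
      refine Finset.sum_congr rfl fun k _ => ?_
      rw [integral_const_mul, intervalIntegral.integral_of_le zero_le_one]
    have e2 : ∀ v, sqSum N (B v) x ^ (p / 2) = ‖w v‖ₑ ^ p := fun v => by
      rw [EuclideanSpace.enorm_rpow_eq]; rfl
    simp_rw [e1, e2]
    have h1 := eLpNorm_le_eLpNorm_of_exponent_le (p := 1) (q := ENNReal.ofReal p)
      (by simpa using hp.le) (hwc.aestronglyMeasurable (μ := μ))
    rw [eLpNorm_one_eq_lintegral_enorm, eLpNorm_eq_lintegral_rpow_enorm_toReal (by simpa using hp0) (by simp),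
      ENNReal.toReal_ofReal hp0.le] at h1
    have h2 := ENNReal.rpow_le_rpow ((enorm_integral_le_lintegral_enorm w).trans h1) hp0.le
    rwa [← ENNReal.rpow_mul, one_div_mul_cancel hp0.ne', ENNReal.rpow_one] at h2
  calc sqInt p N (fun i k => ∫ v in (0 : ℝ)..1, B v i k)
      ≤ ∫⁻ x : Fin l → ℝ, ∫⁻ v, sqSum N (B v) x ^ (p / 2) ∂μ := lintegral_mono key
    _ = ∫⁻ v, sqInt p N (B v) ∂μ := by
        rw [lintegral_lintegral_swap]
        · rfl
        · exact (((continuous_sqSum N hB).comp continuous_swap).measurable.pow_const _).aemeasurable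
    _ ≤ ∫⁻ _, D ∂μ := lintegral_mono fun v => hD v
    _ = D := by simp

lemma sqInt_le_of_tendsto {B : ℕ → ι → (Fin l → ℕ) → ℂ} {a : ι → (Fin l → ℕ) → ℂ}
    (hB : ∀ i k, Filter.Tendsto (fun n => B n i k) Filter.atTop (nhds (a i k)))
    {D : ℝ≥0∞} (hD : ∀ n, sqInt p N (B n) ≤ D) : sqInt p N a ≤ D := by
  have hlim : ∀ x, Filter.Tendsto (fun n => sqSum N (B n) x ^ (p / 2)) Filter.atTop
      (nhds (sqSum N a x ^ (p / 2))) := by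
    intro x
    refine (ENNReal.continuous_rpow_const.tendsto _).comp (tendsto_finsetSum _ fun i _ => ?_)
    refine ((ENNReal.continuous_pow 2).tendsto _).comp (Filter.Tendsto.enorm ?_)
    exact tendsto_finsetSum _ fun k _ => (hB i k).const_mul _
  calc sqInt p N a = ∫⁻ x, Filter.liminf (fun n => sqSum N (B n) x ^ (p / 2)) Filter.atTop :=
        lintegral_congr fun x => (hlim x).liminf_eq.symm
    _ ≤ Filter.liminf (fun n => sqInt p N (B n)) Filter.atTop :=
        lintegral_liminf_le fun n => measurable_sqSum_rpow _
    _ ≤ D := by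
        refine Filter.liminf_le_of_frequently_le' (Filter.Frequently.of_forall hD)

end

/-- A function on the sector which is holomorphic in each variable and bounded by `M`. -/
structure IsSymbol {l : ℕ} (ψ M : ℝ) (m : (Fin l → ℂ) → ℂ) : Prop where
  holo : ∀ z ∈ sectorN l ψ, ∀ j, DifferentiableAt ℂ (fun w => m (Function.update z j w)) (z j)
  bound : ∀ z ∈ sectorN l ψ, ‖m z‖ ≤ M

/-- The point of the joint spectrum with multi-index `k`. -/
def spec {l : ℕ} (k : Fin l → ℕ) : Fin l → ℂ := fun j => 2 * (k j : ℂ) + 1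

/-- The square function estimate for families of symbols. -/
def MultBound (l : ℕ) (ψ M p : ℝ) (C : ℝ≥0∞) : Prop :=
  ∀ (ι : Type) [Fintype ι] (m : ι → (Fin l → ℂ) → ℂ), (∀ i, IsSymbol ψ M (m i)) →
    ∀ (N : ℕ) (a : ι → (Fin l → ℕ) → ℂ),
      sqInt p N (fun i k => m i (spec k) * a i k) ≤ C * sqInt p N a

variable {l : ℕ} {ψ M p : ℝ}

lemma spec_eq_ofReal (k : ℕ) : (2 * (k : ℂ) + 1) = ((2 * k + 1 : ℝ) : ℂ) := by push_cast; ring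

lemma spec_mem (hψ : Real.pi / 4 < ψ) (k : Fin l → ℕ) : spec k ∈ sectorN l ψ := by
  intro j
  unfold spec
  rw [spec_eq_ofReal, Complex.arg_ofReal_of_nonneg (by positivity), abs_zero]
  linarith [Real.pi_pos]

lemma cons_mem {z₀ : ℂ} {z : Fin l → ℂ} (h₀ : |Complex.arg z₀| < ψ) (h : z ∈ sectorN l ψ) :
    (Fin.cons z₀ z : Fin (l + 1) → ℂ) ∈ sectorN (l + 1) ψ := by
  intro j
  refine Fin.cases ?_ (fun j => ?_) j
  · simpa using h₀
  · simpa using h j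

lemma spec_cons (k₀ : ℕ) (k : Fin l → ℕ) :
    spec (Fin.cons k₀ k : Fin (l + 1) → ℕ) = Fin.cons (2 * (k₀ : ℂ) + 1) (spec k) := by
  funext j
  refine Fin.cases ?_ (fun j => ?_) j <;> simp [spec]

lemma IsSymbol.cons {m : (Fin (l + 1) → ℂ) → ℂ} (hm : IsSymbol ψ M m) {z₀ : ℂ}
    (h₀ : |Complex.arg z₀| < ψ) : IsSymbol ψ M fun z => m (Fin.cons z₀ z) where
  holo z hz j := by
    have := hm.holo _ (cons_mem h₀ hz) j.succ
    simpa [Fin.cons_update] using this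
  bound z hz := hm.bound _ (cons_mem h₀ hz)

lemma IsSymbol.differentiableAt {m : (Fin (l + 1) → ℂ) → ℂ} (hm : IsSymbol ψ M m) {z₀ : ℂ}
    {z : Fin l → ℂ} (h₀ : |Complex.arg z₀| < ψ) (hz : z ∈ sectorN l ψ) :
    DifferentiableAt ℂ (fun w => m (Fin.cons w z)) z₀ := by
  have := hm.holo _ (cons_mem h₀ hz) 0
  simpa [Fin.update_cons_zero] using this

lemma IsSymbol.add {m m' : (Fin l → ℂ) → ℂ} {M' : ℝ} (hm : IsSymbol ψ M m) (hm' : IsSymbol ψ M' m') :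
    IsSymbol ψ (M + M') fun z => m z + m' z where
  holo z hz j := (hm.holo z hz j).add (hm'.holo z hz j)
  bound z hz := (norm_add_le _ _).trans (add_le_add (hm.bound z hz) (hm'.bound z hz))

lemma IsSymbol.const_mul {m : (Fin l → ℂ) → ℂ} (c : ℂ) (hm : IsSymbol ψ M m) :
    IsSymbol ψ (‖c‖ * M) fun z => c * m z where
  holo z hz j := (hm.holo z hz j).const_mul c
  bound z hz := by
    rw [norm_mul]
    exact mul_le_mul_of_nonneg_left (hm.bound z hz) (norm_nonneg c)

lemma MultBound.tail {C : ℝ≥0∞} (h : MultBound l ψ M p C) (hC : C ≠ ∞) {ι : Type} [Fintype ι]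
    {m : ι → (Fin l → ℂ) → ℂ} (hm : ∀ i, IsSymbol ψ M (m i)) (N : ℕ) (a : ι → (Fin (l + 1) → ℕ) → ℂ) :
    sqInt p N (fun i k => m i (spec (Fin.tail k)) * a i k) ≤ C * sqInt p N a := by
  rw [sqInt_succ', sqInt_succ', ← lintegral_const_mul' _ _ hC]
  refine lintegral_mono fun x₀ => ?_
  refine le_of_eq_of_le ?_ (h ι m hm N _)
  congr 1
  funext i k'
  rw [Finset.mul_sum]
  refine Finset.sum_congr rfl fun k₀ _ => ?_
  rw [Fin.tail_cons]
  ring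

/-- The average of the boundary values of a symbol in the first variable. -/
noncomputable def edgeSymbol (m : (Fin (l + 1) → ℂ) → ℂ) (v : ℝ) (z : Fin l → ℂ) : ℂ :=
  (2 / coshMass : ℂ) * (m (Fin.cons ((1 + I) * Real.exp v) z) + m (Fin.cons ((1 - I) * Real.exp v) z))

lemma IsSymbol.edgeSymbol {m : (Fin (l + 1) → ℂ) → ℂ} (hψ : Real.pi / 4 < ψ) (hm : IsSymbol ψ M m)
    (v : ℝ) : IsSymbol ψ (‖(2 / coshMass : ℂ)‖ * (M + M)) (edgeSymbol m v) :=
  ((hm.cons (arg_one_add_I_mul_exp hψ v)).add (hm.cons (arg_one_sub_I_mul_exp hψ v))).const_mul _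

lemma IsSymbol.continuous_edgeSymbol {m : (Fin (l + 1) → ℂ) → ℂ} (hψ : Real.pi / 4 < ψ)
    (hm : IsSymbol ψ M m) {z : Fin l → ℂ} (hz : z ∈ sectorN l ψ) :
    Continuous fun v => HermiteMult.edgeSymbol m v z := by
  unfold HermiteMult.edgeSymbol
  refine continuous_const.mul (Continuous.add ?_ ?_) <;> refine continuous_iff_continuousAt.2 fun v => ?_
  · exact ContinuousAt.comp (g := fun w => m (Fin.cons w z)) (f := fun v : ℝ => (1 + I) * (Real.exp v : ℂ))
      (hm.differentiableAt (arg_one_add_I_mul_exp hψ v) hz).continuousAt (by fun_prop)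
  · exact ContinuousAt.comp (g := fun w => m (Fin.cons w z)) (f := fun v : ℝ => (1 - I) * (Real.exp v : ℂ))
      (hm.differentiableAt (arg_one_sub_I_mul_exp hψ v) hz).continuousAt (by fun_prop)

lemma continuous_sqSymbol {l : ℝ} (hl : 0 < l) : Continuous fun s => sqSymbol s l := by
  unfold sqSymbol
  exact Continuous.div (by fun_prop) (by fun_prop) fun s => sqSymbol_den_ne_zero hl

/-- The discretized multiplier with parameter `v`. -/
noncomputable def dyadMult (m : (Fin (l + 1) → ℂ) → ℂ) (J : Finset ℤ) (v : ℝ) (k : Fin (l + 1) → ℕ) : ℂ :=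
  ∑ j ∈ J, edgeSymbol m (v + (j : ℤ)) (spec (Fin.tail k)) *
    (sqSymbol (Real.exp (v + (j : ℤ))) (2 * k 0 + 1) *
      (starRingEnd ℂ) (sqSymbol (Real.exp (v + (j : ℤ))) (2 * k 0 + 1)))

lemma IsSymbol.continuous_dyadMult {m : (Fin (l + 1) → ℂ) → ℂ} (hψ : Real.pi / 4 < ψ)
    (hm : IsSymbol ψ M m) (J : Finset ℤ) (k : Fin (l + 1) → ℕ) : Continuous fun v => dyadMult m J v k := by
  unfold dyadMult
  refine continuous_finsetSum _ fun j _ => ?_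
  have h1 : Continuous fun v : ℝ => v + ((j : ℤ) : ℝ) := by fun_prop
  have h2 := (continuous_sqSymbol (l := 2 * k 0 + 1) (by positivity)).comp (Real.continuous_exp.comp h1)
  exact ((hm.continuous_edgeSymbol hψ (spec_mem hψ _)).comp h1).mul
    (h2.mul (Complex.continuous_conj.comp h2))

lemma IsSymbol.tendsto_integral_dyadMult {m : (Fin (l + 1) → ℂ) → ℂ} (hψ : Real.pi / 4 < ψ)
    (hm : IsSymbol ψ M m) (k : Fin (l + 1) → ℕ) :
    Filter.Tendsto (fun n => ∫ v in (0 : ℝ)..1, dyadMult m (dyadRange n) v k) Filter.atTop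
      (nhds (m (spec k))) := by
  have hz := spec_mem hψ (Fin.tail k)
  have h := sector_formula (l := 2 * k 0 + 1) hψ (g := fun w => m (Fin.cons w (spec (Fin.tail k))))
    (fun z h => hm.differentiableAt h hz) (fun z h => hm.bound _ (cons_mem h hz)) (by positivity)
  rw [← spec_eq_ofReal, ← spec_cons, Fin.cons_self_tail] at h
  exact h

lemma MultBound.dyadMult_le {C : ℝ≥0∞} (hψ : Real.pi / 4 < ψ) (hp : 1 < p)
    (h : MultBound l ψ (‖(2 / coshMass : ℂ)‖ * (M + M)) p C) (hC : C ≠ ∞) {ι : Type} [Fintype ι]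
    {m : ι → (Fin (l + 1) → ℂ) → ℂ} (hm : ∀ i, IsSymbol ψ M (m i)) (J : Finset ℤ) (v : ℝ) (N : ℕ)
    (a : ι → (Fin (l + 1) → ℕ) → ℂ) :
    sqInt p N (fun i k => dyadMult (m i) J v k * a i k) ≤
      lpConst p sqConst * (C * (lpConst p sqConst * sqInt p N a)) := by
  refine le_trans ?_ (mul_le_mul' le_rfl (mul_le_mul' le_rfl (sqInt_analysis_le J v hp a)))
  refine le_trans ?_ (mul_le_mul' le_rfl (h.tail hC
    (m := fun (q : ι × J) => edgeSymbol (m q.1) (v + (q.2 : ℤ))) (fun q => (hm q.1).edgeSymbol hψ _) N _))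
  refine le_of_eq_of_le ?_ (sqInt_synthesis_le J v hp _)
  congr 1
  funext i k
  unfold dyadMult
  rw [Finset.sum_mul, ← Finset.sum_coe_sort J]
  refine Finset.sum_congr rfl fun j _ => ?_
  ring

lemma MultBound.succ {C : ℝ≥0∞} (hψ : Real.pi / 4 < ψ) (hp : 1 < p)
    (h : MultBound l ψ (‖(2 / coshMass : ℂ)‖ * (M + M)) p C) (hC : C ≠ ∞) :
    MultBound (l + 1) ψ M p (lpConst p sqConst * (C * lpConst p sqConst)) := by
  intro ι _ m hm N a
  refine sqInt_le_of_tendsto (B := fun n i k => ∫ v in (0 : ℝ)..1, dyadMult (m i) (dyadRange n) v k * a i k)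
    (fun i k => ?_) fun n => sqInt_integral_le hp (fun i k => ?_) fun v => ?_
  · simp_rw [intervalIntegral.integral_mul_const]
    exact ((hm i).tendsto_integral_dyadMult hψ k).mul_const _
  · exact ((hm i).continuous_dyadMult hψ _ k).mul continuous_const
  · rw [mul_assoc, mul_assoc]
    exact h.dyadMult_le hψ hp hC hm _ v N a

lemma MultBound.zero (hp : 1 < p) : MultBound 0 ψ M p (ENNReal.ofReal M ^ p) := by
  intro ι _ m hm N a
  unfold sqInt
  rw [← lintegral_const_mul' _ _ (by finiteness)]
  refine lintegral_mono fun x => ?_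
  have hpp : ENNReal.ofReal M ^ p = (ENNReal.ofReal M ^ 2) ^ (p / 2) := by
    rw [← ENNReal.rpow_natCast, ← ENNReal.rpow_mul]; congr 1; push_cast; ring
  rw [hpp, ← ENNReal.mul_rpow_of_nonneg _ _ (by linarith)]
  refine ENNReal.rpow_le_rpow ?_ (by linarith)
  unfold sqSum
  rw [Finset.mul_sum]
  refine Finset.sum_le_sum fun i _ => ?_
  rw [← mul_pow]
  gcongr
  have e : ∀ k ∈ box N 0, hermiteFunNC k x * (m i (spec k) * a i k) =
      m i (spec ![]) * (hermiteFunNC k x * a i k) := by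
    intro k _
    rw [Subsingleton.elim k ![]]; ring
  rw [Finset.sum_congr rfl e, ← Finset.mul_sum, enorm_mul]
  gcongr
  rw [← ofReal_norm]
  exact ENNReal.ofReal_le_ofReal ((hm i).bound _ fun j => j.elim0)

theorem exists_multBound (hψ : Real.pi / 4 < ψ) (hp : 1 < p) (l : ℕ) :
    ∀ M : ℝ, ∃ C : ℝ≥0∞, C ≠ ∞ ∧ MultBound l ψ M p C := by
  have := lpConst_ne_top (C := sqConst) hp
  induction l with
  | zero => exact fun M => ⟨_, by finiteness, MultBound.zero hp⟩
  | succ l ih =>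
    intro M
    obtain ⟨C, hC, h⟩ := ih (‖(2 / coshMass : ℂ)‖ * (M + M))
    exact ⟨_, by finiteness, h.succ hψ hp hC⟩

/-! ### Hermite expansions in several variables -/

variable {n : ℕ}

lemma integrable_hermiteFunNC_mul (k k' : Fin n → ℕ) :
    Integrable fun x => hermiteFunNC k x * hermiteFunNC k' x := by
  have h : Integrable fun x : Fin n → ℝ => ∏ j, (hermiteFun (k j) (x j) * hermiteFun (k' j) (x j)) :=
    Integrable.fintype_prod fun j => integrable_hermiteFun_mul _ _
  have h2 : Integrable fun x : Fin n → ℝ =>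
    ((∏ j, (hermiteFun (k j) (x j) * hermiteFun (k' j) (x j)) : ℝ) : ℂ) := h.ofReal
  refine h2.congr (Filter.Eventually.of_forall fun x => ?_)
  simp [hermiteFunNC, Finset.prod_mul_distrib]

lemma integral_hermiteFunNC_mul (k k' : Fin n → ℕ) :
    ∫ x, hermiteFunNC k x * hermiteFunNC k' x = if k = k' then 1 else 0 := by
  have e : ∀ x : Fin n → ℝ, hermiteFunNC k x * hermiteFunNC k' x =
      ((∏ j, (hermiteFun (k j) (x j) * hermiteFun (k' j) (x j)) : ℝ) : ℂ) := fun x => by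
    simp [hermiteFunNC, Finset.prod_mul_distrib]
  simp_rw [e]
  rw [integral_complex_ofReal,
    integral_fintype_prod_volume_eq_prod fun j u => hermiteFun (k j) u * hermiteFun (k' j) u]
  simp_rw [integral_hermiteFun_mul]
  rw [Finset.prod_ite_zero]
  simp only [Finset.mem_univ, true_imp_iff, Finset.prod_const_one, funext_iff]
  split_ifs <;> simp

lemma hermiteCoeff_sum (S : Finset (Fin n → ℕ)) (a : (Fin n → ℕ) → ℂ) (k : Fin n → ℕ) :
    hermiteCoeff k (fun x => ∑ k' ∈ S, hermiteFunNC k' x * a k') = if k ∈ S then a k else 0 := by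
  unfold hermiteCoeff
  simp_rw [Finset.mul_sum, ← mul_assoc]
  rw [integral_finsetSum _ fun k' _ => (integrable_hermiteFunNC_mul k k').mul_const _]
  simp_rw [integral_mul_const, integral_hermiteFunNC_mul]
  simp

lemma hermiteMultiplier_sum (m : (Fin n → ℂ) → ℂ) (S : Finset (Fin n → ℕ)) (a : (Fin n → ℕ) → ℂ)
    (x : Fin n → ℝ) :
    hermiteMultiplier m (fun x => ∑ k ∈ S, hermiteFunNC k x * a k) x =
      ∑ k ∈ S, hermiteFunNC k x * (m (spec k) * a k) := by
  unfold hermiteMultiplier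
  simp_rw [hermiteCoeff_sum]
  rw [finsum_eq_sum_of_support_subset (s := S)]
  · refine Finset.sum_congr rfl fun k hk => ?_
    rw [if_pos hk]
    unfold spec
    ring
  · intro k hk
    by_contra h
    rw [Finset.mem_coe] at h
    simp [h] at hk

lemma exists_box_of_mem_span {f : (Fin n → ℝ) → ℂ}
    (hf : f ∈ Submodule.span ℂ (Set.range (hermiteFunNC (n := n)))) :
    ∃ (N : ℕ) (a : (Fin n → ℕ) → ℂ), f = fun x => ∑ k ∈ box N n, hermiteFunNC k x * a k := by
  obtain ⟨c, rfl⟩ := Finsupp.mem_span_range_iff_exists_finsupp.1 hf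
  refine ⟨(c.support.sup fun k => ∑ j, k j) + 1, c, ?_⟩
  funext x
  unfold Finsupp.sum
  rw [Finset.sum_apply]
  simp only [Pi.smul_apply, smul_eq_mul]
  simp_rw [mul_comm (hermiteFunNC _ x)]
  refine Finset.sum_subset (fun k hk => ?_) fun k _ hk => ?_
  · simp only [box, Fintype.mem_piFinset, Finset.mem_range]
    intro j
    have h1 : k j ≤ ∑ j, k j := Finset.single_le_sum (fun _ _ => Nat.zero_le _) (Finset.mem_univ j)
    have h2 := Finset.le_sup (f := fun k : Fin n → ℕ => ∑ j, k j) hk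
    exact Nat.lt_succ_of_le (h1.trans h2)
  · rw [Finsupp.notMem_support_iff.1 hk, zero_mul]

lemma eLpNorm_sum_eq {p : ℝ≥0∞} (hp0 : p ≠ 0) (hp : p ≠ ∞) (N : ℕ) (a : (Fin n → ℕ) → ℂ) :
    eLpNorm (fun x => ∑ k ∈ box N n, hermiteFunNC k x * a k) p volume =
      sqInt p.toReal N (fun _ : Unit => a) ^ (1 / p.toReal) := by
  rw [eLpNorm_eq_lintegral_rpow_enorm_toReal hp0 hp]
  unfold sqInt sqSum
  congr 1
  refine lintegral_congr fun x => ?_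
  rw [Finset.univ_unique, Finset.sum_singleton, ← ENNReal.rpow_natCast, ← ENNReal.rpow_mul]
  congr 1
  push_cast
  ring

end HermiteMult

/-- Scalar multivariate Hermite spectral multiplier theorem: if `m` is bounded and
holomorphic on the sector `Γ_ψ` with `ψ > π/4`, then for every `1 < p < ∞` the
operator `T_m` is bounded on `L^p(ℝⁿ)` on the span of the Hermite functions. -/
theorem hermiteMultiplier_bounded {n : ℕ} (ψ : ℝ) (hψ : Real.pi / 4 < ψ)
    (m : (Fin n → ℂ) → ℂ)
    (hm_holo : ∀ z ∈ sectorN n ψ, ∀ j,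
      DifferentiableAt ℂ (fun w => m (Function.update z j w)) (z j))
    (hm_bdd : ∃ M : ℝ, ∀ z ∈ sectorN n ψ, ‖m z‖ ≤ M)
    (p : ℝ≥0∞) (hp1 : 1 < p) (hp2 : p ≠ ⊤) :
    ∃ C : ℝ, 0 < C ∧ ∀ f : (Fin n → ℝ) → ℂ,
      f ∈ Submodule.span ℂ (Set.range (hermiteFunNC (n := n))) →
      eLpNorm (hermiteMultiplier m f) p volume ≤
        ENNReal.ofReal C * eLpNorm f p volume := by
  obtain ⟨M, hM⟩ := hm_bdd
  have hp : 1 < p.toReal := by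
    rw [← ENNReal.toReal_one]
    exact (ENNReal.toReal_lt_toReal (by simp) hp2).2 hp1
  have hp0 : p ≠ 0 := (zero_lt_one.trans hp1).ne'
  obtain ⟨D, hD, h⟩ := HermiteMult.exists_multBound hψ hp n M
  have hr : 0 ≤ 1 / p.toReal := by positivity
  have hD' : D ^ (1 / p.toReal) ≠ ∞ := ENNReal.rpow_ne_top_of_nonneg hr hD
  refine ⟨(D ^ (1 / p.toReal)).toReal + 1, by positivity, fun f hf => ?_⟩
  obtain ⟨N, a, rfl⟩ := HermiteMult.exists_box_of_mem_span hf
  have e : hermiteMultiplier m (fun x => ∑ k ∈ HermiteMult.box N n, hermiteFunNC k x * a k) =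
      fun x => ∑ k ∈ HermiteMult.box N n, hermiteFunNC k x * (m (HermiteMult.spec k) * a k) :=
    funext (HermiteMult.hermiteMultiplier_sum m _ a)
  rw [e, HermiteMult.eLpNorm_sum_eq hp0 hp2, HermiteMult.eLpNorm_sum_eq hp0 hp2]
  refine (ENNReal.rpow_le_rpow (h Unit (fun _ => m) (fun _ => ⟨hm_holo, hM⟩) N fun _ => a) hr).trans ?_
  rw [ENNReal.mul_rpow_of_nonneg _ _ hr]
  refine mul_le_mul' ?_ le_rfl
  rw [← ENNReal.ofReal_toReal hD']
  exact ENNReal.ofReal_le_ofReal (by rw [ENNReal.ofReal_toReal hD']; linarith)
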